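/- Let K ⊆ ℂ be a compact set whose complement Ω := ℂ∞ ∖ K is a finitely connected domain with C^∞ boundary, and let S be a set containing at least one point in each connected component of the interior of K. Then for every ε > 0 there exist rational functions R₁ and R₂, each vanishing at ∞ and with all poles in S, such that (1/2π) ∫_{∂Ω} |1 + R₂(z)|² |dz| − ε ≤ γ(K) ≤ 2 Re R₁′(∞) − (1/2π) ∫_{∂Ω} |R₁(z)|² |dz| + ε. -/

import Mathlib

open Complex Filter Metric Set Topology Bornology MeasureTheory

noncomputable section

/-- `f` has value `l` at infinity and derivative `w` at infinity (within the set `s`), i.e.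
`f(z) → l` and `z (f(z) - l) → w` as `z → ∞` within `s`. -/
def HasDerivAtInftyOn (f : ℂ → ℂ) (s : Set ℂ) (l w : ℂ) : Prop :=
  Tendsto f (cobounded ℂ ⊓ 𝓟 s) (𝓝 l) ∧
    Tendsto (fun z => z * (f z - l)) (cobounded ℂ ⊓ 𝓟 s) (𝓝 w)

/-- The analytic capacity of a plane set `K`:
`γ(K) = sup { |f′(∞)| : f` holomorphic on `ℂ∞ ∖ K`, `‖f‖ ≤ 1 }`. -/
def analyticCapacity (K : Set ℂ) : ℝ :=
  sSup { r : ℝ | ∃ (f : ℂ → ℂ) (l w : ℂ),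
    DifferentiableOn ℂ f Kᶜ ∧ (∀ z ∈ Kᶜ, ‖f z‖ ≤ 1) ∧
    HasDerivAtInftyOn f Kᶜ l w ∧ r = ‖w‖ }

/-- Data exhibiting the boundary of a compact set `K ⊆ ℂ` as a finite union of pairwise
disjoint `C^∞` Jordan curves, positively oriented: each curve is a `1`-periodic regular `C^∞`
parametrization, injective on a period, the curve images are pairwise disjoint and their union
is the frontier of `K`, and the total winding number around every point of `interior K` is `1`
(counterclockwise orientation). -/
structure SmoothBoundary (K : Set ℂ) where
  n : ℕ
  npos : 0 < n
  curve : Fin n → ℝ → ℂ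
  smooth : ∀ i, ContDiff ℝ (⊤ : ℕ∞) (curve i)
  periodic : ∀ i, Function.Periodic (curve i) 1
  injOn : ∀ i, Set.InjOn (curve i) (Set.Ico (0:ℝ) 1)
  regular : ∀ i t, deriv (curve i) t ≠ 0
  boundary : (⋃ i, Set.range (curve i)) = frontier K
  disjointCurves : ∀ i j, i ≠ j → Disjoint (Set.range (curve i)) (Set.range (curve j))
  orientation : ∀ w ∈ interior K,
    (∑ i, ∫ t in (0:ℝ)..1, deriv (curve i) t / (curve i t - w)) = 2 * Real.pi * Complex.I

/-- The contour integral `∫_{∂Ω} f(ζ) dζ` over a finite family of parametrized curves. -/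
def contourIntegralOf {n : ℕ} (curve : Fin n → ℝ → ℂ) (f : ℂ → ℂ) : ℂ :=
  ∑ i, ∫ t in (0:ℝ)..1, f (curve i t) * deriv (curve i) t

/-- The arc-length integral `∫_{∂Ω} f(ζ) |dζ|` over a finite family of parametrized curves. -/
def arcIntegralOf {n : ℕ} (curve : Fin n → ℝ → ℂ) (f : ℂ → ℝ) : ℝ :=
  ∑ i, ∫ t in (0:ℝ)..1, f (curve i t) * ‖deriv (curve i) t‖

/-- `f ∈ A(Ω)` with value `l` at `∞`, where `Ω = ℂ∞ ∖ K`: `f` is continuous on the closure of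
`Ω` (whose finite part is `(interior K)ᶜ`), holomorphic on `Ω`, and `f(z) → l` as `z → ∞`. -/
def MemA (K : Set ℂ) (f : ℂ → ℂ) (l : ℂ) : Prop :=
  ContinuousOn f (interior K)ᶜ ∧ DifferentiableOn ℂ f Kᶜ ∧
    Tendsto f (cobounded ℂ ⊓ 𝓟 Kᶜ) (𝓝 l)

/-- `R` is a rational function vanishing at `∞` with all (finite) poles in `S`:
a finite sum of terms `c/(z − s)^k` with `s ∈ S`, `k ≥ 1`. -/
def IsRationalVanishingAtInftyWithPoles (S : Set ℂ) (R : ℂ → ℂ) : Prop :=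
  ∃ (N d : ℕ) (s : Fin N → ℂ) (c : Fin N → Fin d → ℂ),
    (∀ i, s i ∈ S) ∧
    R = fun z => ∑ i, ∑ k : Fin d, c i k / (z - s i) ^ ((k : ℕ) + 1)

set_option linter.unusedVariables false

section

/-- a regular smooth Jordan curve -/
structure JC (γ : ℝ → ℂ) : Prop where
  smooth : ContDiff ℝ (⊤ : ℕ∞) γ
  periodic : Function.Periodic γ 1
  injOn : Set.InjOn γ (Set.Ico (0:ℝ) 1)
  regular : ∀ t, deriv γ t ≠ 0

/-- averaged chord direction -/
def chordI (γ : ℝ → ℂ) (v x : ℝ) : ℂ := ∫ τ in (0:ℝ)..1, deriv γ (v + τ * x)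

namespace JC
variable {γ : ℝ → ℂ}

lemma cont (h : JC γ) : Continuous γ := h.smooth.continuous

lemma contDeriv (h : JC γ) : Continuous (deriv γ) :=
  h.smooth.continuous_deriv (by norm_cast)

lemma hasDeriv (h : JC γ) (t : ℝ) : HasDerivAt γ (deriv γ t) t :=
  ((h.smooth.differentiable (by simp)) t).hasDerivAt

lemma periodicDeriv (h : JC γ) : Function.Periodic (deriv γ) 1 := by
  intro t
  have h1 : HasDerivAt (fun s => γ (s + 1)) (deriv γ (t + 1)) t := by
    have := (h.hasDeriv (t+1)).comp_add_const t 1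
    simpa using this
  have h2 : (fun s => γ (s + 1)) = γ := funext h.periodic
  rw [h2] at h1
  exact h1.deriv.symm

lemma contChord (h : JC γ) : Continuous (fun p : ℝ × ℝ => chordI γ p.1 p.2) := by
  unfold chordI
  apply intervalIntegral.continuous_parametric_intervalIntegral_of_continuous'
  have := h.contDeriv
  simp only [Function.uncurry_def]
  fun_prop

lemma chord_eq (h : JC γ) (v x : ℝ) : γ (v + x) - γ v = x * chordI γ v x := by
  unfold chordI
  have : ∫ τ in (0:ℝ)..1, (x:ℂ) * deriv γ (v + τ * x) = γ (v + 1 * x) - γ (v + 0 * x) := by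
    apply intervalIntegral.integral_eq_sub_of_hasDerivAt (f := fun τ : ℝ => γ (v + τ * x))
    · intro τ _
      have h1 : HasDerivAt (fun τ : ℝ => v + τ * x) x τ := by
        simpa using ((hasDerivAt_id τ).mul_const x).const_add v
      have := (h.hasDeriv (v + τ * x)).scomp τ h1
      simpa [Function.comp_def] using this
    · have := h.contDeriv
      apply Continuous.intervalIntegrable
      fun_prop
  rw [intervalIntegral.integral_const_mul] at this
  simp at this
  rw [this]

lemma chord_zero (v : ℝ) : chordI γ v 0 = deriv γ v := by
  simp [chordI]

lemma per_int (h : JC γ) (u : ℝ) (n : ℤ) : γ (u + n) = γ u := by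
  simpa using h.periodic.int_mul n u

lemma perD_int (h : JC γ) (u : ℝ) (n : ℤ) : deriv γ (u + n) = deriv γ u := by
  simpa using h.periodicDeriv.int_mul n u

lemma inj_mod (h : JC γ) {u v : ℝ} (e : γ u = γ v) : ∃ n : ℤ, u = v + n := by
  have hu : γ (Int.fract u) = γ u := by
    have := h.per_int (Int.fract u) ⌊u⌋
    rw [Int.fract_add_floor] at this
    exact this.symm
  have hv : γ (Int.fract v) = γ v := by
    have := h.per_int (Int.fract v) ⌊v⌋
    rw [Int.fract_add_floor] at this
    exact this.symm
  have := h.injOn ⟨Int.fract_nonneg u, Int.fract_lt_one u⟩ ⟨Int.fract_nonneg v, Int.fract_lt_one v⟩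
    (by rw [hu, hv, e])
  refine ⟨⌊u⌋ - ⌊v⌋, ?_⟩
  push_cast
  have a := Int.fract_add_floor u
  have b := Int.fract_add_floor v
  linarith

lemma chord_ne (h : JC γ) {v x : ℝ} (hx : |x| < 1) : chordI γ v x ≠ 0 := by
  rcases eq_or_ne x 0 with rfl | h0
  · rw [chord_zero]; exact h.regular v
  · intro hz
    have := h.chord_eq v x
    rw [hz, mul_zero, sub_eq_zero] at this
    obtain ⟨n, hn⟩ := h.inj_mod this
    have hn' : x = n := by linarith
    rw [hn'] at hx h0
    have : |n| < 1 := by exact_mod_cast hx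
    rw [Int.abs_lt_one_iff] at this
    simp [this] at h0

lemma chord_per (h : JC γ) (v x : ℝ) (n : ℤ) : chordI γ (v + n) x = chordI γ v x := by
  unfold chordI
  congr 1
  ext τ
  rw [← h.perD_int (v + τ * x) n]
  congr 1; ring

lemma exists_bilip (h : JC γ) : ∃ c > 0, ∀ v x : ℝ, |x| ≤ 1/2 → c ≤ ‖chordI γ v x‖ := by
  have hc : IsCompact ((Icc (0:ℝ) 1) ×ˢ (Icc (-(1/2):ℝ) (1/2))) := isCompact_Icc.prod isCompact_Icc
  obtain ⟨p, hp, hmin⟩ := hc.exists_isMinOn (by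
    refine ⟨(0,0), ?_⟩; simp) (h.contChord.norm.continuousOn)
  refine ⟨‖chordI γ p.1 p.2‖, ?_, ?_⟩
  · rw [gt_iff_lt, norm_pos_iff]
    apply h.chord_ne
    have := hp.2
    rw [mem_Icc] at this
    rw [abs_lt]; constructor <;> linarith [this.1, this.2]
  · intro v x hx
    have e : chordI γ v x = chordI γ (Int.fract v) x := by
      rw [← h.chord_per (Int.fract v) x ⌊v⌋, Int.fract_add_floor]
    rw [e]
    apply hmin (a := (Int.fract v, x))
    refine ⟨⟨Int.fract_nonneg v, (Int.fract_lt_one v).le⟩, ?_⟩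
    exact abs_le.1 hx

lemma exists_lipD (h : JC γ) : ∃ L, 0 < L ∧ (∀ u, ‖deriv γ u‖ ≤ L) ∧
    ∀ u v, ‖deriv γ u - deriv γ v‖ ≤ L * |u - v| := by
  have hd : ContDiff ℝ 1 (deriv γ) := by
    have h2 : ContDiff ℝ 2 γ := h.smooth.of_le (by norm_cast)
    exact ((contDiff_succ_iff_deriv (n := 1)).1 (by simpa [one_add_one_eq_two] using h2)).2.2
  have hcd : Continuous (deriv (deriv γ)) := hd.continuous_deriv le_rfl
  obtain ⟨L1, hL1⟩ := isCompact_Icc.exists_bound_of_continuousOn (s := Icc (0:ℝ) 1) h.contDeriv.continuousOn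
  obtain ⟨L2, hL2⟩ := isCompact_Icc.exists_bound_of_continuousOn (s := Icc (0:ℝ) 1) hcd.continuousOn
  have hfr : ∀ u, Int.fract u ∈ Icc (0:ℝ) 1 := fun u => ⟨Int.fract_nonneg u, (Int.fract_lt_one u).le⟩
  have per2 : Function.Periodic (deriv (deriv γ)) 1 := by
    intro t
    have := deriv_comp_add_const (deriv γ) 1 t
    rw [← this]
    congr 1
    exact funext h.periodicDeriv
  have b1 : ∀ u, ‖deriv γ u‖ ≤ L1 := by
    intro u
    have := hL1 _ (hfr u)
    rwa [← h.perD_int (Int.fract u) ⌊u⌋, Int.fract_add_floor] at this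
  have b2 : ∀ u, ‖deriv (deriv γ) u‖ ≤ L2 := by
    intro u
    have := hL2 _ (hfr u)
    have e := per2.int_mul ⌊u⌋ (Int.fract u)
    rw [mul_one, Int.fract_add_floor] at e
    rwa [← e] at this
  have hL1p : 0 < L1 := (norm_pos_iff.2 (h.regular 0)).trans_le (b1 0)
  refine ⟨max L1 L2, by positivity, fun u => (b1 u).trans (le_max_left _ _), fun u v => ?_⟩
  have := Convex.norm_image_sub_le_of_norm_deriv_le (f := deriv γ) (s := univ) (C := max L1 L2)
    (x := v) (y := u)
    (fun x _ => (hd.differentiable (by simp)) x) (fun x _ => (b2 x).trans (le_max_right _ _)) convex_univ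
    (mem_univ _) (mem_univ _)
  simpa using this

lemma chord_sub_le (h : JC γ) {L : ℝ} (hL : ∀ u v, ‖deriv γ u - deriv γ v‖ ≤ L * |u - v|)
    (v x : ℝ) : ‖chordI γ v x - deriv γ v‖ ≤ L * |x| := by
  have e : chordI γ v x - deriv γ v = ∫ τ in (0:ℝ)..1, (deriv γ (v + τ * x) - deriv γ v) := by
    rw [intervalIntegral.integral_sub]
    · simp [chordI]
    · have := h.contDeriv
      apply Continuous.intervalIntegrable; fun_prop
    · exact _root_.intervalIntegrable_const
  rw [e]
  have hL0 : 0 ≤ L := by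
    have := (norm_nonneg _).trans (hL 1 0); simpa using this
  have := intervalIntegral.norm_integral_le_of_norm_le_const (a := 0) (b := 1)
    (f := fun τ : ℝ => deriv γ (v + τ * x) - deriv γ v) (C := L * |x|) (by
      intro τ hτ
      rw [uIoc_of_le zero_le_one] at hτ
      refine (hL _ _).trans ?_
      apply mul_le_mul_of_nonneg_left _ hL0
      rw [add_sub_cancel_left, abs_mul, abs_of_pos hτ.1]
      exact mul_le_of_le_one_left (abs_nonneg _) hτ.2)
  simpa using this

/-- reduce a parameter mod 1 -/
lemma exists_near (u v : ℝ) : ∃ (n : ℤ) (x : ℝ), |x| ≤ 1/2 ∧ u = v + x + n :=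
  ⟨round (u - v), u - v - round (u - v), abs_sub_round _, by ring⟩

end JC

lemma norm_unit_sub_le {a b : ℂ} {m : ℝ} (hm : 0 < m) (ha : a ≠ 0) (hb : m ≤ ‖b‖) :
    ‖a / ‖a‖ - b / ‖b‖‖ ≤ 2 / m * ‖a - b‖ := by
  have hb0 : 0 < ‖b‖ := hm.trans_le hb
  have ha0 : 0 < ‖a‖ := norm_pos_iff.2 ha
  have e : a / ‖a‖ - b / ‖b‖ = ((a - b) + (a / ‖a‖) * ((‖b‖ - ‖a‖ : ℝ) : ℂ)) / ‖b‖ := by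
    have : (‖a‖ : ℂ) ≠ 0 := by exact_mod_cast ha0.ne'
    have : (‖b‖ : ℂ) ≠ 0 := by exact_mod_cast hb0.ne'
    field_simp
    push_cast
    ring
  rw [e, norm_div]
  have h1 : ‖(a - b) + (a / ‖a‖) * ((‖b‖ - ‖a‖ : ℝ) : ℂ)‖ ≤ 2 * ‖a - b‖ := by
    refine (norm_add_le _ _).trans ?_
    rw [norm_mul, norm_div, Complex.norm_real, Complex.norm_real, norm_norm, div_self ha0.ne', one_mul,
      Real.norm_eq_abs]
    have := abs_norm_sub_norm_le b a
    rw [norm_sub_rev b a] at this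
    linarith
  rw [Complex.norm_real, norm_norm, div_le_iff₀ hb0]
  refine h1.trans ?_
  have : 2 / m * ‖a - b‖ * m ≤ 2 / m * ‖a - b‖ * ‖b‖ := by gcongr
  have e2 : 2 / m * ‖a - b‖ * m = 2 * ‖a - b‖ := by field_simp
  linarith
end

section

lemma pos_unif {ι : Type*} [Finite ι] (P : ι → ℝ → Prop)
    (hP : ∀ i c c', c' ≤ c → P i c → P i c') (h : ∀ i, ∃ c > 0, P i c) :
    ∃ c > 0, c ≤ 1 ∧ ∀ i, P i c := by
  have h1 : ∀ᶠ c in 𝓝[>] (0:ℝ), ∀ i, P i c := by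
    rw [eventually_all]
    intro i
    obtain ⟨c, hc, hPc⟩ := h i
    filter_upwards [Ioo_mem_nhdsGT hc] with c' hc'
    exact hP i c c' hc'.2.le hPc
  have h2 : ∀ᶠ c in 𝓝[>] (0:ℝ), c ∈ Ioo (0:ℝ) 1 := Ioo_mem_nhdsGT one_pos
  obtain ⟨c, hc, hc2⟩ := (h1.and h2).exists
  exact ⟨c, hc2.1, hc2.2.le, hc⟩

variable {K : Set ℂ}

lemma SmoothBoundary.jc (B : SmoothBoundary K) (i : Fin B.n) : JC (B.curve i) :=
  ⟨B.smooth i, B.periodic i, B.injOn i, B.regular i⟩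

structure BC (B : SmoothBoundary K) (c L : ℝ) : Prop where
  cpos : 0 < c
  cle : c ≤ 1
  Lpos : 1 ≤ L
  chord : ∀ i v x, |x| ≤ 1/2 → c ≤ ‖chordI (B.curve i) v x‖
  sep : ∀ i j, i ≠ j → ∀ u v, c ≤ ‖B.curve i u - B.curve j v‖
  dle : ∀ i u, ‖deriv (B.curve i) u‖ ≤ L
  lip : ∀ i u v, ‖deriv (B.curve i) u - deriv (B.curve i) v‖ ≤ L * |u - v|

lemma JC.range_eq {γ : ℝ → ℂ} (h : JC γ) : range γ = γ '' Icc 0 1 := by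
  apply Subset.antisymm
  · rintro _ ⟨u, rfl⟩
    refine ⟨Int.fract u, ⟨Int.fract_nonneg u, (Int.fract_lt_one u).le⟩, ?_⟩
    have := h.per_int (Int.fract u) ⌊u⌋
    rw [Int.fract_add_floor] at this
    exact this.symm
  · exact image_subset_range _ _

lemma JC.compact_range {γ : ℝ → ℂ} (h : JC γ) : IsCompact (range γ) := by
  rw [h.range_eq]; exact isCompact_Icc.image h.cont

lemma exists_BC (B : SmoothBoundary K) : ∃ c L, BC B c L := by
  obtain ⟨c1, hc1, hc1', h1⟩ := pos_unif
    (fun (i : Fin B.n) c => ∀ v x, |x| ≤ 1/2 → c ≤ ‖chordI (B.curve i) v x‖)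
    (fun i c c' hcc h v x hx => hcc.trans (h v x hx)) (fun i => (B.jc i).exists_bilip)
  obtain ⟨c2, hc2, hc2', h2⟩ := pos_unif
    (fun (p : Fin B.n × Fin B.n) c => p.1 ≠ p.2 → ∀ u v, c ≤ ‖B.curve p.1 u - B.curve p.2 v‖)
    (fun i c c' hcc h hp u v => hcc.trans (h hp u v)) (by
      rintro ⟨i, j⟩
      by_cases hij : i = j
      · exact ⟨1, one_pos, fun h => absurd hij h⟩
      · obtain ⟨r, hr, h⟩ := exists_pos_forall_lt_edist (B.jc i).compact_range
          (B.jc j).compact_range.isClosed (B.disjointCurves i j hij)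
        refine ⟨r, by exact_mod_cast hr, fun _ u v => ?_⟩
        have := h _ (mem_range_self u) _ (mem_range_self v)
        rw [edist_nndist] at this
        have h3 : r < nndist (B.curve i u) (B.curve j v) := by exact_mod_cast this
        rw [← dist_eq_norm, ← coe_nndist]
        exact_mod_cast h3.le)
  choose L hL0 hLa hLb using fun i => (B.jc i).exists_lipD
  obtain ⟨M, hM⟩ := (Set.finite_range L).bddAbove
  have hM' : ∀ i, L i ≤ max M 1 := fun i => (hM (mem_range_self i)).trans (le_max_left _ _)
  refine ⟨min c1 c2, max M 1, lt_min hc1 hc2, (min_le_left _ _).trans hc1', le_max_right _ _,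
    fun i v x hx => (min_le_left _ _).trans (h1 i v x hx),
    fun i j hij u v => (min_le_right _ _).trans (h2 (i,j) hij u v), fun i u => (hLa i u).trans (hM' i),
    fun i u v => (hLb i u v).trans (mul_le_mul_of_nonneg_right (hM' i) (abs_nonneg _))⟩

namespace BC
variable {B : SmoothBoundary K} {c L : ℝ}

lemma dge (h : BC B c L) (i u) : c ≤ ‖deriv (B.curve i) u‖ := by
  have := h.chord i u 0 (by norm_num)
  rwa [JC.chord_zero] at this

lemma dist_ge (h : BC B c L) (i v x) (hx : |x| ≤ 1/2) :
    c * |x| ≤ ‖B.curve i (v + x) - B.curve i v‖ := by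
  rw [(B.jc i).chord_eq, norm_mul, Complex.norm_real, Real.norm_eq_abs, mul_comm]
  exact mul_le_mul_of_nonneg_left (h.chord i v x hx) (abs_nonneg _)

/-- case analysis on pairs of boundary points -/
lemma pair (h : BC B c L) (i j u v) :
    (c ≤ ‖B.curve i u - B.curve j v‖ ∧ i ≠ j) ∨ (i = j ∧ ∃ x, |x| ≤ 1/2 ∧ B.curve i u = B.curve j (v + x) ∧
      deriv (B.curve i) u = deriv (B.curve j) (v + x)) := by
  by_cases hij : i = j
  · subst hij
    right
    obtain ⟨n, x, hx, e⟩ := JC.exists_near u v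
    refine ⟨rfl, x, hx, ?_, ?_⟩
    · rw [e, (B.jc i).per_int]
    · rw [e, (B.jc i).perD_int]
  · exact Or.inl ⟨h.sep i j hij u v, hij⟩

lemma tangent_lip (h : BC B c L) (i j u v) :
    ‖deriv (B.curve i) u / ‖deriv (B.curve i) u‖ - deriv (B.curve j) v / ‖deriv (B.curve j) v‖‖
      ≤ 2 * L / c ^ 2 * ‖B.curve i u - B.curve j v‖ := by
  have hc := h.cpos
  have hL := h.Lpos
  have hL' : 0 < L := by linarith
  rcases h.pair i j u v with ⟨h1, -⟩ | ⟨rfl, x, hx, e1, e2⟩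
  · have hn : ∀ i u, ‖deriv (B.curve i) u / ‖deriv (B.curve i) u‖‖ = 1 := by
      intro i u
      rw [norm_div, Complex.norm_real, norm_norm, div_self]
      exact norm_ne_zero_iff.2 (B.regular i u)
    refine (norm_sub_le _ _).trans ?_
    rw [hn, hn]
    have : 2 * L / c ^ 2 * c ≤ 2 * L / c ^ 2 * ‖B.curve i u - B.curve j v‖ := by gcongr
    refine le_trans ?_ this
    have e : 2 * L / c ^ 2 * c = 2 * L / c := by field_simp
    rw [e, le_div_iff₀ hc]
    nlinarith [h.cle]
  · rw [e1, e2]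
    refine (norm_unit_sub_le hc (B.regular i _) (h.dge i v)).trans ?_
    have h1 := h.lip i (v + x) v
    have h2 := h.dist_ge i v x hx
    rw [add_sub_cancel_left] at h1
    calc 2 / c * ‖deriv (B.curve i) (v + x) - deriv (B.curve i) v‖ ≤ 2 / c * (L * |x|) := by gcongr
      _ = 2 * L / c ^ 2 * (c * |x|) := by field_simp
      _ ≤ _ := by gcongr

lemma quad (h : BC B c L) (i j u v) :
    |((B.curve i u - B.curve j v) * (starRingEnd ℂ) (deriv (B.curve j) v / ‖deriv (B.curve j) v‖)).im|
      ≤ L / c ^ 2 * ‖B.curve i u - B.curve j v‖ ^ 2 := by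
  have hc := h.cpos
  have hL := h.Lpos
  have hL' : 0 < L := by linarith
  have hn : ∀ i u, ‖deriv (B.curve i) u / ‖deriv (B.curve i) u‖‖ = 1 := by
      intro i u
      rw [norm_div, Complex.norm_real, norm_norm, div_self]
      exact norm_ne_zero_iff.2 (B.regular i u)
  rcases h.pair i j u v with ⟨h1, -⟩ | ⟨rfl, x, hx, e1, e2⟩
  · refine (Complex.abs_im_le_norm _).trans ?_
    rw [norm_mul, RCLike.norm_conj, hn, mul_one]
    set d := ‖B.curve i u - B.curve j v‖
    rw [div_mul_eq_mul_div, le_div_iff₀ (by positivity)]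
    have hd : 0 < d := hc.trans_le h1
    have : c ^ 2 ≤ L * d := by nlinarith [h.cle]
    nlinarith
  · rw [e1]
    have h2 := h.dist_ge i v x hx
    have h3 := (B.jc i).chord_sub_le (h.lip i) v x
    have e : (B.curve i (v+x) - B.curve i v) * (starRingEnd ℂ) (deriv (B.curve i) v / ‖deriv (B.curve i) v‖)
      = x * ((chordI (B.curve i) v x - deriv (B.curve i) v) * (starRingEnd ℂ) (deriv (B.curve i) v / ‖deriv (B.curve i) v‖))
        + ((x * ‖deriv (B.curve i) v‖ : ℝ) : ℂ) := by
      rw [(B.jc i).chord_eq]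
      have hne : (‖deriv (B.curve i) v‖ : ℂ) ≠ 0 := by
        exact_mod_cast norm_ne_zero_iff.2 (B.regular i v)
      have hcj := Complex.mul_conj (deriv (B.curve i) v)
      rw [Complex.normSq_eq_norm_sq] at hcj
      rw [map_div₀, Complex.conj_ofReal]
      push_cast at hcj ⊢
      field_simp
      linear_combination (x:ℂ) * hcj
    rw [e, Complex.add_im, Complex.ofReal_im, add_zero, Complex.im_ofReal_mul, abs_mul]
    have h4 : |((chordI (B.curve i) v x - deriv (B.curve i) v) * (starRingEnd ℂ) (deriv (B.curve i) v / ‖deriv (B.curve i) v‖)).im| ≤ L * |x| := by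
      refine (Complex.abs_im_le_norm _).trans ?_
      rw [norm_mul, RCLike.norm_conj, hn, mul_one]
      exact h3
    calc _ ≤ |x| * (L * |x|) := by gcongr
      _ = L / c^2 * (c * |x|)^2 := by field_simp
      _ ≤ _ := by gcongr

lemma exists_tangent (h : BC B c L) : ∃ (T : ℂ → ℂ) (C : NNReal), LipschitzWith C T ∧
    ∀ i u, T (B.curve i u) = deriv (B.curve i) u / ‖deriv (B.curve i) u‖ := by
  classical
  have hc := h.cpos
  have hL := h.Lpos
  have hL' : 0 < L := by linarith
  let Γ : Set ℂ := ⋃ i, range (B.curve i)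
  have hch : ∀ z : ℂ, ∃ p : Fin B.n × ℝ, z ∈ Γ → B.curve p.1 p.2 = z := by
    intro z
    by_cases hz : z ∈ Γ
    · obtain ⟨i, u, hu⟩ := mem_iUnion.1 hz
      exact ⟨(i, u), fun _ => hu⟩
    · exact ⟨(⟨0, B.npos⟩, 0), fun h => absurd h hz⟩
  choose p hp using hch
  let T0 : ℂ → ℂ := fun z => deriv (B.curve (p z).1) (p z).2 / ‖deriv (B.curve (p z).1) (p z).2‖
  have hT0 : ∀ i u, T0 (B.curve i u) = deriv (B.curve i) u / ‖deriv (B.curve i) u‖ := by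
    intro i u
    have h1 := h.tangent_lip (p (B.curve i u)).1 i (p (B.curve i u)).2 u
    rw [hp (B.curve i u) (mem_iUnion.2 ⟨i, mem_range_self u⟩), sub_self, norm_zero, mul_zero] at h1
    exact sub_eq_zero.1 (norm_le_zero_iff.1 h1)
  have hl : LipschitzOnWith (2 * L / c^2).toNNReal T0 Γ := by
    apply LipschitzOnWith.of_dist_le_mul
    intro x hx y hy
    obtain ⟨i, u, rfl⟩ := mem_iUnion.1 hx
    obtain ⟨j, v, rfl⟩ := mem_iUnion.1 hy
    rw [hT0, hT0, dist_eq_norm, dist_eq_norm, Real.coe_toNNReal _ (by positivity)]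
    exact h.tangent_lip i j u v
  obtain ⟨T, hT, hE⟩ := hl.extend_finite_dimension
  exact ⟨T, _, hT, fun i u => by rw [← hE (mem_iUnion.2 ⟨i, mem_range_self u⟩), hT0]⟩

end BC
end

section

open scoped ENNReal NNReal

variable {K : Set ℂ}

/-- arclength measure pieces -/
def sigPiece (γ : ℝ → ℂ) : Measure ℂ :=
  ((volume.restrict (Ioc (0:ℝ) 1)).withDensity (fun u => ((‖deriv γ u‖₊ : ℝ≥0) : ℝ≥0∞))).map γ

/-- arclength measure -/
def sig (B : SmoothBoundary K) : Measure ℂ := ∑ i, sigPiece (B.curve i)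

lemma sigPiece_lintegral {γ : ℝ → ℂ} (h : JC γ) {f : ℂ → ℝ≥0∞} (hf : Measurable f) :
    ∫⁻ z, f z ∂(sigPiece γ) = ∫⁻ u in Ioc (0:ℝ) 1, (‖deriv γ u‖₊ : ℝ≥0∞) * f (γ u) := by
  unfold sigPiece
  rw [lintegral_map hf h.cont.measurable, lintegral_withDensity_eq_lintegral_mul]
  · rfl
  · exact h.contDeriv.nnnorm.measurable.coe_nnreal_ennreal
  · exact hf.comp h.cont.measurable

lemma sig_lintegral (B : SmoothBoundary K) {f : ℂ → ℝ≥0∞} (hf : Measurable f) :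
    ∫⁻ z, f z ∂(sig B) = ∑ i, ∫⁻ u in Ioc (0:ℝ) 1,
      (‖deriv (B.curve i) u‖₊ : ℝ≥0∞) * f (B.curve i u) := by
  unfold sig
  rw [lintegral_finsetSum_measure]
  exact Finset.sum_congr rfl fun i _ => sigPiece_lintegral (B.jc i) hf

lemma lintegral_shift {F : ℝ → ℝ≥0∞} (hF : Function.Periodic F 1) (v : ℝ) :
    ∫⁻ u in Ioc (0:ℝ) 1, F u = ∫⁻ x in Ioc (-(1/2):ℝ) (1/2), F (v + x) := by
  have h1 := (isAddFundamentalDomain_Ioc (T := (1:ℝ)) one_pos 0 volume).setLIntegral_eq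
    (isAddFundamentalDomain_Ioc (T := (1:ℝ)) one_pos (v - 1/2) volume) F (by
      rintro ⟨g, hg⟩ x
      obtain ⟨n, rfl⟩ := AddSubgroup.mem_zmultiples_iff.1 hg
      have := hF.int_mul n x
      simp only [AddSubgroup.vadd_def, vadd_eq_add, zsmul_eq_mul]
      rw [add_comm]; exact this)
  rw [zero_add] at h1
  rw [h1]
  have h2 := (measurePreserving_add_left volume v).setLIntegral_comp_preimage_emb
    (measurableEmbedding_addLeft v) F (Ioc (v - 1/2) (v - 1/2 + 1))
  rw [← h2]
  congr 2
  ext x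
  simp only [mem_preimage, mem_Ioc]
  constructor <;> rintro ⟨a, b⟩ <;> constructor <;> linarith

lemma sig_growth {B : SmoothBoundary K} {c L : ℝ} (h : BC B c L) {φ : ℝ → ℝ≥0∞}
    (hφ : Measurable φ) (ha : AntitoneOn φ (Ioi 0)) {w : ℂ} (hw : w ∈ frontier K) :
    ∫⁻ z, φ ‖z - w‖ ∂(sig B) ≤ B.n * (ENNReal.ofReal L * ∫⁻ x in Ioc (-(1/2):ℝ) (1/2), φ (c * |x|)) := by
  rw [sig_lintegral B (by fun_prop)]
  rw [← B.boundary] at hw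
  obtain ⟨j, v, rfl⟩ := mem_iUnion.1 hw
  have key : ∀ i, ∫⁻ u in Ioc (0:ℝ) 1, (‖deriv (B.curve i) u‖₊ : ℝ≥0∞) * φ ‖B.curve i u - B.curve j v‖
      ≤ ENNReal.ofReal L * ∫⁻ x in Ioc (-(1/2):ℝ) (1/2), φ (c * |x|) := by
    intro i
    rw [lintegral_shift (v := v), ← lintegral_const_mul' _ _ ENNReal.ofReal_ne_top]
    · apply lintegral_mono_ae
      have h0 : ∀ᵐ x ∂(volume.restrict (Ioc (-(1/2):ℝ) (1/2))), x ≠ 0 := by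
        apply ae_restrict_of_ae
        simp [ae_iff]
      filter_upwards [h0, ae_restrict_mem measurableSet_Ioc] with x hx0 hx
      have hx' : |x| ≤ 1/2 := abs_le.2 ⟨hx.1.le, hx.2⟩
      have hxp : 0 < |x| := abs_pos.2 hx0
      have hc := h.cpos
      gcongr
      · have := h.dle i (v + x)
        rw [← enorm_eq_nnnorm, ← ofReal_norm]
        exact ENNReal.ofReal_le_ofReal this
      · have hle : c * |x| ≤ ‖B.curve i (v + x) - B.curve j v‖ := by
          by_cases hij : i = j
          · subst hij; exact h.dist_ge i v x hx'
          · refine le_trans ?_ (h.sep i j hij (v+x) v)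
            nlinarith
        have hp : 0 < c * |x| := by positivity
        exact ha hp (hp.trans_le hle) hle
    · intro u
      simp only
      rw [(B.jc i).periodic, (B.jc i).periodicDeriv]
  refine (Finset.sum_le_sum fun i _ => key i).trans ?_
  simp

lemma sigPiece_univ_lt {γ : ℝ → ℂ} (h : JC γ) : sigPiece γ univ < ∞ := by
  obtain ⟨L, hL, hL1, -⟩ := h.exists_lipD
  rw [← lintegral_one, sigPiece_lintegral h measurable_const]
  calc _ ≤ ∫⁻ u in Ioc (0:ℝ) 1, ENNReal.ofReal L := by
        apply lintegral_mono
        intro u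
        simp only [mul_one]
        rw [← enorm_eq_nnnorm, ← ofReal_norm]
        exact ENNReal.ofReal_le_ofReal (hL1 u)
    _ < ∞ := by simp

instance sigPiece_finite (B : SmoothBoundary K) (i : Fin B.n) : IsFiniteMeasure (sigPiece (B.curve i)) :=
  ⟨sigPiece_univ_lt (B.jc i)⟩

instance sig_finite (B : SmoothBoundary K) : IsFiniteMeasure (sig B) := by
  constructor
  unfold sig
  rw [Measure.finsetSum_apply]
  exact ENNReal.sum_lt_top.2 fun i _ => measure_lt_top _ _

lemma sig_ae_mem (B : SmoothBoundary K) : ∀ᵐ z ∂(sig B), z ∈ frontier K := by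
  rw [ae_iff]
  have hm : MeasurableSet (frontier K)ᶜ := isClosed_frontier.measurableSet.compl
  change sig B (frontier K)ᶜ = 0
  rw [← lintegral_indicator_one hm, sig_lintegral B (measurable_one.indicator hm)]
  apply Finset.sum_eq_zero
  intro i _
  have : ∀ u, B.curve i u ∈ frontier K := fun u => by
    rw [← B.boundary]; exact mem_iUnion.2 ⟨i, mem_range_self u⟩
  simp [this]

lemma sig_restrict (B : SmoothBoundary K) : (sig B).restrict (frontier K) = sig B :=
  Measure.restrict_eq_self_of_ae_mem (sig_ae_mem B)

lemma sig_integral (B : SmoothBoundary K) {E : Type*} [NormedAddCommGroup E] [NormedSpace ℝ E]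
    {f : ℂ → E} (hf : Integrable f (sig B)) :
    ∫ z, f z ∂(sig B) = ∑ i, ∫ u in (0:ℝ)..1, ‖deriv (B.curve i) u‖ • f (B.curve i u) := by
  unfold sig at *
  have hf' := integrable_finsetSum_measure.1 hf
  rw [integral_finsetSum_measure hf']
  refine Finset.sum_congr rfl fun i hi => ?_
  have h := hf' i hi
  unfold sigPiece at *
  rw [integral_map (B.jc i).cont.measurable.aemeasurable h.aestronglyMeasurable,
    integral_withDensity_eq_integral_smul ((B.jc i).contDeriv.nnnorm.measurable),
    intervalIntegral.integral_of_le zero_le_one]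
  rfl

lemma sig_integrable (B : SmoothBoundary K) (hK : IsCompact K) {E : Type*} [NormedAddCommGroup E]
    {f : ℂ → E} (hf : ContinuousOn f (frontier K)) : Integrable f (sig B) := by
  rw [← sig_restrict B]
  have : IsCompact (frontier K) := hK.of_isClosed_subset isClosed_frontier
    (frontier_subset_closure.trans hK.isClosed.closure_eq.subset)
  exact hf.integrableOn_compact this
end

section

open scoped ENNReal NNReal Real

variable {K : Set ℂ}

lemma lint_scale {g : ℝ → ℝ} (hg : Integrable g) (h0 : ∀ x, 0 ≤ g x) {a : ℝ} (ha : 0 < a) (s : Set ℝ) :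
    ∫⁻ x in s, ENNReal.ofReal (g (a * x)) ≤ ENNReal.ofReal (a⁻¹ * ∫ x, g x) := by
  refine (setLIntegral_le_lintegral _ _).trans ?_
  rw [← ofReal_integral_eq_lintegral_ofReal (hg.comp_mul_left' ha.ne') (ae_of_all _ fun x => h0 _),
    Measure.integral_comp_mul_left, abs_of_pos (inv_pos.2 ha), smul_eq_mul]

lemma poisson_scaled {q : ℝ} (hq : 0 < q) : Integrable (fun x : ℝ => 2 / (x ^ 2 * q + 1)) ∧
    ∫ x : ℝ, 2 / (x ^ 2 * q + 1) = 2 * π / √q := by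
  have hs : 0 < √q := Real.sqrt_pos.2 hq
  have e : (fun x : ℝ => 2 / (x ^ 2 * q + 1)) = fun x => 2 * (fun y : ℝ => (1 + y ^ 2)⁻¹) (√q * x) := by
    ext x
    simp only
    rw [mul_pow, Real.sq_sqrt hq.le, div_eq_mul_inv]
    ring_nf
  rw [e]
  refine ⟨(integrable_inv_one_add_sq.comp_mul_left' hs.ne').const_mul 2, ?_⟩
  rw [integral_const_mul, Measure.integral_comp_mul_left (fun y : ℝ => (1 + y ^ 2)⁻¹), abs_of_pos (inv_pos.2 hs),
    integral_univ_inv_one_add_sq, smul_eq_mul]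
  field_simp

lemma posLog_meas : Measurable Real.posLog := by
  unfold Real.posLog
  exact measurable_const.max Real.measurable_log

lemma posLog_integrable : Integrable (fun x : ℝ => Real.posLog x⁻¹) := by
  have h1 : IntegrableOn (fun x : ℝ => -Real.log x) (Ioc (-1) 1) := by
    have := (intervalIntegral.intervalIntegrable_log' (a := -1) (b := 1)).neg
    rw [intervalIntegrable_iff_integrableOn_Ioc_of_le (by norm_num)] at this
    exact this
  have h2 := h1.integrable_indicator measurableSet_Ioc
  refine h2.congr (ae_of_all _ fun x => ?_)
  symm
  simp only [Real.posLog, Real.log_inv]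
  by_cases hx : x ∈ Ioc (-1:ℝ) 1
  · rw [indicator_of_mem hx, max_eq_right]
    have : Real.log x ≤ 0 := by
      rw [← Real.log_abs]
      exact Real.log_nonpos (abs_nonneg _) (abs_le.2 ⟨hx.1.le, hx.2⟩)
    linarith
  · rw [indicator_of_notMem hx, max_eq_left]
    have : 0 ≤ Real.log x := by
      rw [← Real.log_abs]
      apply Real.log_nonneg
      by_contra hlt
      push Not at hlt
      rw [abs_lt] at hlt
      exact hx ⟨hlt.1, hlt.2.le⟩
    linarith

lemma sig_noatom (B : SmoothBoundary K) (w : ℂ) : ∀ᵐ z ∂(sig B), z ≠ w := by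
  obtain ⟨c, L, h⟩ := exists_BC B
  by_cases hw : w ∈ frontier K
  · have h1 := sig_growth h (φ := fun r => if r ≤ 0 then 1 else 0)
      (Measurable.ite measurableSet_Iic measurable_const measurable_const) (by
        intro a ha b hb _
        simp [not_le.2 (mem_Ioi.1 ha), not_le.2 (mem_Ioi.1 hb)]) hw
    have h2 : ∫⁻ x in Ioc (-(1/2):ℝ) (1/2), (if c * |x| ≤ 0 then (1:ℝ≥0∞) else 0) = 0 := by
      rw [lintegral_eq_zero_iff' (by
        apply Measurable.aemeasurable
        exact Measurable.ite (measurableSet_le (by fun_prop) measurable_const) measurable_const measurable_const)]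
      have h0 : ∀ᵐ x ∂(volume.restrict (Ioc (-(1/2):ℝ) (1/2))), x ≠ 0 := by
        apply ae_restrict_of_ae
        simp [ae_iff]
      filter_upwards [h0] with x hx
      have : 0 < c * |x| := mul_pos h.cpos (abs_pos.2 hx)
      simp [not_le.2 this]
    rw [h2, mul_zero, mul_zero, nonpos_iff_eq_zero, lintegral_eq_zero_iff' (by
        apply Measurable.aemeasurable
        exact Measurable.ite (measurableSet_le (by fun_prop) measurable_const) measurable_const measurable_const)] at h1
    filter_upwards [h1] with z hz hzw
    simp [hzw] at hz
  · filter_upwards [sig_ae_mem B] with z hz hzw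
    exact hw (hzw ▸ hz)

lemma sig_poisson_bound (B : SmoothBoundary K) : ∃ C : ℝ, 0 < C ∧ ∀ w ∈ frontier K, ∀ t > 0,
    ∫⁻ z, ENNReal.ofReal (2 * t / (‖z - w‖ ^ 2 + t ^ 2)) ∂(sig B) ≤ ENNReal.ofReal C := by
  obtain ⟨c, L, h⟩ := exists_BC B
  have hc := h.cpos
  have hL : 0 < L := by linarith [h.Lpos]
  have hn : 0 < (B.n : ℝ) := by exact_mod_cast B.npos
  refine ⟨B.n * (L * (2 * π / c)), by positivity, fun w hw t ht => ?_⟩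
  refine (sig_growth h (φ := fun r => ENNReal.ofReal (2 * t / (r ^ 2 + t ^ 2))) (by fun_prop) ?_ hw).trans ?_
  · intro a ha b hb hab
    rw [mem_Ioi] at ha
    apply ENNReal.ofReal_le_ofReal
    gcongr
  · rw [ENNReal.ofReal_mul hn.le, ENNReal.ofReal_mul hL.le, ENNReal.ofReal_natCast]
    gcongr
    obtain ⟨h1, h2⟩ := poisson_scaled (q := 1) one_pos
    have h3 := lint_scale (h1.const_mul t⁻¹) (fun x => by positivity) (a := c / t) (by positivity) (Ioc (-(1/2):ℝ) (1/2))
    rw [integral_const_mul, h2] at h3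
    have e1 : ∀ x : ℝ, 2 * t / ((c * |x|) ^ 2 + t ^ 2) = t⁻¹ * (2 / ((c / t * x) ^ 2 * 1 + 1)) := by
      intro x
      rw [mul_pow, sq_abs]
      field_simp
    have e2 : 2 * π / c = (c / t)⁻¹ * (t⁻¹ * (2 * π / √1)) := by
      rw [Real.sqrt_one]; field_simp
    rw [e2]
    simp only [e1]
    exact h3

lemma sig_log_bound (B : SmoothBoundary K) (hK : IsCompact K) : ∃ C : ℝ, 0 < C ∧ ∀ z : ℂ, ∀ r > 0,
    ∫⁻ ζ, ENNReal.ofReal (Real.posLog (r / ‖ζ - z‖)) ∂(sig B) ≤ ENNReal.ofReal (C * r) := by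
  obtain ⟨c, L, h⟩ := exists_BC B
  have hc := h.cpos
  have hL : 0 < L := by linarith [h.Lpos]
  have hn : 0 < (B.n : ℝ) := by exact_mod_cast B.npos
  set A : ℝ := ∫ x : ℝ, Real.posLog x⁻¹ with hA
  have hA0 : 0 ≤ A := integral_nonneg fun x => Real.posLog_nonneg
  have key : ∀ w ∈ frontier K, ∀ r > 0,
    ∫⁻ ζ, ENNReal.ofReal (Real.posLog (r / ‖ζ - w‖)) ∂(sig B) ≤ ENNReal.ofReal (B.n * (L * (c⁻¹ * A)) * r) := by
    intro w hw r hr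
    refine (sig_growth h (φ := fun s => ENNReal.ofReal (Real.posLog (r / s))) ?_ ?_ hw).trans ?_
    · exact (posLog_meas.comp (measurable_const.div measurable_id)).ennreal_ofReal
    · intro a ha b hb hab
      rw [mem_Ioi] at ha hb
      apply ENNReal.ofReal_le_ofReal
      apply Real.posLog_le_posLog (by positivity)
      gcongr
    · rw [mul_assoc, mul_assoc, ENNReal.ofReal_mul hn.le, ENNReal.ofReal_mul hL.le, ENNReal.ofReal_natCast]
      gcongr
      have h3 := lint_scale posLog_integrable (fun x => Real.posLog_nonneg) (a := c / r) (by positivity) (Ioc (-(1/2):ℝ) (1/2))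
      have e1 : ∀ x : ℝ, Real.posLog (r / (c * |x|)) = Real.posLog (c / r * x)⁻¹ := by
        intro x
        rw [← Real.posLog_abs (x := (c / r * x)⁻¹), abs_inv, abs_mul, abs_of_pos (show 0 < c / r by positivity)]
        congr 1
        rw [div_mul_eq_mul_div, inv_div]
      have e2 : c⁻¹ * A * r = (c / r)⁻¹ * A := by field_simp
      rw [e2]
      simp only [e1]
      exact h3
  refine ⟨B.n * (L * (c⁻¹ * A)) * 2 + 1, by positivity, fun z r hr => ?_⟩
  have hcomp : IsCompact (frontier K) := hK.of_isClosed_subset isClosed_frontier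
    (frontier_subset_closure.trans hK.isClosed.closure_eq.subset)
  have hne : (frontier K).Nonempty := by
    rw [← B.boundary]
    exact ⟨B.curve ⟨0, B.npos⟩ 0, mem_iUnion.2 ⟨_, mem_range_self 0⟩⟩
  obtain ⟨w, hw, hmin⟩ := hcomp.exists_infDist_eq_dist hne z
  have h1 : ∫⁻ ζ, ENNReal.ofReal (Real.posLog (r / ‖ζ - z‖)) ∂(sig B) ≤
     ∫⁻ ζ, ENNReal.ofReal (Real.posLog ((2 * r) / ‖ζ - w‖)) ∂(sig B) := by
    apply lintegral_mono_ae
    filter_upwards [sig_noatom B w, sig_noatom B z, sig_ae_mem B] with ζ h1 h2 h3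
    apply ENNReal.ofReal_le_ofReal
    have hp1 : 0 < ‖ζ - w‖ := norm_pos_iff.2 (sub_ne_zero.2 h1)
    have hp2 : 0 < ‖ζ - z‖ := norm_pos_iff.2 (sub_ne_zero.2 h2)
    apply Real.posLog_le_posLog (by positivity)
    rw [div_le_div_iff₀ hp2 hp1]
    have : dist z w ≤ dist z ζ := hmin ▸ infDist_le_dist_of_mem h3
    rw [dist_eq_norm, dist_eq_norm, norm_sub_rev z ζ] at this
    have h5 : ‖ζ - w‖ ≤ ‖ζ - z‖ + ‖z - w‖ := by
      have := norm_add_le (ζ - z) (z - w); simpa using this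
    nlinarith
  refine h1.trans ((key w hw (2 * r) (by positivity)).trans ?_)
  apply ENNReal.ofReal_le_ofReal
  nlinarith

lemma poisson_1d {q : ℝ → ℝ} {g : ℝ → ℂ} (hq : Continuous q) (hg : Continuous g) {c M : ℝ} (hc : 0 < c)
    (hcq : ∀ x, |x| ≤ 1/2 → c ≤ q x) (hM : ∀ x, |x| ≤ 1/2 → ‖g x‖ ≤ M) :
    Tendsto (fun t : ℝ => ∫ x in (-(1/2):ℝ)..(1/2), (2 * t / (x ^ 2 * q x + t ^ 2)) • g x) (𝓝[>] 0)
      (𝓝 ((2 * π / √(q 0)) • g 0)) := by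
  have hM0 : 0 ≤ M := (norm_nonneg _).trans (hM 0 (by norm_num))
  have hq0 : 0 < q 0 := hc.trans_le (hcq 0 (by norm_num))
  let F : ℝ → ℝ → ℂ := fun t => (Ioc (-(1/(2*t))) (1/(2*t))).indicator
    (fun ξ => (2 / (ξ ^ 2 * q (t * ξ) + 1)) • g (t * ξ))
  have e1 : ∀ t > 0, ∫ x in (-(1/2):ℝ)..(1/2), (2 * t / (x ^ 2 * q x + t ^ 2)) • g x = ∫ ξ, F t ξ := by
    intro t ht
    have h1 := intervalIntegral.smul_integral_comp_mul_left (a := -(1/(2*t))) (b := 1/(2*t))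
      (fun x => (2 * t / (x ^ 2 * q x + t ^ 2)) • g x) t
    have e2 : t * (1/(2*t)) = 1/2 := by field_simp
    rw [mul_neg, e2] at h1
    have hle : -(1/(2*t)) ≤ 1/(2*t) := by
      have : 0 < 1/(2*t) := by positivity
      linarith
    rw [← h1, ← intervalIntegral.integral_smul, intervalIntegral.integral_of_le hle,
      ← integral_indicator measurableSet_Ioc]
    congr 1
    ext ξ
    simp only [F]
    congr 1
    ext ξ
    rw [smul_smul]
    congr 1
    field_simp
  have e2 : (fun t : ℝ => ∫ ξ, F t ξ) =ᶠ[𝓝[>] 0]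
      (fun t : ℝ => ∫ x in (-(1/2):ℝ)..(1/2), (2 * t / (x ^ 2 * q x + t ^ 2)) • g x) := by
    filter_upwards [self_mem_nhdsWithin] with t ht
    exact (e1 t ht).symm
  refine Tendsto.congr' e2 ?_
  have e3 : (2 * π / √(q 0)) • g 0 = ∫ ξ : ℝ, (2 / (ξ ^ 2 * q 0 + 1)) • g 0 := by
    rw [integral_smul_const, (poisson_scaled hq0).2]
  rw [e3]
  apply tendsto_integral_filter_of_dominated_convergence (fun ξ => 2 / (ξ ^ 2 * c + 1) * M)
  · filter_upwards [self_mem_nhdsWithin] with t ht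
    apply AEStronglyMeasurable.indicator _ measurableSet_Ioc
    apply Measurable.aestronglyMeasurable
    have := hq.measurable
    have := hg.measurable
    fun_prop
  · filter_upwards [self_mem_nhdsWithin] with t ht
    rw [mem_Ioi] at ht
    refine ae_of_all _ fun ξ => ?_
    simp only [F]
    by_cases hξ : ξ ∈ Ioc (-(1/(2*t))) (1/(2*t))
    · rw [indicator_of_mem hξ]
      have hx : |t * ξ| ≤ 1/2 := by
        have := abs_le.2 ⟨hξ.1.le, hξ.2⟩
        rw [abs_mul, abs_of_pos ht]
        calc t * |ξ| ≤ t * (1/(2*t)) := by gcongr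
          _ = 1/2 := by field_simp
      have hqq := hcq _ hx
      have hqp : 0 < q (t * ξ) := hc.trans_le hqq
      rw [norm_smul, Real.norm_eq_abs, abs_of_pos (by positivity)]
      gcongr
      exact hM _ hx
    · rw [indicator_of_notMem hξ, norm_zero]; positivity
  · exact (poisson_scaled hc).1.mul_const M
  · refine ae_of_all _ fun ξ => ?_
    have h1 : Tendsto (fun t : ℝ => (2 / (ξ ^ 2 * q (t * ξ) + 1)) • g (t * ξ)) (𝓝[>] 0)
      (𝓝 ((2 / (ξ ^ 2 * q 0 + 1)) • g 0)) := by
      have h2 : ContinuousAt (fun t : ℝ => (2 / (ξ ^ 2 * q (t * ξ) + 1)) • g (t * ξ)) 0 := by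
        have : ξ ^ 2 * q (0 * ξ) + 1 ≠ 0 := by rw [zero_mul]; positivity
        apply ContinuousAt.fun_smul
        · exact ContinuousAt.div (f := fun _ => (2:ℝ)) (g := fun t => ξ ^ 2 * q (t * ξ) + 1) (by fun_prop) (by fun_prop) this
        · fun_prop
      have h3 := h2.tendsto
      simp only [zero_mul] at h3
      exact h3.mono_left nhdsWithin_le_nhds
    refine h1.congr' ?_
    have hpos : (0:ℝ) < 1 / (2 * (|ξ| + 1)) := by positivity
    filter_upwards [Ioo_mem_nhdsGT hpos] with t ht
    simp only [F]
    rw [indicator_of_mem]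
    have ht0 := ht.1
    have h5 : |ξ| + 1 < 1/(2*t) := by
      have := ht.2
      rw [lt_div_iff₀ (by positivity)] at this ⊢
      linarith
    have := abs_le.1 (le_refl |ξ|)
    constructor <;> linarith [this.1, this.2]

lemma sig_poisson_limit (B : SmoothBoundary K) (hK : IsCompact K) {y : ℂ → ℂ} (hy : Continuous y) {w : ℂ} (hw : w ∈ frontier K) :
    Tendsto (fun t : ℝ => ∫ z, (2 * t / (‖z - w‖ ^ 2 + t ^ 2)) • y z ∂(sig B)) (𝓝[>] 0) (𝓝 (2 * π * y w)) := by
  obtain ⟨c, L, h⟩ := exists_BC B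
  have hc := h.cpos
  rw [← B.boundary] at hw
  obtain ⟨j, v, rfl⟩ := mem_iUnion.1 hw
  have e1 : (fun t : ℝ => ∑ i, ∫ x in (-(1/2):ℝ)..(1/2), ‖deriv (B.curve i) (v + x)‖ •
      ((2 * t / (‖B.curve i (v+x) - B.curve j v‖ ^ 2 + t ^ 2)) • y (B.curve i (v+x)))) =ᶠ[𝓝[>] 0]
      (fun t : ℝ => ∫ z, (2 * t / (‖z - B.curve j v‖ ^ 2 + t ^ 2)) • y z ∂(sig B)) := by
    filter_upwards [self_mem_nhdsWithin] with t ht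
    rw [mem_Ioi] at ht
    rw [sig_integral B]
    · refine Finset.sum_congr rfl fun i _ => ?_
      have hper : Function.Periodic (fun u => ‖deriv (B.curve i) u‖ •
        ((2 * t / (‖B.curve i u - B.curve j v‖ ^ 2 + t ^ 2)) • y (B.curve i u))) 1 := by
        intro u
        simp only
        rw [(B.jc i).periodic, (B.jc i).periodicDeriv]
      have h1 := hper.intervalIntegral_add_eq 0 (v - 1/2)
      rw [zero_add] at h1
      rw [h1]
      have h2 := intervalIntegral.integral_comp_add_left (a := -(1/2)) (b := 1/2) (fun u => ‖deriv (B.curve i) u‖ •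
        ((2 * t / (‖B.curve i u - B.curve j v‖ ^ 2 + t ^ 2)) • y (B.curve i u))) v
      rw [h2]
      congr 1; ring
    · apply sig_integrable B hK
      apply Continuous.continuousOn
      refine Continuous.fun_smul ?_ hy
      apply Continuous.div (by fun_prop) (by fun_prop)
      intro z; positivity
  refine Tendsto.congr' e1 ?_
  have e2 : 2 * π * y (B.curve j v) = ∑ i, if i = j then 2 * π * y (B.curve j v) else 0 := by simp
  rw [e2]
  apply tendsto_finsetSum
  intro i _
  have hci : Continuous (fun x => B.curve i (v + x)) := (B.jc i).cont.comp (by fun_prop)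
  have hcdi : Continuous (fun x => deriv (B.curve i) (v + x)) := (B.jc i).contDeriv.comp (by fun_prop)
  have hgc : Continuous (fun x => ‖deriv (B.curve i) (v + x)‖ • y (B.curve i (v + x))) :=
    hcdi.norm.smul (hy.comp hci)
  obtain ⟨M, hM⟩ := (isCompact_Icc (a := (-(1/2):ℝ)) (b := 1/2)).exists_bound_of_continuousOn hgc.continuousOn
  by_cases hij : i = j
  · subst hij
    rw [if_pos rfl]
    have hch : Continuous (fun x => chordI (B.curve i) v x) := (B.jc i).contChord.comp (f := fun x : ℝ => (v, x)) (by fun_prop)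
    have h1 := poisson_1d (q := fun x => ‖chordI (B.curve i) v x‖ ^ 2) (hch.norm.pow 2) hgc (c := c^2) (by positivity)
      (fun x hx => by have := h.chord i v x hx; gcongr) (fun x hx => hM x (abs_le.1 hx))
    have e3 : 2 * π * y (B.curve i v) = (2 * π / √(‖chordI (B.curve i) v 0‖ ^ 2)) • (‖deriv (B.curve i) (v + 0)‖ • y (B.curve i (v + 0))) := by
      rw [Real.sqrt_sq (norm_nonneg _), JC.chord_zero, add_zero, smul_smul, div_mul_cancel₀]
      · simp
      · exact norm_ne_zero_iff.2 (B.regular i v)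
    rw [e3]
    refine h1.congr fun t => ?_
    congr 1
    ext x
    rw [(B.jc i).chord_eq, norm_mul, Complex.norm_real, mul_pow, Real.norm_eq_abs, sq_abs, smul_comm]
  · rw [if_neg hij]
    have hz : Tendsto (fun t : ℝ => (2 * t / c^2) * M * |1/2 - (-(1/2))|) (𝓝[>] (0:ℝ)) (𝓝 0) := by
      have : Continuous (fun t : ℝ => (2 * t / c^2) * M * |1/2 - (-(1/2))|) := by fun_prop
      have h2 := this.tendsto 0
      simp only [mul_zero, zero_div, zero_mul] at h2
      exact h2.mono_left nhdsWithin_le_nhds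
    refine squeeze_zero_norm' (a := fun t : ℝ => (2 * t / c^2) * M * |1/2 - (-(1/2))|) ?_ hz
    filter_upwards [self_mem_nhdsWithin] with t ht
    rw [mem_Ioi] at ht
    apply intervalIntegral.norm_integral_le_of_norm_le_const
    intro x hx
    rw [uIoc_of_le (by norm_num)] at hx
    rw [smul_comm, norm_smul, Real.norm_eq_abs, abs_of_nonneg (by positivity)]
    have := hM x ⟨hx.1.le, hx.2⟩
    have := h.sep i j hij (v + x) v
    gcongr
    nlinarith [sq_nonneg t]
end

section

open scoped ENNReal NNReal Real

lemma diff_param {α : Type*} [MeasurableSpace α] {μ : Measure α} {F : ℂ → α → ℂ} {U : Set ℂ}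
    (hU : IsOpen U) (hm : ∀ z ∈ U, AEStronglyMeasurable (F z) μ)
    (hd : ∀ᵐ t ∂μ, DifferentiableOn ℂ (fun z => F z t) U)
    (hb : ∀ z0 ∈ U, ∃ r > 0, ∃ g : α → ℝ, Integrable g μ ∧ ∀ᵐ t ∂μ, ∀ z ∈ ball z0 r, z ∈ U → ‖F z t‖ ≤ g t) :
    DifferentiableOn ℂ (fun z => ∫ t, F z t ∂μ) U := by
  intro z0 hz0
  obtain ⟨r0, hr0, g, hg, hgb⟩ := hb z0 hz0
  obtain ⟨r1, hr1, hball⟩ := Metric.isOpen_iff.1 hU z0 hz0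
  set r := min r0 r1 with hr
  have hrp : 0 < r := lt_min hr0 hr1
  have hsub : ball z0 r ⊆ U := (ball_subset_ball (min_le_right _ _)).trans hball
  have hsub0 : ball z0 r ⊆ ball z0 r0 := ball_subset_ball (min_le_left _ _)
  have hFm : AEStronglyMeasurable (fun t => deriv (fun z => F z t) z0) μ := by
    have hseq : ∀ n : ℕ, z0 + ((r / 2 * (1 / ((n:ℝ) + 1)) : ℝ) : ℂ) ∈ U := by
      intro n
      apply hsub
      rw [mem_ball, dist_eq_norm, add_sub_cancel_left, Complex.norm_real, Real.norm_eq_abs, abs_of_pos (by positivity)]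
      have : 1 / ((n:ℝ) + 1) ≤ 1 := by
        rw [div_le_one (by positivity)]; linarith [Nat.cast_nonneg (α := ℝ) n]
      nlinarith
    apply aestronglyMeasurable_of_tendsto_ae (u := atTop)
      (f := fun (n : ℕ) t => (((r / 2 * (1 / ((n:ℝ) + 1)) : ℝ) : ℂ))⁻¹ • (F (z0 + ((r / 2 * (1 / ((n:ℝ) + 1)) : ℝ) : ℂ)) t - F z0 t))
    · intro n
      exact ((hm _ (hseq n)).sub (hm _ hz0)).const_smul ((((r / 2 * (1 / ((n:ℝ) + 1)) : ℝ) : ℂ))⁻¹)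
    · filter_upwards [hd] with t ht
      have h1 := ((ht.differentiableAt (hU.mem_nhds hz0)).hasDerivAt).tendsto_slope_zero
      apply h1.comp
      rw [tendsto_nhdsWithin_iff]
      constructor
      · have h2 : Tendsto (fun n : ℕ => r / 2 * (1 / ((n:ℝ) + 1))) atTop (𝓝 (r / 2 * 0)) :=
          tendsto_one_div_add_atTop_nhds_zero_nat.const_mul _
        rw [mul_zero] at h2
        have h3 := (Complex.continuous_ofReal.tendsto 0).comp h2
        rw [Complex.ofReal_zero] at h3
        exact h3
      · refine Eventually.of_forall fun n => ?_
        have : (0:ℝ) < r / 2 * (1 / ((n:ℝ) + 1)) := by positivity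
        simp only [mem_compl_iff, mem_singleton_iff]
        exact_mod_cast this.ne'
  have key := hasDerivAt_integral_of_dominated_loc_of_deriv_le (μ := μ) (F := F) (x₀ := z0) (s := ball z0 (r/2))
    (bound := fun t => g t / (r / 4)) (F' := fun z t => deriv (fun z => F z t) z)
    (ball_mem_nhds z0 (by positivity)) ?_ ?_ hFm ?_ (hg.div_const _) ?_
  · exact key.2.differentiableAt.differentiableWithinAt
  · filter_upwards [hU.mem_nhds hz0] with z hz using hm z hz
  · refine hg.mono' (hm z0 hz0) ?_
    filter_upwards [hgb] with t ht
    exact ht z0 (mem_ball_self hr0) hz0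
  · filter_upwards [hgb, hd] with t ht hdt z hz
    have hcb : closedBall z (r/4) ⊆ ball z0 r := by
      intro y hy
      rw [mem_closedBall] at hy
      rw [mem_ball] at hz ⊢
      have := dist_triangle y z z0
      linarith
    apply Complex.norm_deriv_le_of_forall_mem_sphere_norm_le (by positivity)
    · apply DifferentiableOn.diffContOnCl
      rw [closure_ball _ (by positivity)]
      exact hdt.mono (hcb.trans hsub)
    · intro y hy
      have hy' := hcb (sphere_subset_closedBall hy)
      exact ht y (hsub0 hy') (hsub hy')
  · filter_upwards [hd] with t ht z hz
    have : z ∈ U := hsub (ball_subset_ball (by linarith) hz)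
    exact (ht.differentiableAt (hU.mem_nhds this)).hasDerivAt

lemma diff_param_interval {F : ℂ → ℝ → ℂ} {U : Set ℂ}
    (hU : IsOpen U) (hm : ∀ z ∈ U, ContinuousOn (F z) (Icc 0 1))
    (hd : ∀ t ∈ Icc (0:ℝ) 1, DifferentiableOn ℂ (fun z => F z t) U)
    (hb : ∀ z0 ∈ U, ∃ r > 0, ∃ M : ℝ, ∀ t ∈ Icc (0:ℝ) 1, ∀ z ∈ ball z0 r, z ∈ U → ‖F z t‖ ≤ M) :
    DifferentiableOn ℂ (fun z => ∫ t in (0:ℝ)..1, F z t) U := by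
  simp only [intervalIntegral.integral_of_le zero_le_one]
  apply diff_param hU
  · intro z hz
    exact ((hm z hz).mono Ioc_subset_Icc_self).aestronglyMeasurable measurableSet_Ioc
  · filter_upwards [ae_restrict_mem measurableSet_Ioc] with t ht
    exact hd t (Ioc_subset_Icc_self ht)
  · intro z0 hz0
    obtain ⟨r, hr, M, hM⟩ := hb z0 hz0
    refine ⟨r, hr, fun _ => M, integrable_const _, ?_⟩
    filter_upwards [ae_restrict_mem measurableSet_Ioc] with t ht
    exact hM t (Ioc_subset_Icc_self ht)

lemma cauchy_tendsto_zero {g c : ℝ → ℂ} (hg : ContinuousOn g (Icc 0 1)) (hc : ContinuousOn c (Icc 0 1)) :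
    Tendsto (fun z => ∫ t in (0:ℝ)..1, g t / (c t - z)) (cobounded ℂ) (𝓝 0) := by
  obtain ⟨M, hM⟩ := isCompact_Icc.exists_bound_of_continuousOn hg
  obtain ⟨R, hR⟩ := isCompact_Icc.exists_bound_of_continuousOn hc
  have hM0 : 0 ≤ M := (norm_nonneg _).trans (hM 0 (by simp))
  have h1 : Tendsto (fun z : ℂ => M / (‖z‖ - R) * |1 - 0|) (cobounded ℂ) (𝓝 0) := by
    have h2 : Tendsto (fun z : ℂ => ‖z‖ - R) (cobounded ℂ) atTop :=
      tendsto_atTop_add_const_right _ _ tendsto_norm_cobounded_atTop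
    simpa using (h2.const_div_atTop M)
  refine squeeze_zero_norm' ?_ h1
  have : ∀ᶠ z : ℂ in cobounded ℂ, R < ‖z‖ := tendsto_norm_cobounded_atTop.eventually_gt_atTop R
  filter_upwards [this] with z hz
  apply intervalIntegral.norm_integral_le_of_norm_le_const
  intro t ht
  rw [uIoc_of_le zero_le_one] at ht
  have ht' := Ioc_subset_Icc_self ht
  have := hM t ht'
  have := hR t ht'
  rw [norm_div]
  have h3 : ‖z‖ - R ≤ ‖c t - z‖ := by
    have := norm_sub_norm_le z (c t)
    rw [norm_sub_rev] at this
    linarith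
  have h4 : 0 < ‖z‖ - R := by linarith
  gcongr

lemma contour_tendsto_zero {n : ℕ} {c : Fin n → ℝ → ℂ} (hc : ∀ i, Continuous (c i)) (hc' : ∀ i, Continuous (deriv (c i)))
    {f : ℂ → ℂ} (hf : ∀ i, ContinuousOn (fun t => f (c i t)) (Icc 0 1)) :
    Tendsto (fun z => contourIntegralOf c (fun w => f w / (w - z))) (cobounded ℂ) (𝓝 0) := by
  unfold contourIntegralOf
  rw [show (0:ℂ) = ∑ i : Fin n, 0 by simp]
  apply tendsto_finsetSum
  intro i _
  have := cauchy_tendsto_zero ((hf i).mul (hc' i).continuousOn) (hc i).continuousOn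
  refine this.congr fun z => ?_
  congr 1; ext t
  simp only [Pi.mul_apply]
  ring

lemma contour_add {n : ℕ} {c : Fin n → ℝ → ℂ} (hc' : ∀ i, Continuous (deriv (c i)))
    {f g : ℂ → ℂ} (hf : ∀ i, ContinuousOn (fun t => f (c i t)) (Icc 0 1)) (hg : ∀ i, ContinuousOn (fun t => g (c i t)) (Icc 0 1)) :
    contourIntegralOf c (fun w => f w + g w) = contourIntegralOf c f + contourIntegralOf c g := by
  unfold contourIntegralOf
  rw [← Finset.sum_add_distrib]
  refine Finset.sum_congr rfl fun i _ => ?_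
  rw [← intervalIntegral.integral_add]
  · congr 1; ext t; ring
  · apply ContinuousOn.intervalIntegrable
    rw [uIcc_of_le zero_le_one]
    exact (hf i).mul (hc' i).continuousOn
  · apply ContinuousOn.intervalIntegrable
    rw [uIcc_of_le zero_le_one]
    exact (hg i).mul (hc' i).continuousOn

lemma contour_const_mul {n : ℕ} {c : Fin n → ℝ → ℂ} (a : ℂ) (f : ℂ → ℂ) :
    contourIntegralOf c (fun w => a * f w) = a * contourIntegralOf c f := by
  unfold contourIntegralOf
  rw [Finset.mul_sum]
  refine Finset.sum_congr rfl fun i _ => ?_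
  rw [← intervalIntegral.integral_const_mul]
  congr 1; ext t; ring

lemma contour_congr {n : ℕ} {c : Fin n → ℝ → ℂ} {f g : ℂ → ℂ}
    (h : ∀ i, ∀ t ∈ Icc (0:ℝ) 1, f (c i t) = g (c i t)) :
    contourIntegralOf c f = contourIntegralOf c g := by
  unfold contourIntegralOf
  refine Finset.sum_congr rfl fun i _ => ?_
  apply intervalIntegral.integral_congr
  intro t ht
  rw [uIcc_of_le zero_le_one] at ht
  simp only [h i t ht]

lemma dslope_symm (Q : ℂ → ℂ) (a b : ℂ) : dslope Q a b = dslope Q b a := by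
  by_cases h : a = b
  · rw [h]
  · rw [dslope_of_ne _ (Ne.symm h), dslope_of_ne _ h, slope_comm]

lemma contour_zmul {n : ℕ} {c : Fin n → ℝ → ℂ} (hc : ∀ i, Continuous (c i)) (hc' : ∀ i, Continuous (deriv (c i)))
    {f : ℂ → ℂ} (hf : ∀ i, ContinuousOn (fun t => f (c i t)) (Icc 0 1)) :
    Tendsto (fun z => z * contourIntegralOf c (fun w => f w / (w - z))) (cobounded ℂ) (𝓝 (-contourIntegralOf c f)) := by
  have h1 := contour_tendsto_zero hc hc' (f := fun w => f w * w) (fun i => (hf i).mul (hc i).continuousOn)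
  have h2 := h1.add_const (-contourIntegralOf c f)
  rw [zero_add] at h2
  refine h2.congr' ?_
  have hR : ∃ R, ∀ i, ∀ t ∈ Icc (0:ℝ) 1, ‖c i t‖ ≤ R := by
    choose R hR using fun i => isCompact_Icc.exists_bound_of_continuousOn (s := Icc (0:ℝ) 1) (hc i).continuousOn
    obtain ⟨M, hM⟩ := (Set.finite_range R).bddAbove
    exact ⟨M, fun i t ht => (hR i t ht).trans (hM (mem_range_self i))⟩
  obtain ⟨R, hR⟩ := hR
  have : ∀ᶠ z : ℂ in cobounded ℂ, R < ‖z‖ := tendsto_norm_cobounded_atTop.eventually_gt_atTop R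
  filter_upwards [this] with z hz
  have hne : ∀ i, ∀ t ∈ Icc (0:ℝ) 1, c i t - z ≠ 0 := by
    intro i t ht h0
    rw [sub_eq_zero] at h0
    have := hR i t ht
    rw [h0] at this; linarith
  have hcon : ∀ i, ContinuousOn (fun t => f (c i t) / (c i t - z)) (Icc 0 1) := fun i =>
    (hf i).div ((hc i).sub continuous_const).continuousOn (hne i)
  have e : -contourIntegralOf c f = (-1) * contourIntegralOf c f := by ring
  rw [e, ← contour_const_mul, ← contour_const_mul, ← contour_add hc']
  · apply contour_congr
    intro i t ht
    have := hne i t ht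
    field_simp
    ring
  · intro i
    exact ((hf i).mul (hc i).continuousOn).div ((hc i).sub continuous_const).continuousOn (hne i)
  · intro i
    exact continuousOn_const.mul (hf i)

theorem dixon {n : ℕ} {c : Fin n → ℝ → ℂ} (hc : ∀ i, Continuous (c i)) (hc' : ∀ i, Continuous (deriv (c i)))
    {U V : Set ℂ} (hU : IsOpen U) (hV : IsOpen V) (hcU : ∀ i, ∀ t ∈ Icc (0:ℝ) 1, c i t ∈ U)
    (hcV : ∀ i, ∀ t ∈ Icc (0:ℝ) 1, c i t ∉ V) (huv : U ∪ V = univ)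
    (hw : ∀ z ∈ V, contourIntegralOf c (fun w => 1 / (w - z)) = 2 * π * I)
    (hUb : ∀ᶠ z in cobounded ℂ, z ∈ U) {Q : ℂ → ℂ} (hQ : DifferentiableOn ℂ Q U) {q : ℂ}
    (hq : Tendsto (fun z => z * Q z) (cobounded ℂ) (𝓝 q)) :
    contourIntegralOf c Q = 2 * π * I * q := by
  classical
  have hQc : ∀ i, ContinuousOn (fun t => Q (c i t)) (Icc 0 1) := fun i =>
    hQ.continuousOn.comp (hc i).continuousOn (hcU i)
  have hone : ∀ i, ContinuousOn (fun t => (fun _ : ℂ => (1:ℂ)) (c i t)) (Icc 0 1) := fun i => continuousOn_const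
  have hQ0 : Tendsto Q (cobounded ℂ) (𝓝 0) := by
    have h1 := hq.mul (tendsto_inv₀_cobounded (α := ℂ))
    rw [mul_zero] at h1
    refine h1.congr' ?_
    have : ∀ᶠ z : ℂ in cobounded ℂ, 0 < ‖z‖ := tendsto_norm_cobounded_atTop.eventually_gt_atTop 0
    filter_upwards [this] with z hz
    have : z ≠ 0 := norm_pos_iff.1 hz
    field_simp
  let D : ℂ → ℂ := fun z => contourIntegralOf c (fun w => dslope Q z w) + 2 * π * I * Q z
  let Cq : ℂ → ℂ := fun z => contourIntegralOf c (fun w => Q w / (w - z))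
  have hDC : ∀ z ∈ U, (∀ i, ∀ t ∈ Icc (0:ℝ) 1, c i t ≠ z) →
      D z = Cq z - Q z * contourIntegralOf c (fun w => 1 / (w - z)) + 2 * π * I * Q z := by
    intro z hz hne
    have hcon : ∀ i, ∀ f : ℂ → ℂ, ContinuousOn (fun t => f (c i t)) (Icc 0 1) →
        ContinuousOn (fun t => f (c i t) / (c i t - z)) (Icc 0 1) := fun i f hf =>
      hf.div ((hc i).sub continuous_const).continuousOn (fun t ht => sub_ne_zero.2 (hne i t ht))
    simp only [D, Cq]
    congr 1
    rw [sub_eq_add_neg, ← neg_mul, ← contour_const_mul,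
      ← contour_add hc' (f := fun w => Q w / (w - z)) (g := fun w => -Q z * (1 / (w - z))) (fun i => hcon i Q (hQc i))
      (fun i => continuousOn_const.mul (hcon i (fun _ => 1) continuousOn_const))]
    apply contour_congr
    intro i t ht
    rw [dslope_of_ne _ (hne i t ht), slope_def_field]
    have := sub_ne_zero.2 (hne i t ht)
    field_simp
    ring
  have hDdiff : DifferentiableOn ℂ D U := by
    apply DifferentiableOn.fun_add _ ((hQ.const_mul _))
    unfold contourIntegralOf
    apply DifferentiableOn.fun_sum
    intro i _
    obtain ⟨M1, hM1⟩ := isCompact_Icc.exists_bound_of_continuousOn (hQc i)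
    obtain ⟨M2, hM2⟩ := isCompact_Icc.exists_bound_of_continuousOn (s := Icc (0:ℝ) 1) (hc' i).continuousOn
    apply diff_param_interval hU
    · intro z hz
      have : ContinuousOn (dslope Q z) U := ((Complex.differentiableOn_dslope (hU.mem_nhds hz)).2 hQ).continuousOn
      exact (this.comp (hc i).continuousOn (hcU i)).mul (hc' i).continuousOn
    · intro t ht
      have h1 := (Complex.differentiableOn_dslope (hU.mem_nhds (hcU i t ht))).2 hQ
      simp only [dslope_symm Q _ (c i t)]
      exact h1.mul_const _
    · intro z0 hz0
      obtain ⟨r', hr', hball⟩ := Metric.isOpen_iff.1 hU z0 hz0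
      set r := r' / 4 with hr
      have hrp : 0 < r := by positivity
      have hcb : closedBall z0 (3 * r) ⊆ U := (closedBall_subset_ball (by linarith)).trans hball
      obtain ⟨M0, hM0⟩ := (isCompact_closedBall z0 (3*r)).exists_bound_of_continuousOn (hQ.continuousOn.mono hcb)
      have hM00 : 0 ≤ M0 := (norm_nonneg _).trans (hM0 z0 (mem_closedBall_self (by positivity)))
      have hM10 : 0 ≤ M1 := (norm_nonneg _).trans (hM1 0 (by simp))
      refine ⟨r, hrp, (M0 + M1) / r * M2, fun t ht z hz _ => ?_⟩
      rw [norm_mul]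
      have hM2t := hM2 t ht
      have hM1t := hM1 t ht
      have hbd : ∀ y ∈ closedBall z0 (3*r), r ≤ ‖y - c i t‖ → ‖dslope Q (c i t) y‖ ≤ (M0 + M1) / r := by
        intro y hy hyr
        have hne : y ≠ c i t := by
          intro h; rw [h, sub_self, norm_zero] at hyr; linarith
        rw [dslope_of_ne _ hne, slope_def_field, norm_div]
        have := hM0 y hy
        have h3 := norm_sub_le (Q y) (Q (c i t))
        gcongr
        linarith
      have : ‖dslope Q z (c i t)‖ ≤ (M0 + M1) / r := by
        rw [dslope_symm]
        rw [mem_ball] at hz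
        by_cases hw0 : dist (c i t) z0 ≤ 2 * r
        · have hdd : DifferentiableOn ℂ (dslope Q (c i t)) (closedBall z0 (3*r)) :=
            ((Complex.differentiableOn_dslope (hU.mem_nhds (hcU i t ht))).2 hQ).mono hcb
          apply Complex.norm_le_of_forall_mem_frontier_norm_le (U := ball z0 (3*r)) isBounded_ball
          · apply DifferentiableOn.diffContOnCl
            rwa [closure_ball _ (by positivity)]
          · intro y hy
            rw [frontier_ball _ (by positivity), mem_sphere] at hy
            apply hbd y (by rw [mem_closedBall]; exact hy.le)
            rw [← dist_eq_norm]
            have := dist_triangle y (c i t) z0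
            linarith
          · apply subset_closure
            rw [mem_ball]; linarith
        · push Not at hw0
          apply hbd z (by rw [mem_closedBall]; linarith)
          rw [← dist_eq_norm]
          have := dist_triangle (c i t) z z0
          rw [dist_comm (c i t) z] at this
          linarith
      gcongr
  have hCdiff : DifferentiableOn ℂ Cq V := by
    simp only [Cq]
    unfold contourIntegralOf
    apply DifferentiableOn.fun_sum
    intro i _
    obtain ⟨M1, hM1⟩ := isCompact_Icc.exists_bound_of_continuousOn ((hQc i).mul (hc' i).continuousOn)
    have hM10 : 0 ≤ M1 := (norm_nonneg _).trans (hM1 0 (by simp))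
    have hne : ∀ z ∈ V, ∀ t ∈ Icc (0:ℝ) 1, c i t - z ≠ 0 := fun z hz t ht h0 =>
      hcV i t ht (by rw [sub_eq_zero.1 h0]; exact hz)
    apply diff_param_interval hV
    · intro z hz
      exact ((hQc i).div ((hc i).sub continuous_const).continuousOn (hne z hz)).mul (hc' i).continuousOn
    · intro t ht
      apply DifferentiableOn.mul_const
      apply DifferentiableOn.fun_div (by fun_prop) (by fun_prop)
      exact fun z hz => hne z hz t ht
    · intro z0 hz0
      obtain ⟨r', hr', hball⟩ := Metric.isOpen_iff.1 hV z0 hz0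
      refine ⟨r'/2, by positivity, M1 / (r'/2), fun t ht z hz _ => ?_⟩
      rw [div_mul_eq_mul_div, norm_div]
      have h2 := hM1 t ht
      have h3 : r'/2 ≤ ‖c i t - z‖ := by
        have h5 : c i t ∉ ball z0 r' := fun h => hcV i t ht (hball h)
        rw [mem_ball, not_lt] at h5
        rw [mem_ball] at hz
        have := dist_triangle (c i t) z z0
        rw [← dist_eq_norm]; linarith
      simp only [Pi.mul_apply] at h2
      gcongr
  let E : ℂ → ℂ := fun z => if z ∈ U then D z else Cq z
  have hEV : ∀ z ∈ V, E z = Cq z := by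
    intro z hz
    by_cases hzU : z ∈ U
    · simp only [E, if_pos hzU]
      rw [hDC z hzU (fun i t ht h0 => hcV i t ht (by rw [h0]; exact hz)), hw z hz]
      ring
    · simp only [E, if_neg hzU]
  have hEdiff : Differentiable ℂ E := by
    intro z
    have hz : z ∈ U ∪ V := huv ▸ mem_univ z
    rcases hz with hz | hz
    · apply (hDdiff.differentiableAt (hU.mem_nhds hz)).congr_of_eventuallyEq
      filter_upwards [hU.mem_nhds hz] with y hy
      simp only [E, if_pos hy]
    · apply (hCdiff.differentiableAt (hV.mem_nhds hz)).congr_of_eventuallyEq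
      filter_upwards [hV.mem_nhds hz] with y hy
      exact hEV y hy
  have hR : ∃ R, ∀ i, ∀ t ∈ Icc (0:ℝ) 1, ‖c i t‖ ≤ R := by
    choose R hR using fun i => isCompact_Icc.exists_bound_of_continuousOn (s := Icc (0:ℝ) 1) (hc i).continuousOn
    obtain ⟨M, hM⟩ := (Set.finite_range R).bddAbove
    exact ⟨M, fun i t ht => (hR i t ht).trans (hM (mem_range_self i))⟩
  obtain ⟨R, hR⟩ := hR
  have hbig : ∀ᶠ z : ℂ in cobounded ℂ, R < ‖z‖ := tendsto_norm_cobounded_atTop.eventually_gt_atTop R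
  have hEinf : ∀ᶠ z in cobounded ℂ, E z = Cq z - Q z * contourIntegralOf c (fun w => 1 / (w - z)) + 2 * π * I * Q z := by
    filter_upwards [hbig, hUb] with z hz hzU
    simp only [E, if_pos hzU]
    apply hDC z hzU
    intro i t ht h0
    have := hR i t ht
    rw [h0] at this; linarith
  have hone0 := contour_tendsto_zero hc hc' (f := fun _ => 1) hone
  have hE0 : Tendsto E (cobounded ℂ) (𝓝 0) := by
    have h1 : Tendsto Cq (cobounded ℂ) (𝓝 0) := contour_tendsto_zero hc hc' hQc
    have h2 := (h1.sub (hQ0.mul hone0)).add (hQ0.const_mul (2 * π * I))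
    simp only [mul_zero, sub_zero, add_zero] at h2
    exact h2.congr' (hEinf.mono fun z hz => hz.symm)
  have hEz : ∀ z, E z = 0 := fun z => by
    apply hEdiff.apply_eq_of_tendsto_cocompact
    rwa [← Metric.cobounded_eq_cocompact]
  have h5 : Tendsto (fun z => z * E z) (cobounded ℂ) (𝓝 (-contourIntegralOf c Q + 2 * π * I * q)) := by
    have h1 := contour_zmul hc hc' hQc
    have h2 := (h1.sub (hq.mul hone0)).add (hq.const_mul (2 * π * I))
    simp only [mul_zero, sub_zero] at h2
    refine h2.congr' ?_
    filter_upwards [hEinf] with z hz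
    rw [hz]
    simp only [Cq]
    ring
  simp only [hEz, mul_zero] at h5
  have h6 := tendsto_nhds_unique h5 tendsto_const_nhds
  linear_combination -h6
end

section
open scoped ENNReal NNReal Real ComplexConjugate
variable {K : Set ℂ}

structure Geo (B : SmoothBoundary K) (T : ℂ → ℂ) (C : ℝ) : Prop where
  Cpos : 1 ≤ C
  lip : ∀ w b, ‖T w - T b‖ ≤ C * ‖w - b‖
  tan : ∀ i u, T (B.curve i u) = deriv (B.curve i) u / ‖deriv (B.curve i) u‖
  quad : ∀ w ∈ frontier K, ∀ b ∈ frontier K, |((w - b) * conj (T b)).im| ≤ C * ‖w - b‖ ^ 2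

lemma mem_front (B : SmoothBoundary K) {w : ℂ} (hw : w ∈ frontier K) : ∃ i u, B.curve i u = w := by
  rw [← B.boundary] at hw
  simpa using hw

lemma curve_mem (B : SmoothBoundary K) (i u) : B.curve i u ∈ frontier K := by
  rw [← B.boundary]
  exact mem_iUnion.2 ⟨i, mem_range_self u⟩

lemma exists_geo (B : SmoothBoundary K) : ∃ T C, Geo B T C := by
  obtain ⟨c, L, h⟩ := exists_BC B
  obtain ⟨T, C, hT, hT'⟩ := h.exists_tangent
  refine ⟨T, max 1 (max C (L / c ^ 2)), le_max_left _ _, ?_, hT', ?_⟩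
  · intro w b
    have := hT.dist_le_mul w b
    rw [dist_eq_norm, dist_eq_norm] at this
    refine this.trans ?_
    gcongr
    exact (le_max_left _ _).trans (le_max_right _ _)
  · intro w hw b hb
    obtain ⟨i, u, rfl⟩ := mem_front B hw
    obtain ⟨j, v, rfl⟩ := mem_front B hb
    rw [hT' j v]
    refine (h.quad i j u v).trans ?_
    gcongr
    exact (le_max_right _ _).trans (le_max_right _ _)

/-- normal displacement -/
def nr (T : ℂ → ℂ) (b : ℂ) (t : ℝ) : ℂ := b + t * I * T b

namespace Geo
variable {B : SmoothBoundary K} {T : ℂ → ℂ} {C : ℝ}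

lemma norm_T (h : Geo B T C) {w : ℂ} (hw : w ∈ frontier K) : ‖T w‖ = 1 := by
  obtain ⟨i, u, rfl⟩ := mem_front B hw
  rw [h.tan, norm_div, Complex.norm_real, norm_norm, div_self (norm_ne_zero_iff.2 (B.regular i u))]

lemma T_conj (h : Geo B T C) {w : ℂ} (hw : w ∈ frontier K) : T w * conj (T w) = 1 := by
  rw [Complex.mul_conj, Complex.normSq_eq_norm_sq, h.norm_T hw]; simp

lemma contT (h : Geo B T C) : Continuous T := by
  have : LipschitzWith (Real.toNNReal C) T := by
    apply LipschitzWith.of_dist_le_mul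
    intro x y
    rw [dist_eq_norm, dist_eq_norm, Real.coe_toNNReal _ (by linarith [h.Cpos])]
    exact h.lip x y
  exact this.continuous

lemma dist_nr (h : Geo B T C) {w b : ℂ} (hw : w ∈ frontier K) (hb : b ∈ frontier K) {t : ℝ}
    (ht : |t| * (4 * C) ≤ 1) : (‖w - b‖ ^ 2 + t ^ 2) / 2 ≤ ‖w - nr T b t‖ ^ 2 := by
  have hq := h.quad w hw b hb
  have hT := h.norm_T hb
  have e : ‖w - nr T b t‖ ^ 2 = ‖w - b‖ ^ 2 + t ^ 2 - 2 * t * ((w - b) * conj (T b)).im := by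
    have hT2 : (T b).re * (T b).re + (T b).im * (T b).im = 1 := by
      rw [← Complex.normSq_apply, Complex.normSq_eq_norm_sq, hT]; norm_num
    rw [← Complex.normSq_eq_norm_sq, ← Complex.normSq_eq_norm_sq, Complex.normSq_apply, Complex.normSq_apply, nr]
    simp only [sub_re, sub_im, add_re, add_im, mul_re, mul_im, I_re, I_im, ofReal_re, ofReal_im, conj_re, conj_im]
    linear_combination (t^2) * hT2
  have h1 : |2 * t * ((w - b) * conj (T b)).im| ≤ ‖w - b‖ ^ 2 / 2 := by
    rw [abs_mul, abs_mul, abs_two]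
    calc 2 * |t| * |((w - b) * conj (T b)).im| ≤ 2 * |t| * (C * ‖w - b‖ ^ 2) := by gcongr
      _ = (|t| * (4 * C)) * ‖w - b‖ ^ 2 / 2 := by ring
      _ ≤ 1 * ‖w - b‖ ^ 2 / 2 := by gcongr
      _ = _ := by ring
  have h2 := (abs_le.1 h1).2
  rw [e]
  nlinarith [sq_nonneg t]

/-- the tangent discs avoid the boundary -/
lemma disc_avoid (h : Geo B T C) {w b : ℂ} (hw : w ∈ frontier K) (hb : b ∈ frontier K) {t : ℝ}
    (ht : |t| * (4 * C) ≤ 1) : |t| ≤ ‖w - nr T b t‖ := by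
  have hq := h.quad w hw b hb
  have hT := h.norm_T hb
  have e : ‖w - nr T b t‖ ^ 2 = ‖w - b‖ ^ 2 + t ^ 2 - 2 * t * ((w - b) * conj (T b)).im := by
    have hT2 : (T b).re * (T b).re + (T b).im * (T b).im = 1 := by
      rw [← Complex.normSq_apply, Complex.normSq_eq_norm_sq, hT]; norm_num
    rw [← Complex.normSq_eq_norm_sq, ← Complex.normSq_eq_norm_sq, Complex.normSq_apply, Complex.normSq_apply, nr]
    simp only [sub_re, sub_im, add_re, add_im, mul_re, mul_im, I_re, I_im, ofReal_re, ofReal_im, conj_re, conj_im]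
    linear_combination (t^2) * hT2
  have h1 : |2 * t * ((w - b) * conj (T b)).im| ≤ ‖w - b‖ ^ 2 / 2 := by
    rw [abs_mul, abs_mul, abs_two]
    calc 2 * |t| * |((w - b) * conj (T b)).im| ≤ 2 * |t| * (C * ‖w - b‖ ^ 2) := by gcongr
      _ = (|t| * (4 * C)) * ‖w - b‖ ^ 2 / 2 := by ring
      _ ≤ 1 * ‖w - b‖ ^ 2 / 2 := by gcongr
      _ = _ := by ring
  have h2 := (abs_le.1 h1).2
  apply abs_le_of_sq_le_sq _ (norm_nonneg _) |>.trans' (le_abs_self _) |> fun x => x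
  rw [sq_abs, e]
  nlinarith [sq_nonneg ‖w - b‖]

lemma contour_sig (h : Geo B T C) (hK : IsCompact K) {f : ℂ → ℂ} (hf : ContinuousOn f (frontier K)) :
    contourIntegralOf B.curve f = ∫ w, f w * T w ∂(sig B) := by
  rw [sig_integral B (f := fun w => f w * T w) (sig_integrable B hK (hf.mul h.contT.continuousOn))]
  unfold contourIntegralOf
  refine Finset.sum_congr rfl fun i _ => ?_
  congr 1
  ext u
  simp only [h.tan]
  have : (‖deriv (B.curve i) u‖ : ℂ) ≠ 0 := by
    exact_mod_cast norm_ne_zero_iff.2 (B.regular i u)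
  rw [Complex.real_smul]
  field_simp

end Geo

lemma arc_sig (B : SmoothBoundary K) (hK : IsCompact K) {f : ℂ → ℝ} (hf : ContinuousOn f (frontier K)) :
    arcIntegralOf B.curve f = ∫ w, f w ∂(sig B) := by
  rw [sig_integral B (sig_integrable B hK hf)]
  unfold arcIntegralOf
  refine Finset.sum_congr rfl fun i _ => ?_
  congr 1
  ext u
  rw [smul_eq_mul, mul_comm]

lemma closed_int {c : ℝ → ℂ} (hc : Differentiable ℝ c) (hc' : Continuous (deriv c)) (h01 : c 0 = c 1)
    {z : ℂ} (hz : ∀ t, c t ≠ z) :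
    ∃ k : ℤ, ∫ t in (0:ℝ)..1, deriv c t / (c t - z) = k * (2 * π * I) := by
  have hcon : Continuous (fun t => deriv c t / (c t - z)) :=
    hc'.div₀ (hc.continuous.sub continuous_const) (fun t => sub_ne_zero.2 (hz t))
  let Φ : ℝ → ℂ := fun t => ∫ u in (0:ℝ)..t, deriv c u / (c u - z)
  have hΦd : ∀ t, HasDerivAt Φ (deriv c t / (c t - z)) t := fun t =>
    intervalIntegral.integral_hasDerivAt_right (hcon.intervalIntegrable _ _)
      (hcon.stronglyMeasurableAtFilter _ _) hcon.continuousAt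
  have hd : ∀ t, HasDerivAt (fun t => (c t - z) * exp (-Φ t)) 0 t := by
    intro t
    have h1 := ((hc t).hasDerivAt.sub_const z).mul ((hΦd t).neg.cexp)
    refine h1.congr_deriv ?_
    have h2 := div_mul_cancel₀ (deriv c t) (sub_ne_zero.2 (hz t))
    linear_combination -exp (-Φ t) * h2
  have key := is_const_of_deriv_eq_zero (fun t => (hd t).differentiableAt) (fun t => (hd t).deriv) 1 0
  have hΦ0 : Φ 0 = 0 := intervalIntegral.integral_same
  simp only [hΦ0, h01] at key
  have h1 := mul_left_cancel₀ (sub_ne_zero.2 (hz 1)) key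
  rw [neg_zero, Complex.exp_zero, Complex.exp_neg, inv_eq_one, Complex.exp_eq_one_iff] at h1
  exact h1

lemma int_const {X : Type*} [TopologicalSpace X] {s : Set X} (hs : IsPreconnected s) {f : X → ℂ} (hf : ContinuousOn f s)
    (hi : ∀ z ∈ s, ∃ k : ℤ, f z = k * (2 * π * I)) {x y : X} (hx : x ∈ s) (hy : y ∈ s) : f x = f y := by
  have hpi : (2 * π * I : ℂ) ≠ 0 := Complex.two_pi_I_ne_zero
  have hD : DiscreteTopology (range (Int.cast : ℤ → ℝ)) :=
    Int.isClosedEmbedding_coe_real.isEmbedding.toHomeomorph.symm.isEmbedding.discreteTopology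
  have h1 : ContinuousOn (fun z => (f z / (2 * π * I)).re) s :=
    continuous_re.comp_continuousOn (hf.div_const _)
  have h2 : MapsTo (fun z => (f z / (2 * π * I)).re) s (range (Int.cast : ℤ → ℝ)) := by
    intro z hz
    obtain ⟨k, hk⟩ := hi z hz
    refine ⟨k, ?_⟩
    simp only [hk]
    rw [mul_div_cancel_right₀ _ hpi]
    simp
  obtain ⟨c, -, hc⟩ := hs.eqOn_const_of_mapsTo ⟨hD⟩ h1 h2 ⟨_, h2 hx⟩
  have h3 : (f x / (2 * π * I)).re = (f y / (2 * π * I)).re := (hc hx).trans (hc hy).symm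
  obtain ⟨k, hk⟩ := hi x hx
  obtain ⟨l, hl⟩ := hi y hy
  rw [hk, hl, mul_div_cancel_right₀ _ hpi, mul_div_cancel_right₀ _ hpi] at h3
  have : k = l := by exact_mod_cast h3
  rw [hk, hl, this]

/-- family of closed curves: winding integral continuous off a set -/
lemma wind_diff {n : ℕ} {c : Fin n → ℝ → ℂ} (hc : ∀ i, Continuous (c i)) (hc' : ∀ i, Continuous (deriv (c i)))
    {f : ℂ → ℂ} (hf : ∀ i, ContinuousOn (fun t => f (c i t)) (Icc 0 1))
    {V : Set ℂ} (hV : IsOpen V) (hcV : ∀ i, ∀ t ∈ Icc (0:ℝ) 1, c i t ∉ V) :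
    DifferentiableOn ℂ (fun z => contourIntegralOf c (fun w => f w / (w - z))) V := by
  unfold contourIntegralOf
  apply DifferentiableOn.fun_sum
  intro i _
  obtain ⟨M1, hM1⟩ := isCompact_Icc.exists_bound_of_continuousOn ((hf i).mul (hc' i).continuousOn)
  have hM10 : 0 ≤ M1 := (norm_nonneg _).trans (hM1 0 (by simp))
  have hne : ∀ z ∈ V, ∀ t ∈ Icc (0:ℝ) 1, c i t - z ≠ 0 := fun z hz t ht h0 =>
    hcV i t ht (by rw [sub_eq_zero.1 h0]; exact hz)
  apply diff_param_interval hV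
  · intro z hz
    exact ((hf i).div₀ ((hc i).sub continuous_const).continuousOn (hne z hz)).mul (hc' i).continuousOn
  · intro t ht
    apply DifferentiableOn.mul_const
    exact (differentiableOn_const _).fun_div ((differentiableOn_const _).sub differentiableOn_id) (fun z hz => hne z hz t ht)
  · intro z0 hz0
    obtain ⟨r, hr, hball⟩ := Metric.isOpen_iff.1 hV z0 hz0
    refine ⟨r / 2, by positivity, M1 / (r / 2), fun t ht z hz _ => ?_⟩
    rw [div_mul_eq_mul_div, norm_div]
    have h1 := hM1 t ht
    have h2 : r / 2 ≤ ‖c i t - z‖ := by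
      by_contra hcon
      push Not at hcon
      apply hcV i t ht
      apply hball
      rw [mem_ball] at hz ⊢
      rw [← dist_eq_norm] at hcon
      have := dist_triangle (c i t) z z0
      linarith
    gcongr
    exact h1
end

section
open scoped ENNReal NNReal Real ComplexConjugate
variable {K : Set ℂ}

lemma curve01 (B : SmoothBoundary K) (i : Fin B.n) : B.curve i 0 = B.curve i 1 := by
  have := B.periodic i 0
  rw [zero_add] at this; exact this.symm

lemma wind_eq {n : ℕ} (c : Fin n → ℝ → ℂ) (z : ℂ) : contourIntegralOf c (fun w => 1 / (w - z)) =
    ∑ i, ∫ t in (0:ℝ)..1, deriv (c i) t / (c i t - z) := by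
  unfold contourIntegralOf
  refine Finset.sum_congr rfl fun i _ => ?_
  congr 1; ext u; ring

lemma wind_in (B : SmoothBoundary K) {z : ℂ} (hz : z ∈ interior K) :
    contourIntegralOf B.curve (fun w => 1 / (w - z)) = 2 * π * I := by
  rw [wind_eq]; exact B.orientation z hz

lemma wind_isint {n : ℕ} {c : Fin n → ℝ → ℂ} (hc : ∀ i, Differentiable ℝ (c i)) (hc' : ∀ i, Continuous (deriv (c i)))
    (h01 : ∀ i, c i 0 = c i 1) {z : ℂ} (hz : ∀ i t, c i t ≠ z) :
    ∃ k : ℤ, contourIntegralOf c (fun w => 1 / (w - z)) = k * (2 * π * I) := by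
  rw [wind_eq]
  choose k hk using fun i => closed_int (hc i) (hc' i) (h01 i) (hz i)
  refine ⟨∑ i, k i, ?_⟩
  simp only [hk]
  push_cast
  rw [Finset.sum_mul]

lemma compl_nhds_inf (hK : IsCompact K) : Kᶜ ∈ cobounded ℂ := by
  rw [Metric.cobounded_eq_cocompact]
  exact hK.compl_mem_cocompact

lemma bd_wind_const (B : SmoothBoundary K) {s : Set ℂ} (hs : IsPreconnected s) (hd : Disjoint s (frontier K))
    {x y : ℂ} (hx : x ∈ s) (hy : y ∈ s) :
    contourIntegralOf B.curve (fun w => 1 / (w - x)) = contourIntegralOf B.curve (fun w => 1 / (w - y)) := by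
  apply int_const hs (f := fun z => contourIntegralOf B.curve (fun w => 1 / (w - z))) _ _ hx hy
  · apply ContinuousOn.mono _ (show s ⊆ (frontier K)ᶜ from fun z hz hz' => hd.le_bot ⟨hz, hz'⟩)
    apply DifferentiableOn.continuousOn (𝕜 := ℂ)
    exact wind_diff (f := fun _ => 1) (fun i => (B.jc i).cont) (fun i => (B.jc i).contDeriv)
      (fun i => continuousOn_const) (isClosed_frontier.isOpen_compl) (fun i t _ h => h (curve_mem B i t))
  · intro z hz
    apply wind_isint (fun i t => ((B.jc i).hasDeriv t).differentiableAt) (fun i => (B.jc i).contDeriv) (curve01 B)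
    intro i t h0
    exact hd.le_bot ⟨hz, h0 ▸ curve_mem B i t⟩

lemma compl_disj (hK : IsCompact K) : Disjoint Kᶜ (frontier K) := by
  rw [Set.disjoint_left]
  intro z hz hz'
  exact hz (hK.isClosed.frontier_subset hz')

lemma wind_out (B : SmoothBoundary K) (hK : IsCompact K) (hconn : IsConnected Kᶜ) {z : ℂ} (hz : z ∈ Kᶜ) :
    contourIntegralOf B.curve (fun w => 1 / (w - z)) = 0 := by
  have h1 := contour_tendsto_zero (f := fun _ => 1) (fun i => (B.jc i).cont) (fun i => (B.jc i).contDeriv)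
      (fun i => continuousOn_const)
  have h2 : ∀ᶠ y in cobounded ℂ, contourIntegralOf B.curve (fun w => 1 / (w - y)) =
      contourIntegralOf B.curve (fun w => 1 / (w - z)) := by
    filter_upwards [compl_nhds_inf hK] with y hy
    exact bd_wind_const B hconn.isPreconnected (compl_disj hK) hy hz
  exact tendsto_nhds_unique (tendsto_const_nhds.congr' (h2.mono fun _ h => h.symm)) h1

lemma off_front (hK : IsCompact K) {z : ℂ} (hz : z ∉ frontier K) : z ∈ interior K ∨ z ∈ Kᶜ := by
  by_cases h : z ∈ K
  · left
    by_contra h2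
    exact hz ⟨subset_closure h, h2⟩
  · right; exact h

namespace Geo
variable {B : SmoothBoundary K} {T : ℂ → ℂ} {C : ℝ}

/-- the pointwise comparison kernel estimate for the side lemma -/
lemma side_kernel (h : Geo B T C) {w b : ℂ} (hw : w ∈ frontier K) (hb : b ∈ frontier K) {t : ℝ} (ht0 : 0 < t)
    (ht : t * (4 * C) ≤ 1) :
    ‖(1 / (w - nr T b t) * T w - 1 / (w - nr T b (-t)) * T w) - I * ((2 * t / (‖w - b‖ ^ 2 + t ^ 2) : ℝ) : ℂ)‖ ≤
      12 * C * (t * ‖w - b‖ / (‖w - b‖ ^ 2 + t ^ 2)) := by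
  obtain ⟨q, hq⟩ : ∃ q, q = (w - b) * conj (T b) := ⟨_, rfl⟩
  have hTT := h.T_conj hb
  have hTb : ‖T b‖ = 1 := h.norm_T hb
  have hT0 : T b ≠ 0 := by
    intro h0; rw [h0, norm_zero] at hTb; norm_num at hTb
  have hwb : w - b = q * T b := by rw [hq, mul_assoc, mul_comm (conj _), hTT, mul_one]
  have hnq : ‖w - b‖ = ‖q‖ := by rw [hwb, norm_mul, hTb, mul_one]
  have hy := h.quad w hw b hb
  rw [← hq, hnq] at hy
  have hd1 := h.dist_nr hw hb (t := t) (by rwa [abs_of_pos ht0])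
  have hd2 := h.dist_nr hw hb (t := -t) (by rwa [abs_neg, abs_of_pos ht0])
  have e1 : w - nr T b t = (q - I * t) * T b := by
    rw [nr]; linear_combination hwb
  have e2 : w - nr T b (-t) = (q + I * t) * T b := by
    rw [nr]; push_cast; linear_combination hwb
  rw [e1, hnq, norm_mul, hTb, mul_one] at hd1
  rw [e2, hnq, norm_mul, hTb, mul_one, neg_sq] at hd2
  obtain ⟨P, hP⟩ : ∃ P, P = ‖q‖ ^ 2 + t ^ 2 := ⟨_, rfl⟩
  rw [← hP] at hd1 hd2
  have hPpos : 0 < P := by rw [hP]; positivity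
  have hn1 : q - I * t ≠ 0 := by
    intro h0; rw [h0, norm_zero] at hd1; nlinarith
  have hn2 : q + I * t ≠ 0 := by
    intro h0; rw [h0, norm_zero] at hd2; nlinarith
  obtain ⟨D, hD⟩ : ∃ D, D = (q - I * t) * (q + I * t) := ⟨_, rfl⟩
  have hDn : P / 2 ≤ ‖D‖ := by
    rw [hD, norm_mul]
    apply le_of_sq_le_sq _ (by positivity)
    calc (P / 2) ^ 2 = P / 2 * (P / 2) := by ring
      _ ≤ ‖q - I * t‖ ^ 2 * ‖q + I * t‖ ^ 2 := by gcongr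
      _ = _ := by ring
  have hD0 : D ≠ 0 := hD ▸ mul_ne_zero hn1 hn2
  have hPc : (P : ℂ) ≠ 0 := by exact_mod_cast hPpos.ne'
  have hI2 := I_sq
  have hDe : D = q ^ 2 + t ^ 2 := by rw [hD]; linear_combination (-(t:ℂ)^2) * hI2
  have hPe : (P : ℂ) = q * conj q + t ^ 2 := by
    rw [Complex.mul_conj, Complex.normSq_eq_norm_sq, hP]; push_cast; ring
  rw [e1, e2, hnq, ← hP]
  have e3 : (1 / ((q - I * t) * T b) * T w - 1 / ((q + I * t) * T b) * T w) - I * ((2 * t / P : ℝ) : ℂ)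
      = 2 * I * t * ((T w - T b) / (T b * D) + (P - D) / (D * P)) := by
    rw [hD]
    push_cast
    field_simp
    ring
  rw [e3]
  have hPD : ‖(P:ℂ) - D‖ ≤ 2 * C * ‖q‖ ^ 3 := by
    have : (P:ℂ) - D = q * (-(2 * q.im : ℝ) * I) := by
      rw [hDe, hPe]
      have := Complex.sub_conj q
      linear_combination (-q) * this
    rw [this, norm_mul, norm_mul, norm_I, mul_one, norm_neg, Complex.norm_real, Real.norm_eq_abs, abs_mul, abs_two]
    calc ‖q‖ * (2 * |q.im|) ≤ ‖q‖ * (2 * (C * ‖q‖ ^ 2)) := by gcongr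
      _ = _ := by ring
  have hTw : ‖T w - T b‖ ≤ C * ‖q‖ := by rw [← hnq]; exact h.lip w b
  have hC : 0 < C := by linarith [h.Cpos]
  have b1 : ‖(T w - T b) / (T b * D)‖ ≤ C * ‖q‖ / (P / 2) := by
    rw [norm_div, norm_mul, hTb, one_mul]; gcongr
  have b2 : ‖((P:ℂ) - D) / (D * P)‖ ≤ 2 * C * ‖q‖ ^ 3 / (P / 2 * P) := by
    rw [norm_div, norm_mul, Complex.norm_real, Real.norm_eq_abs, abs_of_pos hPpos]; gcongr
  have b3 : 2 * C * ‖q‖ ^ 3 / (P / 2 * P) ≤ 4 * C * ‖q‖ / P := by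
    rw [div_le_div_iff₀ (by positivity) hPpos]
    have : ‖q‖ ^ 2 ≤ P := by rw [hP]; nlinarith
    have h5 : 2 * C * ‖q‖ * P * (‖q‖ ^ 2) ≤ 2 * C * ‖q‖ * P * P := by gcongr
    nlinarith
  rw [norm_mul, norm_mul, norm_mul, norm_I, Complex.norm_real, Real.norm_eq_abs, abs_of_pos ht0, Complex.norm_two]
  calc 2 * 1 * t * ‖(T w - T b) / (T b * D) + (P - D) / (D * P)‖ ≤ 2 * 1 * t * (C * ‖q‖ / (P / 2) + 4 * C * ‖q‖ / P) := by
        gcongr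
        exact (norm_add_le _ _).trans (add_le_add b1 (b2.trans b3))
    _ = _ := by field_simp; ring

lemma nr_off (h : Geo B T C) {b : ℂ} (hb : b ∈ frontier K) {t : ℝ} (ht0 : t ≠ 0)
    (ht : |t| * (4 * C) ≤ 1) : nr T b t ∉ frontier K := by
  intro h0
  have := h.disc_avoid h0 hb ht
  rw [sub_self, norm_zero] at this
  exact ht0 (abs_eq_zero.1 (le_antisymm this (abs_nonneg _)))

lemma off_cont {z : ℂ} (hz : z ∉ frontier K) : ContinuousOn (fun w => 1 / (w - z)) (frontier K) :=
  continuousOn_const.div₀ (continuousOn_id.sub continuousOn_const) (fun w hw h0 => hz (sub_eq_zero.1 h0 ▸ hw))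

lemma side_tendsto (h : Geo B T C) (hK : IsCompact K) {b : ℂ} (hb : b ∈ frontier K) :
    Tendsto (fun t : ℝ => contourIntegralOf B.curve (fun w => 1 / (w - nr T b t)) -
      contourIntegralOf B.curve (fun w => 1 / (w - nr T b (-t)))) (𝓝[>] 0) (𝓝 (2 * π * I)) := by
  have hC := h.Cpos
  have hsmall : ∀ᶠ t : ℝ in 𝓝[>] 0, 0 < t ∧ t * (4 * C) ≤ 1 := by
    have : (0:ℝ) < 1 / (4 * C) := by positivity
    filter_upwards [Ioo_mem_nhdsGT this] with t ht
    refine ⟨ht.1, ?_⟩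
    have := ht.2.le
    rwa [le_div_iff₀ (by positivity)] at this
  have hp := (sig_poisson_limit B hK (y := fun _ => 1) continuous_const hb).const_mul I
  have hz : Tendsto (fun t : ℝ => ∫ w, ((1 / (w - nr T b t) * T w - 1 / (w - nr T b (-t)) * T w) -
      I * ((2 * t / (‖w - b‖ ^ 2 + t ^ 2) : ℝ) : ℂ)) ∂(sig B)) (𝓝[>] 0) (𝓝 (∫ w, (0:ℂ) ∂(sig B))) := by
    apply tendsto_integral_filter_of_dominated_convergence (fun _ => 6 * C)
    · filter_upwards [hsmall] with t ht
      have c1 := off_cont (h.nr_off hb ht.1.ne' (by rw [abs_of_pos ht.1]; exact ht.2))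
      have c2 := off_cont (h.nr_off hb (neg_ne_zero.2 ht.1.ne') (by rw [abs_neg, abs_of_pos ht.1]; exact ht.2))
      apply (sig_integrable B hK _).aestronglyMeasurable
      apply ((c1.mul h.contT.continuousOn).sub (c2.mul h.contT.continuousOn)).sub
      apply Continuous.continuousOn
      have ht0 := ht.1
      have : ∀ w : ℂ, ‖w - b‖ ^ 2 + t ^ 2 ≠ 0 := fun w => by positivity
      fun_prop (disch := assumption)
    · filter_upwards [hsmall] with t ht
      filter_upwards [sig_ae_mem B] with w hw
      refine (h.side_kernel hw hb ht.1 ht.2).trans ?_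
      have ht0 := ht.1
      have : t * ‖w - b‖ / (‖w - b‖ ^ 2 + t ^ 2) ≤ 1 / 2 := by
        rw [div_le_div_iff₀ (by positivity) two_pos]
        nlinarith [sq_nonneg (t - ‖w - b‖)]
      nlinarith
    · exact integrable_const _
    · filter_upwards [sig_ae_mem B, sig_noatom B b] with w hw hwb
      have h1 : Tendsto (fun t : ℝ => 12 * C * (t * ‖w - b‖ / (‖w - b‖ ^ 2 + t ^ 2))) (𝓝[>] 0) (𝓝 0) := by
        have h2 : 0 < ‖w - b‖ := norm_pos_iff.2 (sub_ne_zero.2 hwb)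
        have : ContinuousAt (fun t : ℝ => 12 * C * (t * ‖w - b‖ / (‖w - b‖ ^ 2 + t ^ 2))) 0 := by
          apply ContinuousAt.mul continuousAt_const
          apply ContinuousAt.div₀ (by fun_prop) (by fun_prop)
          positivity
        have h3 := this.tendsto.mono_left (nhdsWithin_le_nhds (s := Ioi 0))
        simpa using h3
      apply squeeze_zero_norm' _ h1
      filter_upwards [hsmall] with t ht using h.side_kernel hw hb ht.1 ht.2
  rw [integral_zero] at hz
  have hs := hz.add hp
  rw [zero_add, mul_one, show I * (2 * (π:ℂ)) = 2 * π * I by ring] at hs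
  refine hs.congr' ?_
  filter_upwards [hsmall] with t ht
  have ht0 := ht.1
  have c1 := off_cont (h.nr_off hb ht.1.ne' (by rw [abs_of_pos ht.1]; exact ht.2))
  have c2 := off_cont (h.nr_off hb (neg_ne_zero.2 ht.1.ne') (by rw [abs_neg, abs_of_pos ht.1]; exact ht.2))
  have c3 : Continuous (fun w : ℂ => I * ((2 * t / (‖w - b‖ ^ 2 + t ^ 2) : ℝ) : ℂ)) := by
    have : ∀ w : ℂ, ‖w - b‖ ^ 2 + t ^ 2 ≠ 0 := fun w => by positivity
    fun_prop (disch := assumption)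
  rw [h.contour_sig hK c1, h.contour_sig hK c2, integral_sub, integral_sub]
  · have : ∫ z, (2 * t / (‖z - b‖ ^ 2 + t ^ 2)) • (1:ℂ) ∂(sig B) = ∫ w, ((2 * t / (‖w - b‖ ^ 2 + t ^ 2) : ℝ) : ℂ) ∂(sig B) := by
      congr 1; ext z; rw [Complex.real_smul, mul_one]
    rw [this, integral_const_mul]
    ring
  · exact sig_integrable B hK (c1.mul h.contT.continuousOn)
  · exact sig_integrable B hK (c2.mul h.contT.continuousOn)
  · exact (sig_integrable B hK (c1.mul h.contT.continuousOn)).sub (sig_integrable B hK (c2.mul h.contT.continuousOn))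
  · exact sig_integrable B hK c3.continuousOn

lemma ball_disj (h : Geo B T C) {b : ℂ} (hb : b ∈ frontier K) {t : ℝ}
    (ht : |t| * (4 * C) ≤ 1) : Disjoint (ball (nr T b t) |t|) (frontier K) := by
  rw [Set.disjoint_left]
  intro w hw hw'
  have := h.disc_avoid hw' hb ht
  rw [mem_ball, dist_eq_norm] at hw
  linarith

lemma nr_mem_ball (h : Geo B T C) {b : ℂ} (hb : b ∈ frontier K) {t s : ℝ} (hs : 0 < s) (hst : s ≤ t) :
    nr T b s ∈ ball (nr T b t) t ∧ nr T b (-s) ∈ ball (nr T b (-t)) t := by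
  have : ∀ x y : ℝ, dist (nr T b x) (nr T b y) = |x - y| := by
    intro x y
    rw [dist_eq_norm, nr, nr, show b + x * I * T b - (b + y * I * T b) = ((x - y : ℝ) : ℂ) * I * T b by push_cast; ring,
      norm_mul, norm_mul, norm_I, h.norm_T hb, mul_one, mul_one, Complex.norm_real, Real.norm_eq_abs]
  rw [mem_ball, mem_ball, this, this, abs_lt, abs_lt]
  constructor <;> constructor <;> linarith

/-- the side lemma -/
lemma side (h : Geo B T C) (hK : IsCompact K) (hconn : IsConnected Kᶜ) {b : ℂ} (hb : b ∈ frontier K) {t : ℝ} (ht0 : 0 < t)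
    (ht : t * (4 * C) ≤ 1) : ball (nr T b t) t ⊆ interior K ∧ ball (nr T b (-t)) t ⊆ Kᶜ := by
  have hC := h.Cpos
  have hlim := h.side_tendsto hK hb
  have d1 := h.ball_disj hb (t := t) (by rwa [abs_of_pos ht0])
  have d2 := h.ball_disj hb (t := -t) (by rwa [abs_neg, abs_of_pos ht0])
  rw [abs_of_pos ht0] at d1
  rw [abs_neg, abs_of_pos ht0] at d2
  have pc : ∀ x : ℂ, IsPreconnected (ball x t) := fun x => (convex_ball x t).isPreconnected
  have hN : contourIntegralOf B.curve (fun w => 1 / (w - nr T b t)) -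
      contourIntegralOf B.curve (fun w => 1 / (w - nr T b (-t))) = 2 * π * I := by
    apply tendsto_nhds_unique _ hlim
    apply tendsto_const_nhds.congr'
    filter_upwards [Ioc_mem_nhdsGT ht0] with s hs
    obtain ⟨m1, m2⟩ := h.nr_mem_ball hb hs.1 hs.2
    obtain ⟨m3, m4⟩ := h.nr_mem_ball hb ht0 le_rfl
    rw [bd_wind_const B (pc _) d1 m1 m3, bd_wind_const B (pc _) d2 m2 m4]
  obtain ⟨m3, m4⟩ := h.nr_mem_ball hb ht0 le_rfl
  have hpi : (2 * π * I : ℂ) ≠ 0 := Complex.two_pi_I_ne_zero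
  constructor
  · intro z hz
    rcases off_front hK (z := z) (fun h => d1.le_bot ⟨hz, h⟩) with h1 | h1
    · exact h1
    · exfalso
      rw [bd_wind_const B (pc _) d1 m3 hz, wind_out B hK hconn h1] at hN
      rcases off_front hK (z := nr T b (-t)) (fun h => d2.le_bot ⟨m4, h⟩) with h2 | h2
      · rw [wind_in B h2] at hN
        have : (2 * π * I : ℂ) = 0 := by linear_combination (-1/2) * hN
        exact hpi this
      · rw [wind_out B hK hconn h2] at hN
        exact hpi (by rw [← hN]; ring)
  · intro z hz
    rcases off_front hK (z := z) (fun h => d2.le_bot ⟨hz, h⟩) with h1 | h1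
    · exfalso
      rw [bd_wind_const B (pc _) d2 m4 hz, wind_in B h1] at hN
      rcases off_front hK (z := nr T b t) (fun h => d1.le_bot ⟨m3, h⟩) with h2 | h2
      · rw [wind_in B h2] at hN
        exact hpi (by rw [← hN]; ring)
      · rw [wind_out B hK hconn h2] at hN
        have : (2 * π * I : ℂ) = 0 := by linear_combination (-1/2) * hN
        exact hpi this
    · exact h1

end Geo
end

section
open scoped ENNReal NNReal Real ComplexConjugate
variable {K : Set ℂ}

def Rsp (P : Set ℂ) : Submodule ℂ (ℂ → ℂ) :=
  Submodule.span ℂ {f | ∃ s ∈ P, ∃ k : ℕ, f = fun z => ((z - s) ^ (k + 1))⁻¹}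

lemma Rsp.isRational {P S : Set ℂ} (hPS : P ⊆ S) {R : ℂ → ℂ} (hR : R ∈ Rsp P) :
    IsRationalVanishingAtInftyWithPoles S R := by
  classical
  unfold Rsp at hR
  rw [Submodule.mem_span_set'] at hR
  obtain ⟨n, f, g, rfl⟩ := hR
  choose s hs k hk using fun i => (g i).2
  obtain ⟨d, hd⟩ : ∃ d, ∀ i, k i < d := by
    obtain ⟨M, hM⟩ := (Set.finite_range k).bddAbove
    exact ⟨M + 1, fun i => Nat.lt_succ_of_le (hM (mem_range_self i))⟩
  refine ⟨n, d, s, fun i j => if (j:ℕ) = k i then f i else 0, fun i => hPS (hs i), ?_⟩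
  ext z
  rw [Finset.sum_apply]
  refine Finset.sum_congr rfl fun i _ => ?_
  rw [Finset.sum_eq_single (⟨k i, hd i⟩ : Fin d)]
  · simp [hk, div_eq_mul_inv]
  · intro j _ hj
    beta_reduce
    rw [if_neg, zero_div]
    intro h; apply hj; ext; exact h
  · simp

/-- holomorphic off a finite subset of `P`, with `z R z → a` at infinity. -/
def Good (P : Set ℂ) (R : ℂ → ℂ) (a : ℂ) : Prop :=
  (∃ F : Set ℂ, F.Finite ∧ F ⊆ P ∧ DifferentiableOn ℂ R Fᶜ) ∧
    Tendsto (fun z => z * R z) (cobounded ℂ) (𝓝 a)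

lemma Good.tendsto_zero {P : Set ℂ} {R : ℂ → ℂ} {a : ℂ} (h : Good P R a) : Tendsto R (cobounded ℂ) (𝓝 0) := by
  have h1 := h.2.mul (tendsto_inv₀_cobounded (α := ℂ))
  rw [mul_zero] at h1
  refine h1.congr' ?_
  have : ∀ᶠ z : ℂ in cobounded ℂ, 0 < ‖z‖ := tendsto_norm_cobounded_atTop.eventually_gt_atTop 0
  filter_upwards [this] with z hz
  have : z ≠ 0 := norm_pos_iff.1 hz
  field_simp

lemma Good.add {P : Set ℂ} {R R' : ℂ → ℂ} {a a' : ℂ} (h : Good P R a) (h' : Good P R' a') :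
    Good P (R + R') (a + a') := by
  obtain ⟨⟨F, hF, hFP, hd⟩, ht⟩ := h
  obtain ⟨⟨F', hF', hFP', hd'⟩, ht'⟩ := h'
  refine ⟨⟨F ∪ F', hF.union hF', union_subset hFP hFP', ?_⟩, ?_⟩
  · exact (hd.mono (compl_subset_compl.2 subset_union_left)).add (hd'.mono (compl_subset_compl.2 subset_union_right))
  · refine (ht.add ht').congr fun z => ?_
    simp only [Pi.add_apply]; ring

lemma Good.smul {P : Set ℂ} {R : ℂ → ℂ} {a : ℂ} (h : Good P R a) (c : ℂ) : Good P (c • R) (c * a) := by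
  obtain ⟨⟨F, hF, hFP, hd⟩, ht⟩ := h
  refine ⟨⟨F, hF, hFP, hd.const_smul c⟩, ?_⟩
  refine (ht.const_mul c).congr fun z => ?_
  simp only [Pi.smul_apply, smul_eq_mul]; ring

lemma Good.mul {P : Set ℂ} {R R' : ℂ → ℂ} {a a' : ℂ} (h : Good P R a) (h' : Good P R' a') :
    Good P (R * R') 0 := by
  have h0 := h'.tendsto_zero
  obtain ⟨⟨F, hF, hFP, hd⟩, ht⟩ := h
  obtain ⟨⟨F', hF', hFP', hd'⟩, ht'⟩ := h'
  refine ⟨⟨F ∪ F', hF.union hF', union_subset hFP hFP', ?_⟩, ?_⟩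
  · exact (hd.mono (compl_subset_compl.2 subset_union_left)).mul (hd'.mono (compl_subset_compl.2 subset_union_right))
  · have := ht.mul h0
    rw [mul_zero] at this
    refine this.congr fun z => ?_
    simp only [Pi.mul_apply]; ring

lemma good_base {P : Set ℂ} {s : ℂ} (hs : s ∈ P) : Good P (fun z => ((z - s) ^ (0 + 1))⁻¹) 1 := by
  refine ⟨⟨{s}, finite_singleton s, singleton_subset_iff.2 hs, ?_⟩, ?_⟩
  · intro z hz
    have : z - s ≠ 0 := sub_ne_zero.2 hz
    apply DifferentiableAt.differentiableWithinAt
    apply DifferentiableAt.fun_inv (by fun_prop)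
    simpa using this
  · have h1 : Tendsto (fun z : ℂ => z * z⁻¹ * (1 - s * z⁻¹)⁻¹) (cobounded ℂ) (𝓝 (1 * (1 - s * 0)⁻¹)) := by
      apply Tendsto.mul
      · apply tendsto_const_nhds.congr'
        have : ∀ᶠ z : ℂ in cobounded ℂ, 0 < ‖z‖ := tendsto_norm_cobounded_atTop.eventually_gt_atTop 0
        filter_upwards [this] with z hz
        rw [mul_inv_cancel₀ (norm_pos_iff.1 hz)]
      · apply Tendsto.inv₀
        · exact tendsto_const_nhds.sub (tendsto_inv₀_cobounded.const_mul s)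
        · simp
    simp only [mul_zero, sub_zero, inv_one, mul_one] at h1
    refine h1.congr' ?_
    have : ∀ᶠ z : ℂ in cobounded ℂ, 0 < ‖z‖ := tendsto_norm_cobounded_atTop.eventually_gt_atTop 0
    filter_upwards [this] with z hz
    have hz0 := norm_pos_iff.1 hz
    rw [zero_add, pow_one]
    have : 1 - s * z⁻¹ = (z - s) * z⁻¹ := by field_simp
    rw [this, mul_inv, inv_inv]
    field_simp

lemma good_gen {P : Set ℂ} {s : ℂ} (hs : s ∈ P) (k : ℕ) : ∃ a, Good P (fun z => ((z - s) ^ (k + 1))⁻¹) a := by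
  induction k with
  | zero => exact ⟨1, good_base hs⟩
  | succ k ih =>
    obtain ⟨a, ha⟩ := ih
    refine ⟨0, ?_⟩
    have := ha.mul (good_base hs)
    convert this using 1
    ext z
    simp only [Pi.mul_apply]
    rw [← mul_inv, ← pow_add]

lemma good_of_mem {P : Set ℂ} {R : ℂ → ℂ} (hR : R ∈ Rsp P) : ∃ a, Good P R a := by
  induction hR using Submodule.span_induction with
  | mem f hf =>
    obtain ⟨s, hs, k, rfl⟩ := hf
    exact good_gen hs k
  | zero => exact ⟨0, ⟨∅, finite_empty, empty_subset _, differentiableOn_const 0⟩, by simp⟩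
  | add x y _ _ hx hy =>
    obtain ⟨a, ha⟩ := hx
    obtain ⟨b, hb⟩ := hy
    exact ⟨_, ha.add hb⟩
  | smul c x _ hx =>
    obtain ⟨a, ha⟩ := hx
    exact ⟨_, ha.smul c⟩

lemma Good.diffOn {P : Set ℂ} {R : ℂ → ℂ} {a : ℂ} (h : Good P R a) {s : Set ℂ} (hs : Disjoint s P) :
    DifferentiableOn ℂ R s := by
  obtain ⟨⟨F, hF, hFP, hd⟩, ht⟩ := h
  exact hd.mono fun z hz hz' => hs.le_bot ⟨hz, hFP hz'⟩

lemma front_disj {P : Set ℂ} (hP : P ⊆ interior K) : Disjoint (frontier K) P := by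
  rw [Set.disjoint_left]
  intro z hz hz'
  exact hz.2 (hP hz')

lemma Good.contF {P : Set ℂ} {R : ℂ → ℂ} {a : ℂ} (h : Good P R a) (hP : P ⊆ interior K) :
    ContinuousOn R (frontier K) := (h.diffOn (front_disj hP)).continuousOn

namespace Geo
variable {B : SmoothBoundary K} {T : ℂ → ℂ} {C : ℝ}

lemma good_int (h : Geo B T C) (hK : IsCompact K) {P : Set ℂ} (hP : P ⊆ interior K) {R : ℂ → ℂ} {a : ℂ}
    (hR : Good P R a) : ∫ w, R w * T w ∂(sig B) = 2 * π * I * a := by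
  rw [← h.contour_sig hK (hR.contF hP)]
  obtain ⟨⟨F, hF, hFP, hd⟩, ht⟩ := hR
  apply dixon (U := Fᶜ) (V := interior K) (fun i => (B.jc i).cont) (fun i => (B.jc i).contDeriv) 
    hF.isClosed.isOpen_compl isOpen_interior _ _ _ (fun z hz => wind_in B hz) _ hd ht
  · intro i t _ h0
    exact (curve_mem B i t).2 (hP (hFP h0))
  · intro i t _ h0
    exact (curve_mem B i t).2 h0
  · rw [eq_univ_iff_forall]
    intro z
    by_cases hz : z ∈ F
    · right; exact hP (hFP hz)
    · left; exact hz
  · rw [Metric.cobounded_eq_cocompact]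
    exact hF.isCompact.compl_mem_cocompact

end Geo

lemma contour_const_zero {n : ℕ} {c : Fin n → ℝ → ℂ} (hc : ∀ i, Differentiable ℝ (c i)) (hc' : ∀ i, Continuous (deriv (c i)))
    (h01 : ∀ i, c i 0 = c i 1) (l : ℂ) : contourIntegralOf c (fun _ => l) = 0 := by
  unfold contourIntegralOf
  apply Finset.sum_eq_zero
  intro i _
  rw [intervalIntegral.integral_const_mul, intervalIntegral.integral_deriv_eq_sub (fun t _ => hc i t)
    ((hc' i).intervalIntegrable _ _), h01 i, sub_self, mul_zero]

lemma Geo.int_T {B : SmoothBoundary K} {T : ℂ → ℂ} {C : ℝ} (h : Geo B T C) (hK : IsCompact K) :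
    ∫ w, T w ∂(sig B) = 0 := by
  have := contour_const_zero (c := B.curve) (fun i t => ((B.jc i).hasDeriv t).differentiableAt) (fun i => (B.jc i).contDeriv) (curve01 B) 1
  rw [h.contour_sig hK continuousOn_const] at this
  simpa using this
end

section
open scoped ENNReal NNReal Real ComplexConjugate
variable {K : Set ℂ}

/-- unit tangent along the curve -/
def tau (B : SmoothBoundary K) (i : Fin B.n) (u : ℝ) : ℂ := deriv (B.curve i) u / ‖deriv (B.curve i) u‖

/-- outer parallel curve -/
def outer (B : SmoothBoundary K) (t : ℝ) (i : Fin B.n) (u : ℝ) : ℂ := B.curve i u - t * (I * tau B i u)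

lemma tau_smooth (B : SmoothBoundary K) (i : Fin B.n) : ContDiff ℝ 1 (tau B i) := by
  have h1 : ContDiff ℝ 1 (deriv (B.curve i)) := by
    have := ((B.smooth i).of_le (m := 2) (WithTop.coe_le_coe.2 (le_top : (2:ℕ∞) ≤ ⊤)))
    exact ((contDiff_succ_iff_deriv (n := 1)).1 this).2.2
  have h2 : ContDiff ℝ 1 (fun u => ‖deriv (B.curve i) u‖) := h1.norm ℝ (B.regular i)
  have h3 : ContDiff ℝ 1 (fun u => ‖deriv (B.curve i) u‖⁻¹) := h2.inv (fun u => norm_ne_zero_iff.2 (B.regular i u))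
  have e : tau B i = fun u => ‖deriv (B.curve i) u‖⁻¹ • deriv (B.curve i) u := by
    ext u
    rw [tau, Complex.real_smul, Complex.ofReal_inv, div_eq_mul_inv, mul_comm]
  rw [e]
  exact h3.smul h1

lemma outer_hasDeriv (B : SmoothBoundary K) (t i u) :
    HasDerivAt (outer B t i) (deriv (B.curve i) u - t * (I * deriv (tau B i) u)) u := by
  have h1 := ((tau_smooth B i).differentiable (by norm_num) u).hasDerivAt
  exact ((B.jc i).hasDeriv u).sub ((h1.const_mul I).const_mul (t:ℂ))

lemma outer_deriv (B : SmoothBoundary K) (t i) :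
    deriv (outer B t i) = fun u => (deriv (B.curve i) u - t * (I * deriv (tau B i) u)) :=
  funext fun u => (outer_hasDeriv B t i u).deriv

lemma tau_contD (B : SmoothBoundary K) (i : Fin B.n) : Continuous (deriv (tau B i)) :=
  (tau_smooth B i).continuous_deriv le_rfl

lemma outer_deriv_cont (B : SmoothBoundary K) (i) :
    Continuous (fun p : ℝ × ℝ => deriv (outer B p.1 i) p.2) := by
  simp only [outer_deriv]
  have := tau_contD B i
  have := (B.jc i).contDeriv
  fun_prop

lemma outer_cont (B : SmoothBoundary K) (i) :
    Continuous (fun p : ℝ × ℝ => outer B p.1 i p.2) := by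
  have := (tau_smooth B i).continuous
  have := (B.jc i).cont
  unfold outer
  fun_prop

lemma outer01 (B : SmoothBoundary K) (t i) : outer B t i 0 = outer B t i 1 := by
  have h := (B.jc i).periodicDeriv 0
  rw [zero_add] at h
  rw [outer, outer, curve01, tau, tau, h]

namespace Geo
variable {B : SmoothBoundary K} {T : ℂ → ℂ} {C : ℝ}

lemma outer_eq (h : Geo B T C) (t i u) : outer B t i u = nr T (B.curve i u) (-t) := by
  rw [outer, nr, h.tan, tau]; push_cast; ring

lemma outer_mem (h : Geo B T C) (hK : IsCompact K) (hconn : IsConnected Kᶜ) {t : ℝ} (ht0 : 0 < t)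
    (ht : t * (4 * C) ≤ 1) (i u) : outer B t i u ∈ Kᶜ := by
  rw [h.outer_eq]
  exact (h.side hK hconn (curve_mem B i u) ht0 ht).2 (mem_ball_self ht0)

lemma outer_wind_in (h : Geo B T C) (hK : IsCompact K) (hconn : IsConnected Kᶜ) {t : ℝ} (ht0 : 0 < t)
    (ht : t * (4 * C) ≤ 1) {z : ℂ} (hz : z ∈ interior K) :
    contourIntegralOf (outer B t) (fun w => 1 / (w - z)) = 2 * π * I := by
  have hC := h.Cpos
  have hne : ∀ s ∈ Icc 0 t, ∀ i u, outer B s i u ≠ z := by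
    intro s hs i u h0
    rcases hs.1.eq_or_lt with h1 | h1
    · rw [← h1, outer, Complex.ofReal_zero, zero_mul, sub_zero] at h0
      exact (curve_mem B i u).2 (h0 ▸ hz)
    · have := h.outer_mem hK hconn h1 (le_trans (by have := hs.2; gcongr) ht) i u
      exact this (h0 ▸ interior_subset hz)
  have key := int_const (isPreconnected_Icc (a := 0) (b := t)) 
    (f := fun s : ℝ => contourIntegralOf (outer B s) (fun w => 1 / (w - z))) ?_ ?_ (x := t) (y := 0) ⟨ht0.le, le_rfl⟩ ⟨le_rfl, ht0.le⟩
  · rw [key, ← wind_in B hz]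
    unfold contourIntegralOf
    refine Finset.sum_congr rfl fun i _ => ?_
    congr 1; ext u
    rw [outer_deriv]
    simp [outer]
  · unfold contourIntegralOf
    apply continuousOn_finsetSum
    intro i _
    have hcont : ContinuousOn (fun p : ℝ × ℝ => 1 / (outer B p.1 i p.2 - z) * deriv (outer B p.1 i) p.2) (Icc 0 t ×ˢ univ) := by
      apply ContinuousOn.mul _ (outer_deriv_cont B i).continuousOn
      apply continuousOn_const.div₀ ((outer_cont B i).sub continuous_const).continuousOn
      intro p hp
      exact sub_ne_zero.2 (hne p.1 hp.1 i p.2)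
    obtain ⟨M, hM⟩ := (isCompact_Icc.prod isCompact_Icc).exists_bound_of_continuousOn (hcont.mono (prod_mono_right (subset_univ (Icc (0:ℝ) 1))))
    intro s hs
    apply intervalIntegral.continuousWithinAt_of_dominated_interval (bound := fun _ => M)
    · filter_upwards [self_mem_nhdsWithin] with x hx
      apply Continuous.aestronglyMeasurable
      rw [← continuousOn_univ]
      exact hcont.comp (f := fun u => (x, u)) (by fun_prop) (fun u _ => ⟨hx, mem_univ u⟩)
    · filter_upwards [self_mem_nhdsWithin] with x hx
      refine Eventually.of_forall fun u hu => ?_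
      rw [uIoc_of_le zero_le_one] at hu
      exact hM (x, u) ⟨hx, hu.1.le, hu.2⟩
    · exact intervalIntegrable_const
    · refine Eventually.of_forall fun u hu => ?_
      exact (hcont.comp (f := fun s => (s, u)) (s := Icc 0 t) (by fun_prop) (fun x hx => ⟨hx, mem_univ u⟩)) s hs
  · intro s hs
    exact wind_isint (fun i u => (outer_hasDeriv B s i u).differentiableAt) 
      (fun i => (outer_deriv_cont B i).comp (f := fun u => (s, u)) (by fun_prop)) (outer01 B s) (hne s hs)

lemma nr_tendsto (b : ℂ) : Tendsto (fun t : ℝ => nr T b t) (𝓝[>] 0) (𝓝 b) := by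
  have : Continuous (fun t : ℝ => nr T b t) := by unfold nr; fun_prop
  have h2 := (this.tendsto 0).mono_left (nhdsWithin_le_nhds (s := Ioi 0))
  simpa [nr] using h2

lemma small (h : Geo B T C) : ∀ᶠ t : ℝ in 𝓝[>] 0, 0 < t ∧ t * (4 * C) ≤ 1 := by
  have hC := h.Cpos
  have : (0:ℝ) < 1 / (4 * C) := by positivity
  filter_upwards [Ioo_mem_nhdsGT this] with t ht
  refine ⟨ht.1, ?_⟩
  have := ht.2.le
  rwa [le_div_iff₀ (by positivity)] at this

lemma outer_contour (h : Geo B T C) (hK : IsCompact K) (hconn : IsConnected Kᶜ) {t : ℝ} (ht0 : 0 < t)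
    (ht : t * (4 * C) ≤ 1) {Q : ℂ → ℂ} (hQ : DifferentiableOn ℂ Q Kᶜ) {q : ℂ}
    (hq : Tendsto (fun z => z * Q z) (cobounded ℂ) (𝓝 q)) :
    contourIntegralOf (outer B t) Q = 2 * π * I * q := by
  have hd : ∀ i, Differentiable ℝ (outer B t i) := fun i u => (outer_hasDeriv B t i u).differentiableAt
  have hc' : ∀ i, Continuous (deriv (outer B t i)) := fun i => (outer_deriv_cont B i).comp (f := fun u => (t, u)) (by fun_prop)
  have hc : ∀ i, Continuous (outer B t i) := fun i => (hd i).continuous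
  let Λ : Set ℂ := ⋃ i, outer B t i '' Icc 0 1
  have hΛ : IsCompact Λ := isCompact_iUnion fun i => isCompact_Icc.image (hc i)
  have hΛm : ∀ i u, outer B t i u ∈ Λ := by
    intro i u
    refine mem_iUnion.2 ⟨i, Int.fract u, ⟨Int.fract_nonneg u, (Int.fract_lt_one u).le⟩, ?_⟩
    have h1 := (B.jc i).per_int (Int.fract u) ⌊u⌋
    have h2 := (B.jc i).perD_int (Int.fract u) ⌊u⌋
    rw [Int.fract_add_floor] at h1 h2
    rw [outer, outer, tau, tau, h1, h2]
  have hΛK : Λ ⊆ Kᶜ := by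
    apply iUnion_subset
    rintro i z ⟨u, -, rfl⟩
    exact h.outer_mem hK hconn ht0 ht i u
  let W : ℂ → ℂ := fun z => contourIntegralOf (outer B t) (fun w => 1 / (w - z))
  have hWc : ContinuousOn W Λᶜ := by
    apply DifferentiableOn.continuousOn (𝕜 := ℂ)
    exact wind_diff (f := fun _ => 1) hc hc' (fun i => continuousOn_const) hΛ.isClosed.isOpen_compl
      (fun i u _ h0 => h0 (hΛm i u))
  have hWi : ∀ z ∈ Λᶜ, ∃ k : ℤ, W z = k * (2 * π * I) := by
    intro z hz
    apply wind_isint hd hc' (outer01 B t)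
    intro i u h0
    exact hz (h0 ▸ hΛm i u)
  apply dixon (U := Kᶜ) (V := {z | z ∈ Λᶜ ∧ W z = 2 * π * I}) hc hc' hK.isClosed.isOpen_compl _ 
    (fun i u _ => h.outer_mem hK hconn ht0 ht i u) (fun i u _ h0 => h0.1 (hΛm i u)) _ (fun z hz => hz.2) (compl_nhds_inf hK) hQ hq
  · rw [Metric.isOpen_iff]
    rintro z ⟨hz, hz2⟩
    obtain ⟨r, hr, hb⟩ := Metric.isOpen_iff.1 hΛ.isClosed.isOpen_compl z hz
    refine ⟨r, hr, fun y hy => ⟨hb hy, ?_⟩⟩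
    rw [← hz2]
    exact int_const (convex_ball z r).isPreconnected (hWc.mono hb) (fun x hx => hWi x (hb hx)) hy (mem_ball_self hr)
  · rw [eq_univ_iff_forall]
    intro z
    by_cases hz : z ∈ K
    · right
      refine ⟨fun h0 => hΛK h0 hz, ?_⟩
      by_cases hz2 : z ∈ interior K
      · exact h.outer_wind_in hK hconn ht0 ht hz2
      · have hzf : z ∈ frontier K := ⟨subset_closure hz, hz2⟩
        have h1 : ContinuousAt W z := hWc.continuousAt (hΛ.isClosed.isOpen_compl.mem_nhds fun h0 => hΛK h0 hz)
        have h2 := h1.tendsto.comp (nr_tendsto (T := T) z)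
        refine tendsto_nhds_unique h2 (tendsto_const_nhds.congr' ?_)
        filter_upwards [h.small] with s hs
        exact (h.outer_wind_in hK hconn ht0 ht ((h.side hK hconn hzf hs.1 hs.2).1 (mem_ball_self hs.1))).symm
    · left; exact hz

/-- the upper bound for admissible functions. -/
lemma upper (h : Geo B T C) (hK : IsCompact K) (hconn : IsConnected Kᶜ) {P : Set ℂ} (hP : P ⊆ interior K)
    {R : ℂ → ℂ} {a : ℂ} (hR : Good P R a) {f : ℂ → ℂ} {l w : ℂ} (hf : DifferentiableOn ℂ f Kᶜ)
    (hf1 : ∀ z ∈ Kᶜ, ‖f z‖ ≤ 1) (hfi : HasDerivAtInftyOn f Kᶜ l w) :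
    2 * π * ‖w + 2 * l * a‖ ≤ ∫ z, ‖1 + R z‖ ^ 2 ∂(sig B) := by
  have hfil : cobounded ℂ ⊓ 𝓟 Kᶜ = cobounded ℂ := inf_eq_left.2 (le_principal_iff.2 (compl_nhds_inf hK))
  rw [HasDerivAtInftyOn, hfil] at hfi
  obtain ⟨hfl, hfw⟩ := hfi
  have hR0 := hR.tendsto_zero
  have hRt := hR.2
  have hd2 : Disjoint Kᶜ P := by
    rw [Set.disjoint_left]
    exact fun z hz hz' => hz (interior_subset (hP hz'))
  have hRK : DifferentiableOn ℂ R Kᶜ := hR.diffOn hd2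
  let Q : ℂ → ℂ := fun z => f z * (1 + R z) ^ 2 - l
  have hQ : DifferentiableOn ℂ Q Kᶜ := ((hf.fun_mul (((differentiableOn_const 1).fun_add hRK).fun_pow 2)).sub_const l)
  have hQt : Tendsto (fun z => z * Q z) (cobounded ℂ) (𝓝 (w + 2 * l * a)) := by
    have h1 : Tendsto (fun z => (z * (f z - l)) * (1 + R z) ^ 2 + l * ((z * R z) * (2 + R z))) (cobounded ℂ)
        (𝓝 (w * (1 + 0) ^ 2 + l * (a * (2 + 0)))) :=
      (hfw.mul ((tendsto_const_nhds.add hR0).pow 2)).add ((hRt.mul (tendsto_const_nhds.add hR0)).const_mul l)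
    rw [show w * (1 + 0) ^ 2 + l * (a * (2 + 0)) = w + 2 * l * a by ring] at h1
    refine h1.congr fun z => ?_
    simp only [Q]; ring
  have hRcl : ContinuousOn R (interior K)ᶜ := by
    apply DifferentiableOn.continuousOn (𝕜 := ℂ)
    apply hR.diffOn
    rw [Set.disjoint_left]
    exact fun z hz hz' => hz (hP hz')
  have hsub : Kᶜ ⊆ (interior K)ᶜ := compl_subset_compl.2 interior_subset
  let r0 := 1 / (4 * C)
  have hC := h.Cpos
  have hr0 : 0 < r0 := by positivity
  have hmem : ∀ i, ∀ s ∈ Icc 0 r0, ∀ u, outer B s i u ∈ (interior K)ᶜ := by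
    intro i s hs u
    rcases hs.1.eq_or_lt with h1 | h1
    · rw [← h1, outer, Complex.ofReal_zero, zero_mul, sub_zero]
      exact (curve_mem B i u).2
    · apply hsub
      apply h.outer_mem hK hconn h1
      have := hs.2
      simp only [r0] at this
      rwa [le_div_iff₀ (by positivity)] at this
  have hcont : ∀ i, ContinuousOn (fun p : ℝ × ℝ => ‖1 + R (outer B p.1 i p.2)‖ ^ 2 * ‖deriv (outer B p.1 i) p.2‖) (Icc 0 r0 ×ˢ univ) := by
    intro i
    apply ContinuousOn.mul _ (outer_deriv_cont B i).norm.continuousOn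
    apply ContinuousOn.pow
    apply ContinuousOn.norm
    apply continuousOn_const.add
    exact hRcl.comp (outer_cont B i).continuousOn (fun p hp => hmem i p.1 hp.1 p.2)
  let J : ℝ → ℝ := fun s => ∑ i, ∫ u in (0:ℝ)..1, ‖1 + R (outer B s i u)‖ ^ 2 * ‖deriv (outer B s i) u‖
  have hJ : ContinuousOn J (Icc 0 r0) := by
    apply continuousOn_finsetSum
    intro i _
    obtain ⟨M, hM⟩ := (isCompact_Icc.prod isCompact_Icc).exists_bound_of_continuousOn ((hcont i).mono (prod_mono_right (subset_univ (Icc (0:ℝ) 1))))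
    intro s hs
    apply intervalIntegral.continuousWithinAt_of_dominated_interval (bound := fun _ => M)
    · filter_upwards [self_mem_nhdsWithin] with x hx
      apply Continuous.aestronglyMeasurable
      rw [← continuousOn_univ]
      exact (hcont i).comp (f := fun u => (x, u)) (by fun_prop) (fun u _ => ⟨hx, mem_univ u⟩)
    · filter_upwards [self_mem_nhdsWithin] with x hx
      refine Eventually.of_forall fun u hu => ?_
      rw [uIoc_of_le zero_le_one] at hu
      exact hM (x, u) ⟨hx, hu.1.le, hu.2⟩
    · exact intervalIntegrable_const
    · refine Eventually.of_forall fun u hu => ?_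
      exact ((hcont i).comp (f := fun s => (s, u)) (s := Icc 0 r0) (by fun_prop) (fun x hx => ⟨hx, mem_univ u⟩)) s hs
  have hJ0 : J 0 = ∫ z, ‖1 + R z‖ ^ 2 ∂(sig B) := by
    rw [← arc_sig B hK]
    · simp only [J, arcIntegralOf]
      refine Finset.sum_congr rfl fun i _ => ?_
      congr 1; ext u
      rw [outer_deriv]
      simp [outer]
    · exact ((continuousOn_const.add (hR.contF hP)).norm).pow 2
  have hlim : Tendsto J (𝓝[>] 0) (𝓝 (J 0)) := by
    have := hJ 0 ⟨le_rfl, hr0.le⟩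
    have h2 : Tendsto J (𝓝[Icc 0 r0] 0) (𝓝 (J 0)) := this
    exact h2.mono_left (nhdsWithin_le_of_mem (mem_of_superset (Ioo_mem_nhdsGT hr0) Ioo_subset_Icc_self))
  rw [← hJ0]
  refine ge_of_tendsto hlim ?_
  filter_upwards [h.small, Ioo_mem_nhdsGT hr0] with t ht htr
  have e1 := h.outer_contour hK hconn ht.1 ht.2 hQ hQt
  have hd : ∀ i, Differentiable ℝ (outer B t i) := fun i u => (outer_hasDeriv B t i u).differentiableAt
  have hc' : ∀ i, Continuous (deriv (outer B t i)) := fun i => (outer_deriv_cont B i).comp (f := fun u => (t, u)) (by fun_prop)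
  have hc : ∀ i, Continuous (outer B t i) := fun i => (hd i).continuous
  have e2 := contour_const_zero hd hc' (outer01 B t) l
  have hQc : ∀ i, ContinuousOn (fun u => Q (outer B t i u)) (Icc 0 1) := fun i =>
    hQ.continuousOn.comp (hc i).continuousOn (fun u _ => h.outer_mem hK hconn ht.1 ht.2 i u)
  have e3 := contour_add hc' (f := Q) (g := fun _ => l) hQc (fun i => continuousOn_const)
  rw [e1, e2, add_zero] at e3
  have e4 : 2 * π * ‖w + 2 * l * a‖ = ‖2 * π * I * (w + 2 * l * a)‖ := by
    rw [norm_mul, norm_mul, norm_mul, norm_I, Complex.norm_real, Complex.norm_two, Real.norm_eq_abs, abs_of_pos Real.pi_pos, mul_one]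
  rw [e4, ← e3]
  unfold contourIntegralOf
  refine (norm_sum_le _ _).trans ?_
  refine Finset.sum_le_sum fun i _ => ?_
  have hcc : Continuous fun u => ‖1 + R (outer B t i u)‖ ^ 2 * ‖deriv (outer B t i) u‖ := by
    rw [← continuousOn_univ]
    exact (hcont i).comp (f := fun u => (t, u)) (by fun_prop) (fun u _ => ⟨⟨htr.1.le, htr.2.le⟩, mem_univ u⟩)
  refine intervalIntegral.norm_integral_le_of_norm_le zero_le_one ?_ (hcc.intervalIntegrable _ _)
  refine Eventually.of_forall fun u _ => ?_
  simp only [Q, sub_add_cancel]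
  rw [norm_mul, norm_mul, norm_pow]
  have := hf1 _ (h.outer_mem hK hconn ht.1 ht.2 i u)
  have h5 : ‖f (outer B t i u)‖ * ‖1 + R (outer B t i u)‖ ^ 2 ≤ 1 * ‖1 + R (outer B t i u)‖ ^ 2 := by gcongr
  rw [one_mul] at h5
  gcongr

end Geo
end

section
open scoped ENNReal NNReal Real ComplexConjugate
variable {K : Set ℂ}

/-- the bounded Hermitian (Kerzman–Stein) kernel -/
def KS (T : ℂ → ℂ) (w b : ℂ) : ℂ := T w / (w - b) - conj (T b / (w - b))

/-- regularised kernel -/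
def kt (T : ℂ → ℂ) (t : ℝ) (w b : ℂ) : ℂ := T w / (w - nr T b t) - conj (T b / (w - nr T b t))

lemma KS_herm (T : ℂ → ℂ) (w b : ℂ) : KS T b w = conj (KS T w b) := by
  rw [KS, KS, map_sub, Complex.conj_conj, ← neg_sub w b, div_neg, div_neg, map_neg]; ring

namespace Geo
variable {B : SmoothBoundary K} {T : ℂ → ℂ} {C : ℝ}

lemma q_facts (h : Geo B T C) {w b : ℂ} (hw : w ∈ frontier K) (hb : b ∈ frontier K) :
    ∃ q θ : ℂ, w - b = q * T b ∧ T w = θ * T b ∧ ‖w - b‖ = ‖q‖ ∧ |q.im| ≤ C * ‖q‖ ^ 2 ∧ ‖θ - 1‖ ≤ C * ‖q‖ ∧ T b ≠ 0 := by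
  have hTT := h.T_conj hb
  have hTb : ‖T b‖ = 1 := h.norm_T hb
  have hT0 : T b ≠ 0 := by
    intro h0; rw [h0, norm_zero] at hTb; norm_num at hTb
  have hn : ‖w - b‖ = ‖(w - b) * conj (T b)‖ := by rw [norm_mul, RCLike.norm_conj, hTb, mul_one]
  refine ⟨(w - b) * conj (T b), T w * conj (T b), ?_, ?_, hn, ?_, ?_, hT0⟩
  · rw [mul_assoc, mul_comm (conj _), hTT, mul_one]
  · rw [mul_assoc, mul_comm (conj _), hTT, mul_one]
  · rw [← hn]; exact h.quad w hw b hb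
  · rw [← hn, ← hTT, ← sub_mul, norm_mul, RCLike.norm_conj, hTb, mul_one]
    exact h.lip w b

lemma KS_bound (h : Geo B T C) {w b : ℂ} (hw : w ∈ frontier K) (hb : b ∈ frontier K) : ‖KS T w b‖ ≤ 3 * C := by
  have hC := h.Cpos
  by_cases hwb : w = b
  · rw [hwb, KS, sub_self]; simp; linarith
  obtain ⟨q, θ, e1, e2, e3, h1, h2, h3⟩ := h.q_facts hw hb
  have hq0 : q ≠ 0 := by
    intro h0; rw [h0, zero_mul, sub_eq_zero] at e1; exact hwb e1
  have hcq : conj q ≠ 0 := by simpa using hq0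
  have hc3 : conj (T b) ≠ 0 := by simpa using h3
  have hqp : 0 < ‖q‖ := norm_pos_iff.2 hq0
  have e4 : KS T w b = ((θ - 1) * conj q + (conj q - q)) / (q * conj q) := by
    rw [KS, e1, e2]
    simp only [map_div₀, map_mul]
    field_simp
    ring
  have h5 : ‖conj q - q‖ ≤ 2 * (C * ‖q‖ ^ 2) := by
    rw [← norm_neg, neg_sub, Complex.sub_conj, norm_mul, norm_I, mul_one, Complex.norm_real, Real.norm_eq_abs, abs_mul, abs_two]
    gcongr
  rw [e4, norm_div, norm_mul, RCLike.norm_conj, div_le_iff₀ (by positivity)]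
  refine (norm_add_le _ _).trans ?_
  rw [norm_mul, RCLike.norm_conj]
  nlinarith

lemma kt_bound (h : Geo B T C) {w b : ℂ} (hw : w ∈ frontier K) (hb : b ∈ frontier K) (hwb : w ≠ b) {t : ℝ} (ht0 : 0 < t)
    (ht : t * (4 * C) ≤ 1) :
    ‖kt T t w b - KS T w b - I * ((2 * t / (‖w - b‖ ^ 2 + t ^ 2) : ℝ) : ℂ)‖ ≤ 22 * C * (t / √(‖w - b‖ ^ 2 + t ^ 2)) := by
  have hC := h.Cpos
  obtain ⟨q, θ, e1, e2, e3, h1, h2, h3⟩ := h.q_facts hw hb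
  have hq0 : q ≠ 0 := by
    intro h0; rw [h0, zero_mul, sub_eq_zero] at e1; exact hwb e1
  have hcq : conj q ≠ 0 := by simpa using hq0
  have hc3 : conj (T b) ≠ 0 := by simpa using h3
  have hqp : 0 < ‖q‖ := norm_pos_iff.2 hq0
  have hd := h.dist_nr hw hb (t := t) (by rwa [abs_of_pos ht0])
  have e5 : w - nr T b t = (q - I * t) * T b := by
    rw [nr]; linear_combination e1
  rw [e5, e3, norm_mul, h.norm_T hb, mul_one] at hd
  rw [e3]
  obtain ⟨P, hP⟩ : ∃ P, P = ‖q‖ ^ 2 + t ^ 2 := ⟨_, rfl⟩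
  obtain ⟨N, hN⟩ : ∃ N, N = ‖q - I * t‖ ^ 2 := ⟨_, rfl⟩
  obtain ⟨Q, hQ⟩ : ∃ Q, Q = ‖q‖ ^ 2 := ⟨_, rfl⟩
  obtain ⟨y, hy⟩ : ∃ y, y = q.im := ⟨_, rfl⟩
  obtain ⟨m, hm⟩ : ∃ m, m = √P := ⟨_, rfl⟩
  rw [← hP, ← hN] at hd
  have hPp : 0 < P := by rw [hP]; positivity
  have hQp : 0 < Q := by rw [hQ]; positivity
  have hNp : 0 < N := by linarith
  have hmp : 0 < m := by rw [hm]; exact Real.sqrt_pos.2 hPp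
  have hmm : m ^ 2 = P := by rw [hm]; exact Real.sq_sqrt hPp.le
  have hPQ : P = Q + t ^ 2 := by rw [hP, hQ]
  have hNe : N = P - 2 * t * y := by
    rw [hN, hP, hy, ← Complex.normSq_eq_norm_sq, ← Complex.normSq_eq_norm_sq, Complex.normSq_apply, Complex.normSq_apply]
    simp only [sub_re, sub_im, mul_re, mul_im, I_re, I_im, ofReal_re, ofReal_im]
    ring
  have hqt : q - I * t ≠ 0 := by
    intro h0; rw [h0, norm_zero] at hN; norm_num at hN; linarith
  have hqt' : conj q + I * t ≠ 0 := by
    have e : conj (q - I * t) = conj q + I * t := by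
      simp [map_sub, map_mul, Complex.conj_I, Complex.conj_ofReal]
    rw [← e]; exact (map_ne_zero _).2 hqt
  have hNc : (N : ℂ) = (q - I * t) * (conj q + I * t) := by
    have : (q - I * t) * conj (q - I * t) = N := by rw [Complex.mul_conj, Complex.normSq_eq_norm_sq, hN]
    rw [← this]
    simp [map_sub, map_mul, Complex.conj_I, Complex.conj_ofReal]
  have hQc : (Q : ℂ) = q * conj q := by
    rw [Complex.mul_conj, Complex.normSq_eq_norm_sq, hQ]
  have hyc : q - conj q = 2 * y * I := by rw [Complex.sub_conj, hy]; push_cast; ring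
  have hNc0 : (N : ℂ) ≠ 0 := by exact_mod_cast hNp.ne'
  have hQc0 : (Q : ℂ) ≠ 0 := by exact_mod_cast hQp.ne'
  have hPc0 : (P : ℂ) ≠ 0 := by exact_mod_cast hPp.ne'
  have f1 : 1 / (q - I * t) - 1 / (conj q + I * t) = 2 * I * (t - y) / N := by
    rw [hNc]
    field_simp
    linear_combination (-1) * hyc
  have f2 : 1 / conj q - 1 / q = 2 * I * y / Q := by
    rw [hQc]
    field_simp
    linear_combination hyc
  have f3 : 1 / (q - I * t) - 1 / q = I * t / (q * (q - I * t)) := by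
    field_simp
    ring
  have e6 : kt T t w b - KS T w b - I * ((2 * t / P : ℝ) : ℂ) =
      (θ - 1) * (I * t / (q * (q - I * t))) + 2 * I * ((2 * t ^ 2 * y / (N * P) + y * (t ^ 2 - 2 * t * y) / (Q * N) : ℝ) : ℂ) := by
    have g1 : kt T t w b = θ * (1 / (q - I * t)) - 1 / (conj q + I * t) := by
      rw [kt, e5, e2]
      simp only [map_div₀, map_mul, map_sub, Complex.conj_I, Complex.conj_ofReal]
      have : conj q - -I * t = conj q + I * t := by ring
      rw [this]
      field_simp
    have g2 : KS T w b = θ * (1 / q) - 1 / conj q := by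
      rw [KS, e1, e2]
      simp only [map_div₀, map_mul]
      field_simp
    have g3 : (2 * t ^ 2 * y / (N * P) + y * (t ^ 2 - 2 * t * y) / (Q * N) : ℝ) = (t - y) / N + y / Q - t / P := by
      field_simp
      rw [hNe, hPQ]
      ring
    rw [g1, g2, g3, ← f3]
    push_cast
    linear_combination f1 + f2
  rw [← hP, e6, ← hm]
  have hy1 : |y| ≤ C * Q := by rw [hy, hQ]; exact h1
  have hqm : ‖q‖ ≤ m := by
    apply le_of_sq_le_sq _ hmp.le
    rw [hmm, hP]; nlinarith
  have hy2 : |y| ≤ m := by rw [hy]; exact (Complex.abs_im_le_norm q).trans hqm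
  have htm : t ≤ m := by
    apply le_of_sq_le_sq _ hmp.le
    rw [hmm, hP]; nlinarith
  have hqtm : m / 2 ≤ ‖q - I * t‖ := by
    apply le_of_sq_le_sq _ (norm_nonneg _)
    rw [← hN, div_pow, hmm]; linarith
  have b1 : ‖(θ - 1) * (I * t / (q * (q - I * t)))‖ ≤ 2 * C * (t / m) := by
    rw [norm_mul, norm_div, norm_mul, norm_mul, norm_I, one_mul, Complex.norm_real, Real.norm_eq_abs, abs_of_pos ht0]
    calc ‖θ - 1‖ * (t / (‖q‖ * ‖q - I * t‖)) ≤ C * ‖q‖ * (t / (‖q‖ * (m / 2))) := by gcongr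
      _ = _ := by field_simp
  have b2 : |2 * t ^ 2 * y / (N * P)| ≤ 4 * C * (t / m) := by
    rw [abs_div, abs_mul, abs_mul, abs_two, abs_of_pos (mul_pos hNp hPp), abs_of_pos (pow_pos ht0 2)]
    calc 2 * t ^ 2 * |y| / (N * P) ≤ 2 * (t * m) * (C * P) / (P / 2 * P) := by
          have : Q ≤ P := by rw [hPQ]; nlinarith
          have h7 : |y| ≤ C * P := hy1.trans (by gcongr)
          have h8 : t ^ 2 ≤ t * m := by nlinarith
          gcongr
      _ = _ := by rw [← hmm]; field_simp; norm_num
  have b3 : |y * (t ^ 2 - 2 * t * y) / (Q * N)| ≤ 6 * C * (t / m) := by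
    rw [abs_div, abs_mul, abs_of_pos (mul_pos hQp hNp)]
    have h9 : |t ^ 2 - 2 * t * y| ≤ 3 * (t * m) := by
      rw [show t ^ 2 - 2 * t * y = t * (t - 2 * y) by ring, abs_mul, abs_of_pos ht0]
      have : |t - 2 * y| ≤ 3 * m := by
        refine (abs_sub _ _).trans ?_
        rw [abs_mul, abs_two, abs_of_pos ht0]; linarith
      nlinarith
    calc |y| * |t ^ 2 - 2 * t * y| / (Q * N) ≤ C * Q * (3 * (t * m)) / (Q * (P / 2)) := by gcongr
      _ = _ := by rw [← hmm]; field_simp; norm_num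
  refine (norm_add_le _ _).trans ?_
  have h10 : ∀ X : ℝ, ‖2 * I * (X : ℂ)‖ = 2 * |X| := by
    intro X
    rw [norm_mul, norm_mul, norm_I, Complex.norm_two, Complex.norm_real, Real.norm_eq_abs, mul_one]
  rw [h10]
  have := abs_add_le (2 * t ^ 2 * y / (N * P)) (y * (t ^ 2 - 2 * t * y) / (Q * N))
  linarith

end Geo
end

section
open scoped ENNReal NNReal Real ComplexConjugate
variable {K : Set ℂ}

lemma front_dist {z : ℂ} (hz : z ∉ frontier K) : ∃ r > 0, ∀ w ∈ frontier K, r ≤ ‖w - z‖ := by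
  obtain ⟨r, hr, hb⟩ := Metric.isOpen_iff.1 isClosed_frontier.isOpen_compl z hz
  refine ⟨r, hr, fun w hw => ?_⟩
  by_contra hlt
  push Not at hlt
  exact hb (mem_ball_iff_norm.2 hlt) hw

lemma cauchy_meas {μ : Measure ℂ} {y : ℂ → ℂ} (hy : Integrable y μ) (z : ℂ) (k : ℕ) :
    AEStronglyMeasurable (fun w => y w * ((w - z) ^ k)⁻¹) μ :=
  hy.aestronglyMeasurable.mul (Measurable.aestronglyMeasurable (by fun_prop))

lemma cauchy_integrable {μ : Measure ℂ} (hμ : ∀ᵐ w ∂μ, w ∈ frontier K) {y : ℂ → ℂ} (hy : Integrable y μ)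
    {z : ℂ} (hz : z ∉ frontier K) (k : ℕ) : Integrable (fun w => y w * ((w - z) ^ k)⁻¹) μ := by
  obtain ⟨r, hr, hb⟩ := front_dist hz
  refine (hy.norm.mul_const ((r ^ k)⁻¹)).mono' (cauchy_meas hy z k) ?_
  filter_upwards [hμ] with w hw
  rw [norm_mul, norm_inv, norm_pow]
  have := hb w hw
  gcongr

lemma cauchy_diff {μ : Measure ℂ} (hμ : ∀ᵐ w ∂μ, w ∈ frontier K) {y : ℂ → ℂ} (hy : Integrable y μ) :
    DifferentiableOn ℂ (fun z => ∫ w, y w * (w - z)⁻¹ ∂μ) (frontier K)ᶜ := by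
  apply diff_param (F := fun z w => y w * (w - z)⁻¹) isClosed_frontier.isOpen_compl
  · intro z hz
    simpa using cauchy_meas hy z 1
  · filter_upwards [hμ] with w hw
    apply DifferentiableOn.fun_mul (differentiableOn_const _)
    apply DifferentiableOn.inv (by fun_prop)
    intro z hz h0
    rw [sub_eq_zero] at h0; rw [h0] at hw; exact hz hw
  · intro z hz
    obtain ⟨r, hr, hb⟩ := front_dist hz
    refine ⟨r / 2, by positivity, fun w => ‖y w‖ * (r / 2)⁻¹, hy.norm.mul_const _, ?_⟩
    filter_upwards [hμ] with w hw z' hz' _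
    rw [norm_mul, norm_inv]
    have h1 := hb w hw
    have h2 : r / 2 ≤ ‖w - z'‖ := by
      have := norm_sub_le_norm_sub_add_norm_sub w z' z
      rw [mem_ball_iff_norm] at hz'
      linarith
    gcongr

lemma cauchy_hasSum {μ : Measure ℂ} (hμ : ∀ᵐ w ∂μ, w ∈ frontier K) {y : ℂ → ℂ} (hy : Integrable y μ)
    {s z : ℂ} {r : ℝ} (hr : 0 < r) (hb : ∀ w ∈ frontier K, r ≤ ‖w - s‖) (hz : ‖z - s‖ < r) :
    HasSum (fun k : ℕ => (z - s) ^ k * ∫ w, y w * ((w - s) ^ (k + 1))⁻¹ ∂μ) (∫ w, y w * (w - z)⁻¹ ∂μ) := by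
  have hs : s ∉ frontier K := fun h => by have := hb s h; rw [sub_self, norm_zero] at this; linarith
  have hInt : ∀ k : ℕ, Integrable (fun w => (z - s) ^ k * (y w * ((w - s) ^ (k + 1))⁻¹)) μ := fun k =>
    (cauchy_integrable hμ hy hs (k + 1)).const_mul _
  have hq : ‖z - s‖ / r < 1 := by rwa [div_lt_one hr]
  have key := hasSum_integral_of_summable_integral_norm hInt ?_
  · have e : ∫ w, ∑' k : ℕ, (z - s) ^ k * (y w * ((w - s) ^ (k + 1))⁻¹) ∂μ = ∫ w, y w * (w - z)⁻¹ ∂μ := by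
      apply integral_congr_ae
      filter_upwards [hμ] with w hw
      have h1 := hb w hw
      have hws : w - s ≠ 0 := by
        intro h0; rw [h0, norm_zero] at h1; linarith
      have hg : ‖(z - s) / (w - s)‖ < 1 := by
        rw [norm_div, div_lt_one (by linarith)]; linarith
      have h2 := (hasSum_geometric_of_norm_lt_one hg).mul_left (y w * (w - s)⁻¹)
      have h3 : (y w * (w - s)⁻¹) * (1 - (z - s) / (w - s))⁻¹ = y w * (w - z)⁻¹ := by
        rw [mul_assoc, ← mul_inv, mul_sub, mul_div_cancel₀ _ hws]; congr 2; ring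
      rw [h3] at h2
      rw [← h2.tsum_eq]
      congr 1; ext k
      rw [div_pow, pow_succ]; field_simp
    rw [e] at key
    simp only [integral_const_mul] at key
    exact key
  · refine Summable.of_nonneg_of_le (fun k => integral_nonneg fun _ => norm_nonneg _) ?_
      ((summable_geometric_of_lt_one (by positivity) hq).mul_left (r⁻¹ * ∫ w, ‖y w‖ ∂μ))
    intro k
    calc _ ≤ ∫ w, (r⁻¹ * (‖z - s‖ / r) ^ k) * ‖y w‖ ∂μ := by
          apply integral_mono_ae (hInt k).norm (hy.norm.const_mul _)
          filter_upwards [hμ] with w hw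
          rw [norm_mul, norm_mul, norm_inv, norm_pow, norm_pow, div_pow]
          have h1 := hb w hw
          calc ‖z - s‖ ^ k * (‖y w‖ * (‖w - s‖ ^ (k + 1))⁻¹) ≤ ‖z - s‖ ^ k * (‖y w‖ * (r ^ (k + 1))⁻¹) := by gcongr
            _ = _ := by rw [pow_succ]; field_simp
      _ = _ := by rw [integral_const_mul]; ring

/-- Equality of moments at the points of `S` gives equality of Cauchy transforms inside `K`. -/
lemma cauchy_eq {S : Set ℂ} (hS : ∀ z ∈ interior K, ∃ s ∈ S, s ∈ connectedComponentIn (interior K) z)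
    {μ ν : Measure ℂ} (hμ : ∀ᵐ w ∂μ, w ∈ frontier K) (hν : ∀ᵐ w ∂ν, w ∈ frontier K)
    {y x : ℂ → ℂ} (hy : Integrable y μ) (hx : Integrable x ν)
    (hm : ∀ s ∈ S ∩ interior K, ∀ k : ℕ, ∫ w, y w * ((w - s) ^ (k + 1))⁻¹ ∂μ = ∫ w, x w * ((w - s) ^ (k + 1))⁻¹ ∂ν)
    {z : ℂ} (hz : z ∈ interior K) : ∫ w, y w * (w - z)⁻¹ ∂μ = ∫ w, x w * (w - z)⁻¹ ∂ν := by
  obtain ⟨s, hsS, hs⟩ := hS z hz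
  have hsub : connectedComponentIn (interior K) z ⊆ interior K := connectedComponentIn_subset _ _
  have hoff : interior K ⊆ (frontier K)ᶜ := fun w hw h => h.2 hw
  obtain ⟨r, hr, hb⟩ := front_dist (hoff (hsub hs))
  have hopen : IsOpen (connectedComponentIn (interior K) z) := isOpen_interior.connectedComponentIn
  have a1 : AnalyticOnNhd ℂ (fun z => ∫ w, y w * (w - z)⁻¹ ∂μ) (connectedComponentIn (interior K) z) :=
    ((cauchy_diff hμ hy).mono (hsub.trans hoff)).analyticOnNhd hopen
  have a2 : AnalyticOnNhd ℂ (fun z => ∫ w, x w * (w - z)⁻¹ ∂ν) (connectedComponentIn (interior K) z) :=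
    ((cauchy_diff hν hx).mono (hsub.trans hoff)).analyticOnNhd hopen
  refine a1.eqOn_of_preconnected_of_eventuallyEq a2 isPreconnected_connectedComponentIn hs ?_ (mem_connectedComponentIn hz)
  filter_upwards [Metric.ball_mem_nhds s hr] with z' hz'
  rw [mem_ball_iff_norm] at hz'
  have h1 := cauchy_hasSum hμ hy hr hb hz'
  have h2 := cauchy_hasSum hν hx hr hb hz'
  have h3 : (fun k : ℕ => (z' - s) ^ k * ∫ w, y w * ((w - s) ^ (k + 1))⁻¹ ∂μ) =
      (fun k : ℕ => (z' - s) ^ k * ∫ w, x w * ((w - s) ^ (k + 1))⁻¹ ∂ν) := by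
    ext k; rw [hm s ⟨hsS, hsub hs⟩ k]
  rw [h3] at h1
  exact h1.unique h2
end

section
open scoped ENNReal NNReal Real ComplexConjugate
variable {K : Set ℂ}

lemma int_sub {α E : Type*} [MeasurableSpace α] {μ : Measure α} [NormedAddCommGroup E] {f g : α → E} (hf : Integrable f μ)
    (hg : Integrable g μ) : Integrable (fun x => f x - g x) μ := hf.sub hg

lemma int_add {α E : Type*} [MeasurableSpace α] {μ : Measure α} [NormedAddCommGroup E] {f g : α → E} (hf : Integrable f μ)
    (hg : Integrable g μ) : Integrable (fun x => f x + g x) μ := hf.add hg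

lemma prod_int (B : SmoothBoundary K) {x y : ℂ → ℂ} (hx : Integrable x (sig B)) (hy : Integrable y (sig B))
    {k : ℂ → ℂ → ℂ} (hk : Measurable (fun p : ℂ × ℂ => k p.1 p.2)) {D : ℝ}
    (hb : ∀ w ∈ frontier K, ∀ b ∈ frontier K, ‖k w b‖ ≤ D) :
    Integrable (fun p : ℂ × ℂ => x p.1 * y p.2 * k p.1 p.2) ((sig B).prod (sig B)) := by
  refine ((hx.mul_prod hy).norm.mul_const D).mono' ((hx.mul_prod hy).aestronglyMeasurable.mul hk.aestronglyMeasurable) ?_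
  have h1 : ∀ᵐ p ∂((sig B).prod (sig B)), p.1 ∈ frontier K := Measure.quasiMeasurePreserving_fst.ae (sig_ae_mem B)
  have h2 : ∀ᵐ p ∂((sig B).prod (sig B)), p.2 ∈ frontier K := Measure.quasiMeasurePreserving_snd.ae (sig_ae_mem B)
  filter_upwards [h1, h2] with p hp1 hp2
  rw [norm_mul]
  have := hb _ hp1 _ hp2
  gcongr

lemma fub (B : SmoothBoundary K) {x y : ℂ → ℂ} (hx : Integrable x (sig B)) (hy : Integrable y (sig B))
    {k : ℂ → ℂ → ℂ} (hk : Measurable (fun p : ℂ × ℂ => k p.1 p.2)) {D : ℝ}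
    (hb : ∀ w ∈ frontier K, ∀ b ∈ frontier K, ‖k w b‖ ≤ D) :
    ∫ b, y b * ∫ w, x w * k w b ∂(sig B) ∂(sig B) = ∫ w, x w * ∫ b, y b * k w b ∂(sig B) ∂(sig B) := by
  have h1 := prod_int B hx hy hk hb
  have h2 := integral_integral_swap (f := fun w b => x w * y b * k w b) h1
  have e1 : ∀ w, x w * ∫ b, y b * k w b ∂(sig B) = ∫ b, x w * y b * k w b ∂(sig B) := by
    intro w; rw [← integral_const_mul]; congr 1; ext b; ring
  have e2 : ∀ b, y b * ∫ w, x w * k w b ∂(sig B) = ∫ w, x w * y b * k w b ∂(sig B) := by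
    intro w; rw [← integral_const_mul]; congr 1; ext b; ring
  simp only [e1, e2]
  exact h2.symm

namespace Geo
variable {B : SmoothBoundary K} {T : ℂ → ℂ} {C : ℝ}

lemma contTg (h : Geo B T C) : Continuous T := by
  have : LipschitzWith ⟨C, by have := h.Cpos; linarith⟩ T := LipschitzWith.of_dist_le_mul fun w b => by
    rw [dist_eq_norm, dist_eq_norm]; exact h.lip w b
  exact this.continuous

lemma KS_meas (h : Geo B T C) : Measurable (fun p : ℂ × ℂ => KS T p.1 p.2) := by
  have hT : Measurable T := h.contTg.measurable
  unfold KS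
  refine Measurable.sub (by fun_prop) (Complex.continuous_conj.measurable.comp (by fun_prop))

lemma kt_meas (h : Geo B T C) (t : ℝ) : Measurable (fun p : ℂ × ℂ => kt T t p.1 p.2) := by
  have hT : Measurable T := h.contTg.measurable
  unfold kt nr
  refine Measurable.sub (by fun_prop) (Complex.continuous_conj.measurable.comp (by fun_prop))

lemma kt_bdd (h : Geo B T C) {t : ℝ} (ht0 : 0 < t) (ht : t * (4 * C) ≤ 1) {w b : ℂ} (hw : w ∈ frontier K) (hb : b ∈ frontier K) :
    ‖kt T t w b‖ ≤ 2 / t := by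
  have h1 : t ≤ ‖w - nr T b t‖ := by
    have := h.disc_avoid (t := t) hw hb (by rwa [abs_of_pos ht0])
    rwa [abs_of_pos ht0] at this
  unfold kt
  refine (norm_sub_le _ _).trans ?_
  rw [RCLike.norm_conj, norm_div, norm_div, h.norm_T hw, h.norm_T hb]
  calc _ ≤ 1 / t + 1 / t := by gcongr
    _ = _ := by ring

/-- the limit of the regularised operator -/
lemma psi_tendsto (h : Geo B T C) (hK : IsCompact K) {y : ℂ → ℂ} (hy : Continuous y) {w : ℂ} (hw : w ∈ frontier K) :
    Tendsto (fun t => ∫ b, y b * kt T t w b ∂(sig B)) (𝓝[>] 0)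
      (𝓝 (2 * π * I * y w + ∫ b, y b * KS T w b ∂(sig B))) := by
  have hyi : Integrable y (sig B) := sig_integrable B hK hy.continuousOn
  have hC := h.Cpos
  have hmk : ∀ t, Measurable (fun b => kt T t w b) := fun t => (h.kt_meas t).comp (by fun_prop : Measurable fun b : ℂ => (w, b))
  have hmK : Measurable (fun b => KS T w b) := h.KS_meas.comp (by fun_prop : Measurable fun b : ℂ => (w, b))
  have hmP : ∀ t : ℝ, Measurable (fun b : ℂ => (2 * t / (‖w - b‖ ^ 2 + t ^ 2) : ℝ)) := fun t => by fun_prop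
  have i2 : Integrable (fun b => y b * KS T w b) (sig B) := by
    refine (hyi.norm.mul_const (3 * C)).mono' (hyi.aestronglyMeasurable.mul hmK.aestronglyMeasurable) ?_
    filter_upwards [sig_ae_mem B] with b hb
    rw [norm_mul]; have := h.KS_bound hw hb; gcongr
  have i3 : ∀ t : ℝ, 0 < t → Integrable (fun b => y b * (I * ((2 * t / (‖w - b‖ ^ 2 + t ^ 2) : ℝ) : ℂ))) (sig B) := by
    intro t ht
    apply sig_integrable B hK
    apply Continuous.continuousOn
    refine hy.mul (continuous_const.mul (Complex.continuous_ofReal.comp ?_))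
    exact Continuous.div (by fun_prop) (by fun_prop) (fun b => by positivity)
  have i1 : ∀ t : ℝ, 0 < t → t * (4 * C) ≤ 1 → Integrable (fun b => y b * kt T t w b) (sig B) := by
    intro t ht0 ht
    refine (hyi.norm.mul_const (2 / t)).mono' (hyi.aestronglyMeasurable.mul (hmk t).aestronglyMeasurable) ?_
    filter_upwards [sig_ae_mem B] with b hb
    rw [norm_mul]; have := h.kt_bdd ht0 ht hw hb; gcongr
  have L1 : Tendsto (fun t : ℝ => ∫ b, y b * (kt T t w b - KS T w b - I * ((2 * t / (‖w - b‖ ^ 2 + t ^ 2) : ℝ) : ℂ)) ∂(sig B))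
      (𝓝[>] 0) (𝓝 (∫ b, (0:ℂ) ∂(sig B))) := by
    apply tendsto_integral_filter_of_dominated_convergence (fun b => ‖y b‖ * (22 * C))
    · refine Eventually.of_forall fun t => hyi.aestronglyMeasurable.mul (Measurable.aestronglyMeasurable ?_)
      exact ((hmk t).sub hmK).sub (measurable_const.mul (Complex.measurable_ofReal.comp (hmP t)))
    · filter_upwards [h.small] with t ht
      filter_upwards [sig_ae_mem B, sig_noatom B w] with b hb hbw
      rw [norm_mul]
      refine mul_le_mul_of_nonneg_left ?_ (norm_nonneg _)
      refine (h.kt_bound hw hb (Ne.symm hbw) ht.1 ht.2).trans ?_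
      have : t / √(‖w - b‖ ^ 2 + t ^ 2) ≤ 1 := by
        rw [div_le_one (Real.sqrt_pos.2 (by have := ht.1; positivity))]
        apply Real.le_sqrt_of_sq_le; nlinarith [sq_nonneg ‖w - b‖]
      nlinarith
    · exact hyi.norm.mul_const _
    · filter_upwards [sig_ae_mem B, sig_noatom B w] with b hb hbw
      have hpos : 0 < ‖w - b‖ := norm_pos_iff.2 (sub_ne_zero.2 (Ne.symm hbw))
      have l0 : Tendsto (fun t : ℝ => ‖y b‖ * (22 * C * (t / √(‖w - b‖ ^ 2 + t ^ 2)))) (𝓝[>] 0) (𝓝 0) := by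
        have : ContinuousAt (fun t : ℝ => ‖y b‖ * (22 * C * (t / √(‖w - b‖ ^ 2 + t ^ 2)))) 0 := by
          have hne : √(‖w - b‖ ^ 2 + 0 ^ 2) ≠ 0 := (Real.sqrt_pos.2 (by positivity)).ne'
          fun_prop (disch := assumption)
        have h2 := this.tendsto
        simp only [zero_div, mul_zero] at h2
        exact h2.mono_left nhdsWithin_le_nhds
      apply squeeze_zero_norm' _ l0
      filter_upwards [h.small] with t ht
      rw [norm_mul]
      exact mul_le_mul_of_nonneg_left (h.kt_bound hw hb (Ne.symm hbw) ht.1 ht.2) (norm_nonneg _)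
  have L3 := (sig_poisson_limit B hK hy hw).const_mul I
  rw [integral_zero] at L1
  have L := (L1.add L3).add_const (∫ b, y b * KS T w b ∂(sig B))
  rw [zero_add] at L
  have e0 : I * (2 * π * y w) = 2 * π * I * y w := by ring
  rw [e0] at L
  refine L.congr' ?_
  filter_upwards [h.small] with t ht
  have e3 : I * ∫ z, (2 * t / (‖z - w‖ ^ 2 + t ^ 2)) • y z ∂(sig B) =
      ∫ b, y b * (I * ((2 * t / (‖w - b‖ ^ 2 + t ^ 2) : ℝ) : ℂ)) ∂(sig B) := by
    rw [← integral_const_mul]; congr 1; ext b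
    rw [norm_sub_rev b w, Complex.real_smul]; ring
  rw [e3]
  have e1 : ∫ b, y b * (kt T t w b - KS T w b - I * ((2 * t / (‖w - b‖ ^ 2 + t ^ 2) : ℝ) : ℂ)) ∂(sig B) =
      ∫ b, y b * kt T t w b ∂(sig B) - ∫ b, y b * KS T w b ∂(sig B) -
       ∫ b, y b * (I * ((2 * t / (‖w - b‖ ^ 2 + t ^ 2) : ℝ) : ℂ)) ∂(sig B) := by
    rw [← integral_sub (i1 t ht.1 ht.2) i2, ← integral_sub (int_sub (i1 t ht.1 ht.2) i2) (i3 t ht.1)]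
    congr 1; ext b; ring
  rw [e1]; ring

lemma psi_bound (h : Geo B T C) (hK : IsCompact K) {y : ℂ → ℂ} (hy : Continuous y) :
    ∃ D : ℝ, ∀ t : ℝ, 0 < t → t * (4 * C) ≤ 1 → ∀ w ∈ frontier K, ‖∫ b, y b * kt T t w b ∂(sig B)‖ ≤ D := by
  obtain ⟨Cp, hCp, hP⟩ := sig_poisson_bound B
  have hcF : IsCompact (frontier K) := hK.of_isClosed_subset isClosed_frontier hK.isClosed.frontier_subset
  obtain ⟨M, hM⟩ := hcF.exists_bound_of_continuousOn hy.continuousOn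
  have hC := h.Cpos
  refine ⟨|M| * (25 * C) * (sig B).real univ + |M| * Cp, fun t ht0 ht w hw => ?_⟩
  have iP : Integrable (fun b => (2 * t / (‖b - w‖ ^ 2 + t ^ 2) : ℝ)) (sig B) := by
    apply sig_integrable B hK
    apply Continuous.continuousOn
    exact Continuous.div (by fun_prop) (by fun_prop) (fun b => by positivity)
  have iPb : ∫ b, (2 * t / (‖b - w‖ ^ 2 + t ^ 2) : ℝ) ∂(sig B) ≤ Cp := by
    have h1 := hP w hw t ht0
    rw [← ofReal_integral_eq_lintegral_ofReal iP (Eventually.of_forall fun b => by positivity)] at h1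
    exact (ENNReal.ofReal_le_ofReal_iff hCp.le).1 h1
  calc _ ≤ ∫ b, (|M| * (25 * C) + |M| * (2 * t / (‖b - w‖ ^ 2 + t ^ 2) : ℝ)) ∂(sig B) := by
        apply norm_integral_le_of_norm_le ((integrable_const _).add (iP.const_mul _))
        filter_upwards [sig_ae_mem B, sig_noatom B w] with b hb hbw
        show _ ≤ |M| * (25 * C) + |M| * (2 * t / (‖b - w‖ ^ 2 + t ^ 2) : ℝ)
        rw [norm_mul, ← mul_add]
        have h1 := h.kt_bound hw hb (Ne.symm hbw) ht0 ht
        have h2 := h.KS_bound hw hb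
        have h3 : t / √(‖w - b‖ ^ 2 + t ^ 2) ≤ 1 := by
          rw [div_le_one (Real.sqrt_pos.2 (by positivity))]
          apply Real.le_sqrt_of_sq_le; nlinarith [sq_nonneg ‖w - b‖]
        have h4 : ‖I * ((2 * t / (‖w - b‖ ^ 2 + t ^ 2) : ℝ) : ℂ)‖ = 2 * t / (‖b - w‖ ^ 2 + t ^ 2) := by
          rw [norm_mul, norm_I, one_mul, Complex.norm_real, Real.norm_eq_abs, abs_of_pos (by positivity), norm_sub_rev]
        have h5 : ‖kt T t w b‖ ≤ 25 * C + 2 * t / (‖b - w‖ ^ 2 + t ^ 2) := by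
          rw [← h4]
          have e : kt T t w b = (kt T t w b - KS T w b - I * ((2 * t / (‖w - b‖ ^ 2 + t ^ 2) : ℝ) : ℂ)) + KS T w b
            + I * ((2 * t / (‖w - b‖ ^ 2 + t ^ 2) : ℝ) : ℂ) := by ring
          have h6 := norm_add₃_le (a := kt T t w b - KS T w b - I * ((2 * t / (‖w - b‖ ^ 2 + t ^ 2) : ℝ) : ℂ)) (b := KS T w b)
            (c := I * ((2 * t / (‖w - b‖ ^ 2 + t ^ 2) : ℝ) : ℂ))
          rw [← e] at h6
          nlinarith
        have h7 : ‖y b‖ ≤ |M| := (hM b hb).trans (le_abs_self _)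
        gcongr
    _ = |M| * (25 * C) * (sig B).real univ + |M| * ∫ b, (2 * t / (‖b - w‖ ^ 2 + t ^ 2) : ℝ) ∂(sig B) := by
        rw [integral_add (integrable_const _) (iP.const_mul _), integral_const, integral_const_mul, smul_eq_mul]; ring
    _ ≤ _ := by gcongr

end Geo
end

section
open scoped ENNReal NNReal Real ComplexConjugate
variable {K : Set ℂ}
namespace Geo
variable {B : SmoothBoundary K} {T : ℂ → ℂ} {C : ℝ}

lemma eqn (h : Geo B T C) (hK : IsCompact K) (hconn : IsConnected Kᶜ) {x : ℂ → ℂ} (hx : Integrable x (sig B)) {c0 : ℂ}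
    (h1 : ∀ z ∈ interior K, ∫ w, x w * T w * (w - z)⁻¹ ∂(sig B) = c0)
    (h2 : ∀ z ∈ interior K, ∫ w, conj (x w) * (w - z)⁻¹ ∂(sig B) = 0) :
    ∀ᵐ b ∂(sig B), 2 * π * I * x b + ∫ w, x w * KS T w b ∂(sig B) = c0 := by
  have hC := h.Cpos
  have hTi : Integrable (fun w => x w * T w) (sig B) := by
    refine hx.norm.mono' (hx.aestronglyMeasurable.mul h.contTg.measurable.aestronglyMeasurable) ?_
    filter_upwards [sig_ae_mem B] with w hw
    rw [norm_mul, h.norm_T hw, mul_one]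
  have hxc : Integrable (fun w => conj (x w)) (sig B) := by
    refine hx.norm.mono' (Complex.continuous_conj.comp_aestronglyMeasurable hx.aestronglyMeasurable) ?_
    exact Eventually.of_forall fun w => (RCLike.norm_conj _).le
  have s1 : ∀ t : ℝ, 0 < t → t * (4 * C) ≤ 1 → ∀ b ∈ frontier K, ∫ w, x w * kt T t w b ∂(sig B) = c0 := by
    intro t ht0 ht b hb
    have hz : nr T b t ∈ interior K := (h.side hK hconn hb ht0 ht).1 (mem_ball_self ht0)
    have hzf : nr T b t ∉ frontier K := fun hh => hh.2 hz
    have i1 : Integrable (fun w => x w * T w * (w - nr T b t)⁻¹) (sig B) := by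
      simpa using cauchy_integrable (sig_ae_mem B) hTi hzf 1
    have i2 : Integrable (fun w => conj (x w) * (w - nr T b t)⁻¹) (sig B) := by
      simpa using cauchy_integrable (sig_ae_mem B) hxc hzf 1
    have i3 : Integrable (fun w => conj (T b) * conj (conj (x w) * (w - nr T b t)⁻¹)) (sig B) := by
      refine (i2.norm.mono' (Complex.continuous_conj.comp_aestronglyMeasurable i2.aestronglyMeasurable) ?_).const_mul _
      exact Eventually.of_forall fun w => (RCLike.norm_conj _).le
    have e : ∀ w, x w * kt T t w b = x w * T w * (w - nr T b t)⁻¹ - conj (T b) * conj (conj (x w) * (w - nr T b t)⁻¹) := by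
      intro w
      simp only [kt, map_mul, Complex.conj_conj, div_eq_mul_inv]; ring
    simp only [e]
    rw [integral_sub i1 i3, h1 _ hz, integral_const_mul, integral_conj, h2 _ hz]
    simp
  have s2 : ∀ y : ℂ → ℂ, Continuous y → ∫ b, y b * (2 * π * I * x b + ∫ w, x w * KS T w b ∂(sig B) - c0) ∂(sig B) = 0 := by
    intro y hy
    have hyi : Integrable y (sig B) := sig_integrable B hK hy.continuousOn
    obtain ⟨D, hD⟩ := h.psi_bound hK hy
    have hF : ∀ t : ℝ, 0 < t → t * (4 * C) ≤ 1 → ∫ w, x w * ∫ b, y b * kt T t w b ∂(sig B) ∂(sig B) = ∫ b, y b * c0 ∂(sig B) := by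
      intro t ht0 ht
      rw [← fub B hx hyi (h.kt_meas t) (fun w hw b hb => h.kt_bdd ht0 ht hw hb)]
      apply integral_congr_ae
      filter_upwards [sig_ae_mem B] with b hb
      rw [s1 t ht0 ht b hb]
    have L : Tendsto (fun t : ℝ => ∫ w, x w * ∫ b, y b * kt T t w b ∂(sig B) ∂(sig B)) (𝓝[>] 0)
        (𝓝 (∫ w, x w * (2 * π * I * y w + ∫ b, y b * KS T w b ∂(sig B)) ∂(sig B))) := by
      apply tendsto_integral_filter_of_dominated_convergence (fun w => ‖x w‖ * D)
      · refine Eventually.of_forall fun t => hx.aestronglyMeasurable.mul ?_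
        have : Measurable (fun p : ℂ × ℂ => y p.2 * kt T t p.1 p.2) := (hy.measurable.comp measurable_snd).mul (h.kt_meas t)
        exact (this.stronglyMeasurable.integral_prod_right (ν := sig B)).aestronglyMeasurable
      · filter_upwards [h.small] with t ht
        filter_upwards [sig_ae_mem B] with w hw
        rw [norm_mul]; have := hD t ht.1 ht.2 w hw; gcongr
      · exact hx.norm.mul_const _
      · filter_upwards [sig_ae_mem B] with w hw
        exact (h.psi_tendsto hK hy hw).const_mul _
    have L2 : Tendsto (fun t : ℝ => ∫ w, x w * ∫ b, y b * kt T t w b ∂(sig B) ∂(sig B)) (𝓝[>] 0) (𝓝 (∫ b, y b * c0 ∂(sig B))) := by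
      refine tendsto_const_nhds.congr' ?_
      filter_upwards [h.small] with t ht
      exact (hF t ht.1 ht.2).symm
    have E := tendsto_nhds_unique L L2
    have F := fub B hx hyi h.KS_meas (fun w hw b hb => h.KS_bound hw hb)
    have P := prod_int B hx hyi h.KS_meas (fun w hw b hb => h.KS_bound hw hb)
    have j1 : Integrable (fun w => x w * ∫ b, y b * KS T w b ∂(sig B)) (sig B) := by
      refine P.integral_prod_left.congr (Eventually.of_forall fun w => ?_)
      beta_reduce
      rw [← integral_const_mul]; congr 1; ext b; ring
    have j2 : Integrable (fun b => y b * ∫ w, x w * KS T w b ∂(sig B)) (sig B) := by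
      refine P.integral_prod_right.congr (Eventually.of_forall fun w => ?_)
      beta_reduce
      rw [← integral_const_mul]; congr 1; ext b; ring
    have j0 : Integrable (fun w => 2 * π * I * (y w * x w)) (sig B) := by
      refine Integrable.const_mul ?_ _
      have hcF : IsCompact (frontier K) := hK.of_isClosed_subset isClosed_frontier hK.isClosed.frontier_subset
      obtain ⟨M, hM⟩ := hcF.exists_bound_of_continuousOn hy.continuousOn
      refine (hx.norm.const_mul M).mono' (hyi.aestronglyMeasurable.mul hx.aestronglyMeasurable) ?_
      filter_upwards [sig_ae_mem B] with w hw
      rw [norm_mul]; have := hM w hw; gcongr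
    have e1 : ∀ w, x w * (2 * π * I * y w + ∫ b, y b * KS T w b ∂(sig B)) = 2 * π * I * (y w * x w) + x w * ∫ b, y b * KS T w b ∂(sig B) := by
      intro w; ring
    have e2 : ∀ b, y b * (2 * π * I * x b + ∫ w, x w * KS T w b ∂(sig B) - c0) =
      2 * π * I * (y b * x b) + y b * ∫ w, x w * KS T w b ∂(sig B) - y b * c0 := by
      intro w; ring
    simp only [e1] at E
    simp only [e2]
    rw [integral_sub (int_add j0 j2) (hyi.mul_const _), integral_add j0 j2, F, ← E, integral_add j0 j1, sub_self]
  have hgi : Integrable (fun b => 2 * π * I * x b + ∫ w, x w * KS T w b ∂(sig B) - c0) (sig B) := by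
    have P := prod_int B hx (integrable_const (1:ℂ)) h.KS_meas (fun w hw b hb => h.KS_bound hw hb)
    have j2 : Integrable (fun b => ∫ w, x w * KS T w b ∂(sig B)) (sig B) := by
      refine P.integral_prod_right.congr (Eventually.of_forall fun w => ?_)
      simp
    exact ((hx.const_mul _).add j2).sub (integrable_const _)
  have := ae_eq_zero_of_integral_contDiff_smul_eq_zero hgi.locallyIntegrable (fun g hg _ => by
    have := s2 (fun b => (g b : ℂ)) (Complex.continuous_ofReal.comp hg.continuous)
    simpa [Complex.real_smul] using this)
  filter_upwards [this] with b hb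
  linear_combination hb

end Geo
end

section
open scoped ENNReal NNReal Real ComplexConjugate
variable {K : Set ℂ}

lemma l2_cs {μ : Measure ℂ} {f q : ℂ → ℂ} (hf : MemLp f 2 μ) (hq : MemLp q 2 μ) :
    ‖∫ w, f w * q w ∂μ‖ ≤ √(∫ w, ‖f w‖ ^ 2 ∂μ) * √(∫ w, ‖q w‖ ^ 2 ∂μ) := by
  have e2 : ENNReal.ofReal 2 = 2 := by simp
  have h := integral_mul_norm_le_Lp_mul_Lq (μ := μ) (f := f) (g := q) Real.HolderConjugate.two_two (by rwa [e2]) (by rwa [e2])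
  rw [Real.sqrt_eq_rpow, Real.sqrt_eq_rpow]
  simp only [Real.rpow_two] at h
  refine le_trans ?_ h
  refine (norm_integral_le_integral_norm _).trans (le_of_eq ?_)
  simp only [norm_mul]

lemma l2_mul {μ : Measure ℂ} {f q : ℂ → ℂ} (hf : MemLp f 2 μ) (hq : MemLp q 2 μ) : Integrable (fun w => f w * q w) μ :=
  MemLp.integrable_mul hf hq

lemma l2_int {μ : Measure ℂ} [IsFiniteMeasure μ] {f : ℂ → ℂ} (hf : MemLp f 2 μ) : Integrable f μ :=
  hf.integrable (by norm_num)

lemma l2_conj {μ : Measure ℂ} {f : ℂ → ℂ} (hf : MemLp f 2 μ) : MemLp (fun w => conj (f w)) 2 μ :=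
  hf.of_le (Complex.continuous_conj.comp_aestronglyMeasurable hf.aestronglyMeasurable)
    (Eventually.of_forall fun w => (RCLike.norm_conj _).le)

lemma l2_sq {μ : Measure ℂ} {f : ℂ → ℂ} (hf : MemLp f 2 μ) : Integrable (fun w => ‖f w‖ ^ 2) μ :=
  (memLp_two_iff_integrable_sq_norm hf.aestronglyMeasurable).1 hf

lemma frontier_compact (hK : IsCompact K) : IsCompact (frontier K) :=
  hK.of_isClosed_subset isClosed_frontier hK.isClosed.frontier_subset

lemma l2_cont (B : SmoothBoundary K) (hK : IsCompact K) {f : ℂ → ℂ} (hf : ContinuousOn f (frontier K)) : MemLp f 2 (sig B) := by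
  obtain ⟨M, hM⟩ := (frontier_compact hK).exists_bound_of_continuousOn hf
  refine MemLp.of_bound (sig_integrable B hK hf).aestronglyMeasurable M ?_
  filter_upwards [sig_ae_mem B] with w hw using hM w hw

lemma l2_mul_cont (B : SmoothBoundary K) (hK : IsCompact K) {f p : ℂ → ℂ} (hf : ContinuousOn f (frontier K)) (hp : MemLp p 2 (sig B)) :
    MemLp (fun w => p w * f w) 2 (sig B) := by
  obtain ⟨M, hM⟩ := (frontier_compact hK).exists_bound_of_continuousOn hf
  refine hp.of_le_mul (c := M) (hp.aestronglyMeasurable.mul (sig_integrable B hK hf).aestronglyMeasurable) ?_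
  filter_upwards [sig_ae_mem B] with w hw
  rw [norm_mul, mul_comm]; have := hM w hw; gcongr

/-- approximable in `L²` by the rational functions with poles in `P` -/
def Apx (B : SmoothBoundary K) (P : Set ℂ) (p : ℂ → ℂ) : Prop :=
  MemLp p 2 (sig B) ∧ ∀ ε > 0, ∃ R ∈ Rsp P, ∫ w, ‖p w - R w‖ ^ 2 ∂(sig B) < ε

lemma rsp_cont {P : Set ℂ} (hP : P ⊆ interior K) {R : ℂ → ℂ} (hR : R ∈ Rsp P) : ContinuousOn R (frontier K) := by
  obtain ⟨a, ha⟩ := good_of_mem hR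
  exact ha.contF hP

lemma Apx.int_zero {B : SmoothBoundary K} {P : Set ℂ} (hK : IsCompact K) (hP : P ⊆ interior K) {p q : ℂ → ℂ} (hp : Apx B P p)
    (hq : MemLp q 2 (sig B)) (h0 : ∀ R ∈ Rsp P, ∫ w, R w * q w ∂(sig B) = 0) : ∫ w, p w * q w ∂(sig B) = 0 := by
  rw [← norm_le_zero_iff]
  apply le_of_forall_pos_le_add
  intro ε hε
  have hD : 0 ≤ √(∫ w, ‖q w‖ ^ 2 ∂(sig B)) := Real.sqrt_nonneg _
  obtain ⟨D, hDe⟩ : ∃ D, D = √(∫ w, ‖q w‖ ^ 2 ∂(sig B)) := ⟨_, rfl⟩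
  rw [← hDe] at hD
  obtain ⟨R, hR, hRε⟩ := hp.2 ((ε / (D + 1)) ^ 2) (by positivity)
  have hRl := l2_cont B hK (rsp_cont hP hR)
  have h1 := l2_cs (hp.1.sub hRl) hq
  have e : ∫ w, (p - R) w * q w ∂(sig B) = ∫ w, p w * q w ∂(sig B) := by
    have : ∀ w, (p - R) w * q w = p w * q w - R w * q w := fun w => by simp [sub_mul]
    simp only [this]
    rw [integral_sub (l2_mul hp.1 hq) (l2_mul hRl hq), h0 R hR, sub_zero]
  rw [e, ← hDe] at h1
  have h2 : √(∫ w, ‖(p - R) w‖ ^ 2 ∂(sig B)) ≤ ε / (D + 1) := by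
    rw [Real.sqrt_le_left (by positivity)]
    exact hRε.le
  calc _ ≤ ε / (D + 1) * D := h1.trans (by gcongr)
    _ ≤ 0 + ε := by
      rw [zero_add, div_mul_eq_mul_div, div_le_iff₀ (by positivity)]; nlinarith

lemma l2_norm {μ : Measure ℂ} (x : Lp ℂ 2 μ) : ‖x‖ ^ 2 = ∫ w, ‖x w‖ ^ 2 ∂μ := by
  have h1 : inner ℂ x x = ((‖x‖ ^ 2 : ℝ) : ℂ) := by rw [inner_self_eq_norm_sq_to_K]; push_cast; rfl
  have h2 : inner ℂ x x = ((∫ w, ‖x w‖ ^ 2 ∂μ : ℝ) : ℂ) := by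
    rw [L2.inner_def, ← integral_complex_ofReal]
    congr 1; ext w
    rw [inner_self_eq_norm_sq_to_K]; push_cast; rfl
  rw [h1] at h2
  exact_mod_cast h2

/-- orthogonal projection -/
lemma proj_ex (B : SmoothBoundary K) (P : Set ℂ) (hK : IsCompact K) (hP : P ⊆ interior K) {f : ℂ → ℂ} (hf : MemLp f 2 (sig B)) :
    ∃ p, Apx B P p ∧ ∀ R ∈ Rsp P, ∫ w, R w * conj (f w - p w) ∂(sig B) = 0 := by
  let M : Submodule ℂ (Lp ℂ 2 (sig B)) :=
    { carrier := {x | ∃ R ∈ Rsp P, x =ᵐ[sig B] R}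
      zero_mem' := ⟨0, Submodule.zero_mem _, Lp.coeFn_zero _ _ _⟩
      add_mem' := by
        rintro x y ⟨R, hR, hx⟩ ⟨R', hR', hy⟩
        exact ⟨R + R', Submodule.add_mem _ hR hR', (Lp.coeFn_add x y).trans (hx.add hy)⟩
      smul_mem' := by
        rintro c x ⟨R, hR, hx⟩
        exact ⟨c • R, Submodule.smul_mem _ _ hR, (Lp.coeFn_smul c x).trans (hx.const_smul c)⟩ }
  have hMm : ∀ x, x ∈ M ↔ ∃ R ∈ Rsp P, x =ᵐ[sig B] R := fun x => Iff.rfl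
  have : CompleteSpace M.topologicalClosure := M.isClosed_topologicalClosure.completeSpace_coe
  obtain ⟨F, hF⟩ : ∃ F, F = MemLp.toLp f hf := ⟨_, rfl⟩
  obtain ⟨p, hp⟩ : ∃ p, p = M.topologicalClosure.starProjection F := ⟨_, rfl⟩
  have hpm : p ∈ M.topologicalClosure := by rw [hp]; exact Submodule.starProjection_apply_mem _ _
  have hpo : F - p ∈ M.topologicalClosureᗮ := by rw [hp]; exact Submodule.sub_starProjection_mem_orthogonal _
  refine ⟨p, ⟨Lp.memLp p, fun ε hε => ?_⟩, fun R hR => ?_⟩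
  · have : p ∈ closure (M : Set (Lp ℂ 2 (sig B))) := hpm
    obtain ⟨m, hm, hd⟩ := Metric.mem_closure_iff.1 this (√ε) (Real.sqrt_pos.2 hε)
    obtain ⟨R, hR, hmR⟩ := hm
    refine ⟨R, hR, ?_⟩
    rw [dist_eq_norm] at hd
    have h1 : ‖p - m‖ ^ 2 < ε := by
      rw [← Real.sq_sqrt hε.le]; gcongr
    rw [l2_norm] at h1
    refine lt_of_eq_of_lt (integral_congr_ae ?_) h1
    filter_upwards [hmR, Lp.coeFn_sub p m] with w h2 h3
    rw [h3, Pi.sub_apply, h2]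
  · have hRl := l2_cont B hK (rsp_cont hP hR)
    have hm : MemLp.toLp R hRl ∈ M := ⟨R, hR, MemLp.coeFn_toLp hRl⟩
    have h1 := (Submodule.mem_orthogonal _ _).1 hpo _ (M.le_topologicalClosure hm)
    rw [L2.inner_def] at h1
    have h2 : conj (∫ a, inner ℂ (MemLp.toLp R hRl a) ((F - p : Lp ℂ 2 (sig B)) a) ∂(sig B)) = 0 := by rw [h1, map_zero]
    rw [← integral_conj] at h2
    rw [← h2]
    apply integral_congr_ae
    filter_upwards [MemLp.coeFn_toLp hRl, MemLp.coeFn_toLp hf, Lp.coeFn_sub F p] with w h3 h4 h5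
    rw [h5, h3, Pi.sub_apply, hF, h4, RCLike.inner_apply]
    simp [mul_comm]

namespace Geo
variable {B : SmoothBoundary K} {T : ℂ → ℂ} {C : ℝ}

lemma rr_zero (h : Geo B T C) (hK : IsCompact K) {P : Set ℂ} (hP : P ⊆ interior K) {R R' : ℂ → ℂ} (hR : R ∈ Rsp P) (hR' : R' ∈ Rsp P) :
    ∫ w, R w * (R' w * T w) ∂(sig B) = 0 := by
  obtain ⟨a, ha⟩ := good_of_mem hR
  obtain ⟨a', ha'⟩ := good_of_mem hR'
  have := h.good_int hK hP (ha.mul ha')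
  rw [mul_zero] at this
  rw [← this]; congr 1; ext w; simp only [Pi.mul_apply]; ring

lemma l2T (h : Geo B T C) (hK : IsCompact K) {p : ℂ → ℂ} (hp : MemLp p 2 (sig B)) : MemLp (fun w => p w * T w) 2 (sig B) :=
  l2_mul_cont B hK h.contTg.continuousOn hp

/-- uniqueness -/
lemma uniq (h : Geo B T C) (hK : IsCompact K) (hconn : IsConnected Kᶜ) {S : Set ℂ}
    (hS : ∀ z ∈ interior K, ∃ s ∈ S, s ∈ connectedComponentIn (interior K) z) {x : ℂ → ℂ} (hx : MemLp x 2 (sig B))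
    (h1 : ∀ R ∈ Rsp (S ∩ interior K), ∫ w, R w * conj (x w) ∂(sig B) = 0)
    (h2 : ∀ R ∈ Rsp (S ∩ interior K), ∫ w, R w * (x w * T w) ∂(sig B) = 0) : x =ᵐ[sig B] 0 := by
  have gen : ∀ y : ℂ → ℂ, Integrable y (sig B) → (∀ R ∈ Rsp (S ∩ interior K), ∫ w, R w * y w ∂(sig B) = 0) →
      ∀ z ∈ interior K, ∫ w, y w * (w - z)⁻¹ ∂(sig B) = 0 := by
    intro y hy hR z hz
    have := cauchy_eq hS (sig_ae_mem B) (sig_ae_mem B) hy (integrable_zero ℂ ℂ (sig B)) (fun s hs k => ?_) hz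
    · rw [this]; simp
    · have e0 : ∫ w, (0 : ℂ → ℂ) w * ((w - s) ^ (k + 1))⁻¹ ∂(sig B) = 0 := by simp
      refine Eq.trans ?_ e0.symm
      rw [← hR _ (Submodule.subset_span ⟨s, hs, k, rfl⟩)]
      congr 1; ext w; ring
  have c1 := gen _ (l2_int (l2_conj hx)) h1
  have c2 := gen _ (l2_int (h.l2T hK hx)) h2
  have E := h.eqn hK hconn (l2_int hx) c2 c1
  have hxi := l2_int hx
  have hxc := l2_int (l2_conj hx)
  obtain ⟨D, hD⟩ : ∃ D, D = ∫ b, conj (x b) * ∫ w, x w * KS T w b ∂(sig B) ∂(sig B) := ⟨_, rfl⟩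
  have F := fub B hxi hxc h.KS_meas (fun w hw b hb => h.KS_bound hw hb)
  have hDr : conj D = D := by
    rw [hD, F, ← integral_conj, ← F]
    congr 1; ext w
    rw [map_mul, ← integral_conj]
    congr 1
    congr 1; ext b
    rw [map_mul, Complex.conj_conj, KS_herm T b w, Complex.conj_conj]
  have E2 : 2 * π * I * ((∫ w, ‖x w‖ ^ 2 ∂(sig B) : ℝ) : ℂ) + D = 0 := by
    have P := prod_int B hxi hxc h.KS_meas (fun w hw b hb => h.KS_bound hw hb)
    have j2 : Integrable (fun b => conj (x b) * ∫ w, x w * KS T w b ∂(sig B)) (sig B) := by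
      refine P.integral_prod_right.congr (Eventually.of_forall fun w => ?_)
      beta_reduce
      rw [← integral_const_mul]; congr 1; ext b; ring
    have j1 : Integrable (fun w => 2 * π * I * ((‖x w‖ ^ 2 : ℝ) : ℂ)) (sig B) := (l2_sq hx).ofReal.const_mul _
    rw [← integral_complex_ofReal, ← integral_const_mul, hD, ← integral_add j1 j2]
    rw [← integral_zero ℂ ℂ (μ := sig B)]
    apply integral_congr_ae
    filter_upwards [E] with b hb
    have : ((‖x b‖ ^ 2 : ℝ) : ℂ) = conj (x b) * x b := by
      rw [← Complex.normSq_eq_norm_sq, ← Complex.mul_conj]; ring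
    rw [this]
    linear_combination conj (x b) * hb
  have hDi : D.im = 0 := Complex.conj_eq_iff_im.1 hDr
  have E3 := congrArg Complex.im E2
  have e4 : (2 * π * I * ((∫ w, ‖x w‖ ^ 2 ∂(sig B) : ℝ) : ℂ)).im = 2 * π * ∫ w, ‖x w‖ ^ 2 ∂(sig B) := by
    rw [show 2 * π * I * ((∫ w, ‖x w‖ ^ 2 ∂(sig B) : ℝ) : ℂ) = ((2 * π * ∫ w, ‖x w‖ ^ 2 ∂(sig B) : ℝ) : ℂ) * I by push_cast; ring]
    simp only [mul_im, I_im, I_re, ofReal_re, ofReal_im]; ring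
  rw [add_im, hDi, e4, add_zero, zero_im] at E3
  have E4 : ∫ w, ‖x w‖ ^ 2 ∂(sig B) = 0 := by
    have := Real.pi_pos
    nlinarith
  rw [integral_eq_zero_iff_of_nonneg (fun w => by positivity) (l2_sq hx)] at E4
  filter_upwards [E4] with w hw
  simpa using hw

lemma cl_of (h : Geo B T C) (hK : IsCompact K) (hconn : IsConnected Kᶜ) {S : Set ℂ}
    (hS : ∀ z ∈ interior K, ∃ s ∈ S, s ∈ connectedComponentIn (interior K) z) {x : ℂ → ℂ} (hx : MemLp x 2 (sig B))
    (h2 : ∀ R ∈ Rsp (S ∩ interior K), ∫ w, R w * (x w * T w) ∂(sig B) = 0) : Apx B (S ∩ interior K) x := by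
  have hP : S ∩ interior K ⊆ interior K := inter_subset_right
  obtain ⟨p, hp, ho⟩ := proj_ex B _ hK hP hx
  have hu : MemLp (fun w => x w - p w) 2 (sig B) := hx.sub hp.1
  have h0 := h.uniq hK hconn hS hu ho (fun R hR => by
    have e : ∀ w, R w * ((x w - p w) * T w) = R w * (x w * T w) - p w * (R w * T w) := fun w => by ring
    have hRl := l2_cont B hK (rsp_cont hP hR)
    have hRT := h.l2T hK hRl
    simp only [e]
    rw [integral_sub (l2_mul hRl (h.l2T hK hx)) (l2_mul hp.1 hRT), h2 R hR, hp.int_zero hK hP hRT (fun R' hR' => h.rr_zero hK hP hR' hR),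
      sub_zero])
  refine ⟨hx, fun ε hε => ?_⟩
  obtain ⟨R, hR, hRe⟩ := hp.2 ε hε
  refine ⟨R, hR, lt_of_eq_of_lt (integral_congr_ae ?_) hRe⟩
  filter_upwards [h0] with w hw
  have : x w = p w := by simpa [sub_eq_zero] using hw
  rw [this]

end Geo
end

section
open scoped ENNReal NNReal Real ComplexConjugate
variable {K : Set ℂ}
namespace Geo
variable {B : SmoothBoundary K} {T : ℂ → ℂ} {C : ℝ}

lemma apx_one (h : Geo B T C) (hK : IsCompact K) {P : Set ℂ} (hP : P ⊆ interior K) {p R : ℂ → ℂ} (hp : Apx B P p) (hR : R ∈ Rsp P) :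
    ∫ w, p w * (R w * T w) ∂(sig B) = 0 :=
  hp.int_zero hK hP (h.l2T hK (l2_cont B hK (rsp_cont hP hR))) (fun R' hR' => h.rr_zero hK hP hR' hR)

lemma apx_two (h : Geo B T C) (hK : IsCompact K) {P : Set ℂ} (hP : P ⊆ interior K) {p q : ℂ → ℂ} (hp : Apx B P p) (hq : Apx B P q) :
    ∫ w, p w * (q w * T w) ∂(sig B) = 0 :=
  hp.int_zero hK hP (h.l2T hK hq.1) (fun R hR => by
    rw [← h.apx_one hK hP hq hR]; congr 1; ext w; ring)

lemma apx_three (h : Geo B T C) (hK : IsCompact K) {P : Set ℂ} (hP : P ⊆ interior K) {p q R : ℂ → ℂ} (hp : Apx B P p) (hq : Apx B P q)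
    (hR : R ∈ Rsp P) :
    ∫ w, p w * (q w * (R w * T w)) ∂(sig B) = 0 := by
  have hRc := rsp_cont hP hR
  have hRT : ContinuousOn (fun w => R w * T w) (frontier K) := hRc.mul h.contTg.continuousOn
  refine hp.int_zero hK hP (l2_mul_cont B hK hRT hq.1) (fun R' hR' => ?_)
  have hc := rsp_cont hP hR'
  have := hq.int_zero hK hP (q := fun w => R' w * (R w * T w)) (l2_cont B hK (hc.mul hRT)) (fun R2 hR2 => ?_)
  · rw [← this]; congr 1; ext w; ring
  · obtain ⟨a, ha⟩ := good_of_mem hR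
    obtain ⟨a', ha'⟩ := good_of_mem hR'
    obtain ⟨a2, ha2⟩ := good_of_mem hR2
    have := h.good_int hK hP ((ha2.mul ha').mul ha)
    rw [mul_zero] at this
    rw [← this]; congr 1; ext w; simp only [Pi.mul_apply]; ring

/-- the a.e. solution of the integral equation has a continuous representative -/
lemma KSint_cont (h : Geo B T C) {x : ℂ → ℂ} (hx : Integrable x (sig B)) :
    ContinuousOn (fun b => ∫ w, x w * KS T w b ∂(sig B)) (frontier K) := by
  intro b hb
  apply tendsto_integral_filter_of_dominated_convergence (fun w => ‖x w‖ * (3 * C))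
  · refine Eventually.of_forall fun b' => hx.aestronglyMeasurable.mul (Measurable.aestronglyMeasurable ?_)
    exact h.KS_meas.comp (by fun_prop : Measurable fun w : ℂ => (w, b'))
  · filter_upwards [self_mem_nhdsWithin] with b' hb'
    filter_upwards [sig_ae_mem B] with w hw
    rw [norm_mul]; have := h.KS_bound hw hb'; gcongr
  · exact hx.norm.mul_const _
  · filter_upwards [sig_noatom B b] with w hw
    have hne : w - b ≠ 0 := sub_ne_zero.2 hw
    have hT := h.contTg
    have c1 : ContinuousAt (fun b' => KS T w b') b := by
      unfold KS
      apply ContinuousAt.sub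
      · fun_prop (disch := assumption)
      · apply Complex.continuous_conj.continuousAt.comp
        fun_prop (disch := assumption)
    exact (tendsto_const_nhds.mul c1.tendsto).mono_left nhdsWithin_le_nhds

lemma exists_G (h : Geo B T C) (hK : IsCompact K) (hconn : IsConnected Kᶜ) {S : Set ℂ}
    (hS : ∀ z ∈ interior K, ∃ s ∈ S, s ∈ connectedComponentIn (interior K) z) :
    ∃ G : ℂ → ℂ, ContinuousOn G (frontier K) ∧ Apx B (S ∩ interior K) (fun w => 1 - G w) ∧
      Apx B (S ∩ interior K) (fun w => conj (G w * T w)) ∧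
      (∀ R ∈ Rsp (S ∩ interior K), ∫ w, R w * conj (G w) ∂(sig B) = 0) := by
  have hP : S ∩ interior K ⊆ interior K := inter_subset_right
  have h1l : MemLp (fun _ : ℂ => (1:ℂ)) 2 (sig B) := l2_cont B hK continuousOn_const
  obtain ⟨p, hp, ho⟩ := proj_ex B _ hK hP h1l
  have hgl : MemLp (fun w => 1 - p w) 2 (sig B) := h1l.sub hp.1
  have hgi := l2_int hgl
  have c1 : ∀ z ∈ interior K, ∫ w, conj (1 - p w) * (w - z)⁻¹ ∂(sig B) = 0 := by
    intro z hz
    have := cauchy_eq hS (sig_ae_mem B) (sig_ae_mem B) (l2_int (l2_conj hgl)) (integrable_zero ℂ ℂ (sig B)) (fun s hs k => ?_) hz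
    · rw [this]; simp
    · have e0 : ∫ w, (0 : ℂ → ℂ) w * ((w - s) ^ (k + 1))⁻¹ ∂(sig B) = 0 := by simp
      refine Eq.trans ?_ e0.symm
      rw [← ho _ (Submodule.subset_span ⟨s, hs, k, rfl⟩)]
      congr 1; ext w; ring
  have c2 : ∀ z ∈ interior K, ∫ w, (1 - p w) * T w * (w - z)⁻¹ ∂(sig B) = 2 * π * I := by
    intro z hz
    have hz1 : ({z} : Set ℂ) ⊆ interior K := by simpa using hz
    have hP' : (S ∩ interior K) ∪ {z} ⊆ interior K := union_subset hP hz1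
    have gz : Good ((S ∩ interior K) ∪ {z}) (fun w => ((w - z) ^ (0 + 1))⁻¹) 1 := good_base (by simp)
    have ez := h.good_int hK hP' gz
    have hqc : ContinuousOn (fun w => ((w - z) ^ (0 + 1))⁻¹ * T w) (frontier K) := (gz.contF hP').mul h.contTg.continuousOn
    have e1 : ∫ w, p w * (((w - z) ^ (0 + 1))⁻¹ * T w) ∂(sig B) = 0 := by
      refine hp.int_zero hK hP (l2_cont B hK hqc) (fun R hR => ?_)
      have hR' : R ∈ Rsp ((S ∩ interior K) ∪ {z}) := by
        refine Submodule.span_mono ?_ hR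
        rintro f ⟨s, hs, k, rfl⟩
        exact ⟨s, Or.inl hs, k, rfl⟩
      exact h.rr_zero hK hP' hR' (Submodule.subset_span ⟨z, by simp, 0, rfl⟩)
    have e2 : ∀ w, (1 - p w) * T w * (w - z)⁻¹ = ((w - z) ^ (0 + 1))⁻¹ * T w - p w * (((w - z) ^ (0 + 1))⁻¹ * T w) := by
      intro w; rw [zero_add, pow_one]; ring
    simp only [e2]
    rw [integral_sub (sig_integrable B hK hqc) (l2_mul hp.1 (l2_cont B hK hqc)), e1, ez]; ring
  have E := h.eqn hK hconn hgi c2 c1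
  obtain ⟨G, hG⟩ : ∃ G : ℂ → ℂ, G = fun b => 1 - (2 * π * I)⁻¹ * ∫ w, (1 - p w) * KS T w b ∂(sig B) := ⟨_, rfl⟩
  have hGc : ContinuousOn G (frontier K) := by
    rw [hG]; exact continuousOn_const.sub (continuousOn_const.mul (h.KSint_cont hgi))
  have hGe : ∀ᵐ b ∂(sig B), 1 - p b = G b := by
    filter_upwards [E] with b hb
    have hpi : (2 * π * I : ℂ) ≠ 0 := Complex.two_pi_I_ne_zero
    rw [hG]
    field_simp
    linear_combination hb
  have hGl := l2_cont B hK hGc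
  have ho' : ∀ R ∈ Rsp (S ∩ interior K), ∫ w, R w * conj (G w) ∂(sig B) = 0 := by
    intro R hR
    rw [← ho R hR]
    apply integral_congr_ae
    filter_upwards [hGe] with b hb; rw [hb]
  refine ⟨G, hGc, ⟨h1l.sub hGl, fun ε hε => ?_⟩, ?_, ho'⟩
  · obtain ⟨R, hR, hRe⟩ := hp.2 ε hε
    refine ⟨R, hR, lt_of_eq_of_lt (integral_congr_ae ?_) hRe⟩
    filter_upwards [hGe] with b hb
    rw [← hb]; ring_nf
  · have hGT := l2_conj (h.l2T hK hGl)
    refine h.cl_of hK hconn hS hGT (fun R hR => ?_)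
    rw [← ho' R hR]
    apply integral_congr_ae
    filter_upwards [sig_ae_mem B] with b hb
    rw [map_mul]
    linear_combination R b * conj (G b) * h.T_conj hb

/-- the data from the extremal problem -/
lemma exists_ext (h : Geo B T C) (hK : IsCompact K) (hconn : IsConnected Kᶜ) {S : Set ℂ}
    (hS : ∀ z ∈ interior K, ∃ s ∈ S, s ∈ connectedComponentIn (interior K) z) :
    ∃ (G s : ℂ → ℂ) (α : ℝ), ContinuousOn G (frontier K) ∧ Apx B (S ∩ interior K) (fun w => 1 - G w) ∧
      Apx B (S ∩ interior K) (fun w => conj (G w * T w)) ∧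
      ∫ w, ‖G w‖ ^ 2 ∂(sig B) = 2 * π * α ∧
      ∫ w, conj (G w * T w) * T w ∂(sig B) = 2 * π * α ∧
      ∫ w, (1 - G w) * T w ∂(sig B) = 0 ∧
      ContinuousOn s (frontier K) ∧
      (∀ w ∈ frontier K, s w ^ 2 * T w = ((‖s w‖ ^ 2 : ℝ) : ℂ)) ∧
      (∀ R ∈ Rsp (S ∩ interior K), ∀ a, Good (S ∩ interior K) R a → ∀ c : ℂ,
        ∫ w, (c + R w) * ((‖s w‖ ^ 2 : ℝ) : ℂ) ∂(sig B) = 2 * π * (2 * α * c - a)) := by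
  have hP : S ∩ interior K ⊆ interior K := inter_subset_right
  obtain ⟨G, hGc, hp, hk, ho⟩ := h.exists_G hK hconn hS
  obtain ⟨p, hpe⟩ : ∃ p : ℂ → ℂ, p = fun w => 1 - G w := ⟨_, rfl⟩
  obtain ⟨k, hke⟩ : ∃ k : ℂ → ℂ, k = fun w => conj (G w * T w) := ⟨_, rfl⟩
  obtain ⟨α, hα⟩ : ∃ α : ℝ, α = (2 * π)⁻¹ * ∫ w, ‖G w‖ ^ 2 ∂(sig B) := ⟨_, rfl⟩
  have hTc : ContinuousOn T (frontier K) := h.contTg.continuousOn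
  have hpc : ContinuousOn p (frontier K) := by rw [hpe]; exact continuousOn_const.sub hGc
  have hconjc : ContinuousOn (fun w => conj (G w)) (frontier K) := Complex.continuous_conj.comp_continuousOn hGc
  have hkc : ContinuousOn k (frontier K) := by rw [hke]; exact Complex.continuous_conj.comp_continuousOn (hGc.mul hTc)
  have hGl := l2_cont B hK hGc
  have hGp : ∀ w, G w = 1 - p w := fun w => by rw [hpe]; ring
  have hkT : ∀ w ∈ frontier K, k w * T w = conj (G w) := fun w hw => by
    rw [hke]; simp only [map_mul]
    linear_combination conj (G w) * h.T_conj hw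
  rw [← hpe] at hp
  rw [← hke] at hk
  have n2 : ∀ z : ℂ, ((‖z‖ ^ 2 : ℝ) : ℂ) = z * conj z := fun z => by
    rw [← Complex.normSq_eq_norm_sq, ← Complex.mul_conj]
  have hα1 : ∫ w, ‖G w‖ ^ 2 ∂(sig B) = 2 * π * α := by
    rw [hα]; have := Real.pi_pos; field_simp
  have hα2 : ∫ w, G w * conj (G w) ∂(sig B) = 2 * π * α := by
    have : ((∫ w, ‖G w‖ ^ 2 ∂(sig B) : ℝ) : ℂ) = ((2 * π * α : ℝ) : ℂ) := by rw [hα1]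
    rw [← integral_complex_ofReal] at this
    simp only [n2] at this
    rw [this]; push_cast; ring
  have hpo : ∫ w, p w * conj (G w) ∂(sig B) = 0 := hp.int_zero hK hP (l2_conj hGl) ho
  have hko : ∫ w, k w * conj (G w) ∂(sig B) = 0 := hk.int_zero hK hP (l2_conj hGl) ho
  have hcG : ∫ w, conj (G w) ∂(sig B) = 2 * π * α := by
    rw [← hα2]
    have e : ∀ w, G w * conj (G w) = conj (G w) - p w * conj (G w) := fun w => by
      linear_combination conj (G w) * hGp w
    simp only [e]
    rw [integral_sub (sig_integrable B hK hconjc) (sig_integrable B hK (f := fun w => p w * conj (G w)) (hpc.mul hconjc)), hpo, sub_zero]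
  have ikT : ∫ w, k w * T w ∂(sig B) = 2 * π * α := by
    rw [← hcG]
    apply integral_congr_ae
    filter_upwards [sig_ae_mem B] with w hw using hkT w hw
  have iGGT : ∫ w, G w * (G w * T w) ∂(sig B) = 0 := by
    have e : ∫ w, conj (k w * conj (G w)) ∂(sig B) = 0 := by rw [integral_conj, hko, map_zero]
    rw [← e]
    congr 1; ext w
    rw [hke]; simp only [map_mul, Complex.conj_conj]; ring
  have ipT : ∫ w, p w * T w ∂(sig B) = 0 := by
    have e : ∀ w, G w * (G w * T w) = T w - 2 * (p w * T w) + p w * (p w * T w) := fun w => by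
      rw [hGp w]; ring
    simp only [e] at iGGT
    have j1 := sig_integrable B hK hTc
    have j2 := sig_integrable B hK (f := fun w => 2 * (p w * T w)) (continuousOn_const.mul (hpc.mul hTc))
    rw [integral_add (int_sub j1 j2) (sig_integrable B hK (f := fun w => p w * (p w * T w)) (hpc.mul (hpc.mul hTc))), integral_sub j1 j2, h.int_T hK,
      h.apx_two hK hP hp hp, integral_const_mul] at iGGT
    linear_combination (-1/2) * iGGT
  obtain ⟨ω, hω⟩ : ∃ ω : ℂ, ω ^ 2 = I ∧ ω * conj ω = 1 := by
    refine ⟨Complex.exp ((π / 4 : ℝ) * I), ?_, ?_⟩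
    · rw [← Complex.exp_nat_mul]
      rw [show ((2:ℕ):ℂ) * ((π / 4 : ℝ) * I) = π / 2 * I by push_cast; ring, Complex.exp_pi_div_two_mul_I]
    · rw [Complex.mul_conj, Complex.normSq_eq_norm_sq, Complex.norm_exp_ofReal_mul_I]; simp
  obtain ⟨hω2, hω1⟩ := hω
  have hω3 : (conj ω) ^ 2 = -I := by
    have := congrArg conj hω2
    rwa [map_pow, Complex.conj_I] at this
  obtain ⟨s, hs⟩ : ∃ s : ℂ → ℂ, s = fun w => ω * G w + conj ω * k w := ⟨_, rfl⟩
  have hsc : ContinuousOn s (frontier K) := by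
    rw [hs]; exact (continuousOn_const.mul hGc).add (continuousOn_const.mul hkc)
  have hsT : ∀ w ∈ frontier K, s w ^ 2 * T w = ((‖s w‖ ^ 2 : ℝ) : ℂ) := by
    intro w hw
    rw [n2]
    have : conj (s w) = s w * T w := by
      rw [hs]; simp only [map_add, map_mul, Complex.conj_conj, hke]
      linear_combination (-conj ω * conj (G w)) * h.T_conj hw
    rw [this]; ring
  refine ⟨G, s, α, hGc, by rw [← hpe]; exact hp, by rw [← hke]; exact hk, hα1, ?_, ?_, hsc, hsT, ?_⟩
  · rw [← ikT, hke]
  · rw [← ipT, hpe]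
  · intro R hR a ha c
    have hRc := rsp_cont hP hR
    have t1 : ∫ w, p w * (R w * T w) ∂(sig B) = 0 := h.apx_one hK hP hp hR
    have t2 : ∫ w, k w * (R w * T w) ∂(sig B) = 0 := h.apx_one hK hP hk hR
    have t3 : ∫ w, p w * (k w * T w) ∂(sig B) = 0 := h.apx_two hK hP hp hk
    have t4 : ∫ w, k w * (k w * T w) ∂(sig B) = 0 := h.apx_two hK hP hk hk
    have t5 : ∫ w, p w * (p w * T w) ∂(sig B) = 0 := h.apx_two hK hP hp hp
    have t6 : ∫ w, p w * (p w * (R w * T w)) ∂(sig B) = 0 := h.apx_three hK hP hp hp hR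
    have t7 : ∫ w, p w * (k w * (R w * T w)) ∂(sig B) = 0 := h.apx_three hK hP hp hk hR
    have t8 : ∫ w, k w * (k w * (R w * T w)) ∂(sig B) = 0 := h.apx_three hK hP hk hk hR
    have t9 : ∫ w, R w * T w ∂(sig B) = 2 * π * I * a := h.good_int hK hP ha
    have t10 : ∫ w, T w ∂(sig B) = 0 := h.int_T hK
    have J : ∀ f : ℂ → ℂ, ContinuousOn f (frontier K) → Integrable f (sig B) := fun f hf => sig_integrable B hK hf
    have e : ∫ w, (c + R w) * ((‖s w‖ ^ 2 : ℝ) : ℂ) ∂(sig B) =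
      ∫ w, ((I * c * T w + I * (R w * T w)) + (-2 * I * c * (p w * T w) + -2 * I * (p w * (R w * T w))) +
        (I * c * (p w * (p w * T w)) + I * (p w * (p w * (R w * T w)))) +
        (2 * c * (k w * T w) + 2 * (k w * (R w * T w))) + (-2 * c * (p w * (k w * T w)) + -2 * (p w * (k w * (R w * T w)))) +
        (-I * c * (k w * (k w * T w)) + -I * (k w * (k w * (R w * T w))))) ∂(sig B) := by
      apply integral_congr_ae
      filter_upwards [sig_ae_mem B] with w hw
      rw [← hsT w hw, hs]
      beta_reduce
      rw [hGp w]
      linear_combination (c + R w) * T w * ((1 - p w) ^ 2 * hω2 + k w ^ 2 * hω3 + 2 * (1 - p w) * k w * hω1)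
    rw [e]
    have u1 := J _ hTc
    have u2 := J (fun w => R w * T w) (hRc.mul hTc)
    have u3 := J (fun w => p w * T w) (hpc.mul hTc)
    have u4 := J (fun w => p w * (R w * T w)) (hpc.mul (hRc.mul hTc))
    have u5 := J (fun w => p w * (p w * T w)) (hpc.mul (hpc.mul hTc))
    have u6 := J (fun w => p w * (p w * (R w * T w))) (hpc.mul (hpc.mul (hRc.mul hTc)))
    have u7 := J (fun w => k w * T w) (hkc.mul hTc)
    have u8 := J (fun w => k w * (R w * T w)) (hkc.mul (hRc.mul hTc))
    have u9 := J (fun w => p w * (k w * T w)) (hpc.mul (hkc.mul hTc))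
    have u10 := J (fun w => p w * (k w * (R w * T w))) (hpc.mul (hkc.mul (hRc.mul hTc)))
    have u11 := J (fun w => k w * (k w * T w)) (hkc.mul (hkc.mul hTc))
    have u12 := J (fun w => k w * (k w * (R w * T w))) (hkc.mul (hkc.mul (hRc.mul hTc)))
    have A : ∀ (f g : ℂ → ℂ) (a b : ℂ), Integrable f (sig B) → Integrable g (sig B) →
      Integrable (fun w => a * f w + b * g w) (sig B) ∧ ∫ w, (a * f w + b * g w) ∂(sig B) = a * ∫ w, f w ∂(sig B) + b * ∫ w, g w ∂(sig B) := by
      intro f g a b hf hg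
      refine ⟨int_add (hf.const_mul a) (hg.const_mul b), ?_⟩
      rw [integral_add (hf.const_mul a) (hg.const_mul b), integral_const_mul, integral_const_mul]
    have v1 := A _ _ (I * c) I u1 u2
    have v2 := A _ _ (-2 * I * c) (-2 * I) u3 u4
    have v3 := A _ _ (I * c) I u5 u6
    have v4 := A _ _ (2 * c) 2 u7 u8
    have v5 := A _ _ (-2 * c) (-2) u9 u10
    have v6 := A _ _ (-I * c) (-I) u11 u12
    rw [integral_add (int_add (int_add (int_add (int_add v1.1 v2.1) v3.1) v4.1) v5.1) v6.1,
      integral_add (int_add (int_add (int_add v1.1 v2.1) v3.1) v4.1) v5.1, integral_add (int_add (int_add v1.1 v2.1) v3.1) v4.1,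
      integral_add (int_add v1.1 v2.1) v3.1, integral_add v1.1 v2.1, v1.2, v2.2, v3.2, v4.2, v5.2, v6.2, t1, t2, t3, t4, t5, t6, t7, t8, t9, t10,
      ipT, ikT]
    linear_combination (2 * π * a) * I_mul_I

end Geo
end

section
open scoped ENNReal NNReal Real ComplexConjugate
variable {K : Set ℂ}

namespace JC
variable {γ : ℝ → ℂ}

lemma chord_symm (h : JC γ) (v x : ℝ) : chordI γ (v + x) (-x) = chordI γ v x := by
  rcases eq_or_ne x 0 with rfl | hx
  · simp
  · have h1 := h.chord_eq v x
    have h2 := h.chord_eq (v + x) (-x)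
    have hx' : (x : ℂ) ≠ 0 := by exact_mod_cast hx
    apply mul_left_cancel₀ hx'
    rw [← h1]
    push_cast at h2
    have : v + x + -x = v := by ring
    rw [this] at h2
    linear_combination h2

/-- normalised chord map -/
def chE (γ : ℝ → ℂ) (p : ℝ × ℝ) : ℂ :=
  if max 0 (min p.2 1) ≤ 1/2 then
    chordI γ p.1 (max 0 (min p.2 1)) / ((1 - max 0 (min p.2 1) : ℝ) : ℂ)
  else - chordI γ (p.1 + 1) (max 0 (min p.2 1) - 1) / ((max 0 (min p.2 1) : ℝ) : ℂ)

lemma chE_mid (h : JC γ) (t : ℝ) : chordI γ t (1/2) / ((1 - 1/2 : ℝ) : ℂ)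
    = - chordI γ (t + 1) (1/2 - 1) / ((1/2 : ℝ) : ℂ) := by
  have h1 := h.chord_eq t (1/2)
  have h2 := h.chord_eq (t + 1) (1/2 - 1)
  have e : t + 1 + (1/2 - 1) = t + 1/2 := by ring
  have hp := h.periodic t
  rw [e, hp, h1] at h2
  push_cast at h2 ⊢
  linear_combination 4 * h2

lemma chE_cont (h : JC γ) : Continuous (chE γ) := by
  have hc := h.contChord
  unfold chE
  have hm : Continuous (fun p : ℝ × ℝ => max 0 (min p.2 1)) := by fun_prop
  have hm0 : ∀ p : ℝ × ℝ, 0 ≤ max 0 (min p.2 1) := fun p => le_max_left _ _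
  -- use continuous_if_le with continuity on pieces
  apply continuous_if_le hm continuous_const
  · apply ContinuousOn.div
    · exact (hc.comp (continuous_fst.prodMk hm)).continuousOn
    · fun_prop
    · intro p hp
      have : max 0 (min p.2 1) ≤ 1/2 := hp
      norm_cast
      linarith
  · apply ContinuousOn.div
    · exact (hc.comp ((continuous_fst.add continuous_const).prodMk
        (hm.sub continuous_const))).neg.continuousOn
    · fun_prop
    · intro p hp
      have : 1/2 ≤ max 0 (min p.2 1) := hp
      norm_cast
      linarith
  · intro p hp
    rw [hp]
    exact h.chE_mid p.1

lemma chE_low (h : JC γ) {t d : ℝ} (h0 : 0 ≤ d) (h1 : d ≤ 1/2) :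
    chE γ (t, d) = chordI γ t d / ((1 - d : ℝ) : ℂ) := by
  have : max 0 (min d 1) = d := by rw [min_eq_left (by linarith), max_eq_right h0]
  simp only [chE, this, if_pos h1]

lemma chE_high (h : JC γ) {t d : ℝ} (h0 : 1/2 ≤ d) (h1 : d ≤ 1) :
    chE γ (t, d) = - chordI γ (t + 1) (d - 1) / ((d : ℝ) : ℂ) := by
  have e : max 0 (min d 1) = d := by rw [min_eq_left (by linarith), max_eq_right (by linarith)]
  rcases eq_or_lt_of_le h0 with h2 | h2
  · subst h2
    rw [h.chE_low (by norm_num) le_rfl, h.chE_mid]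
  · simp only [chE, e, if_neg (not_le.2 h2)]

lemma chE_ne (h : JC γ) (p : ℝ × ℝ) : chE γ p ≠ 0 := by
  unfold chE
  have hm0 : 0 ≤ max 0 (min p.2 1) := le_max_left _ _
  have hm1 : max 0 (min p.2 1) ≤ 1 := max_le zero_le_one (min_le_right _ _)
  obtain ⟨q, hq⟩ : ∃ q, q = max 0 (min p.2 1) := ⟨_, rfl⟩
  rw [← hq] at hm0 hm1 ⊢
  split_ifs with hh
  · apply div_ne_zero
    · exact h.chord_ne (by rw [abs_lt]; constructor <;> linarith)
    · norm_cast; linarith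
  · push Not at hh
    apply div_ne_zero
    · exact neg_ne_zero.2 (h.chord_ne (by rw [abs_lt]; constructor <;> linarith))
    · norm_cast; linarith

lemma chE_anti (h : JC γ) {t d : ℝ} (h0 : 0 ≤ d) (h1 : d ≤ 1) :
    chE γ (t + d, 1 - d) = - chE γ (t, d) := by
  have hper : ∀ v x, chordI γ (v + 1) x = chordI γ v x := by
    intro v x
    simp only [chordI]
    congr 1; ext τ
    have := h.periodicDeriv (v + τ * x)
    rw [← this]; congr 1; ring
  rcases le_total d (1/2) with hd | hd
  · rw [h.chE_low h0 hd, h.chE_high (by linarith) (by linarith), hper]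
    have : (1 - d - 1) = -d := by ring
    rw [this, h.chord_symm]; ring
  · rw [h.chE_high hd h1, h.chE_low (by linarith) (by linarith), hper]
    have := h.chord_symm (t + d) (1 - d)
    have e1 : t + d + (1 - d) = t + 1 := by ring
    have e2 : -(1 - d) = d - 1 := by ring
    have e3 : 1 - (1 - d) = d := by ring
    rw [e1, e2, hper] at this
    rw [e3, this]; ring

theorem no_sqrt (h : JC γ) (ρ : ℝ → ℂ) (hρ : Continuous ρ) (hp : Function.Periodic ρ 1)
    (hs : ∀ t, ρ t ^ 2 = deriv γ t) : False := by
  obtain ⟨F, ⟨hF0, hF⟩, -⟩ := isCoveringMapOn_exp.existsUnique_continuousMap_lifts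
    (A := ℝ × ℝ) ⟨chE γ, h.chE_cont⟩ (a₀ := (0,0)) (e₀ := Complex.log (chE γ (0,0)))
    (Complex.exp_log (h.chE_ne _)) (fun a => h.chE_ne a)
  have hFe : ∀ p, Complex.exp (F p) = chE γ p := fun p => congrFun hF p
  obtain ⟨s, hsd⟩ : ∃ s : ℝ × ℝ → ℂ, s = fun p => Complex.exp (F p / 2) := ⟨_, rfl⟩
  have hsc : Continuous s := by rw [hsd]; fun_prop
  have hs2 : ∀ p, s p ^ 2 = chE γ p := by
    intro p
    rw [hsd, ← hFe, ← Complex.exp_nat_mul]; congr 1; push_cast; ring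
  have hs0 : ∀ p, s p ≠ 0 := by intro p; rw [hsd]; exact Complex.exp_ne_zero _
  have hpre : IsPreconnected (Set.univ ×ˢ Set.Icc (0:ℝ) 1 : Set (ℝ × ℝ)) :=
    isPreconnected_univ.prod isPreconnected_Icc
  have key : ∀ t, s (t + 1, 0) = - s (t, 0) := by
    have := hpre.eq_or_eq_neg_of_sq_eq (f := fun p => s (p.1 + p.2, 1 - p.2))
      (g := fun p => I * s p) (by fun_prop) (by fun_prop)
      (by
        rintro ⟨t, d⟩ ⟨-, hd⟩
        have := h.chE_anti (t := t) hd.1 hd.2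
        simp only [Pi.pow_apply, mul_pow, hs2, this, I_sq]; ring)
      (fun {p} _ => mul_ne_zero I_ne_zero (hs0 p))
    rcases this with h1 | h1
    · intro t
      have a := h1 (x := (t, 0)) ⟨trivial, by simp⟩
      have b := h1 (x := (t, 1)) ⟨trivial, by simp⟩
      simp at a b
      have c := h1 (x := (t, 0)) ⟨trivial, by simp⟩
      rw [b, a, ← mul_assoc]; simp
    · intro t
      have a := h1 (x := (t, 0)) ⟨trivial, by simp⟩
      have b := h1 (x := (t, 1)) ⟨trivial, by simp⟩
      simp at a b
      rw [b, a]; rw [mul_neg, ← mul_assoc]; simp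
  have hE0 : ∀ t, chE γ (t, 0) = deriv γ t := by
    intro t; rw [h.chE_low le_rfl (by norm_num), chord_zero]; simp
  have := isPreconnected_univ.eq_or_eq_neg_of_sq_eq (f := ρ) (g := fun t => s (t, 0))
      (by fun_prop) (by fun_prop)
      (by intro t _; simp only [Pi.pow_apply, hs, hs2, hE0])
      (fun {p} _ => hs0 _)
  rcases this with h1 | h1
  · have a := h1 (x := 0) trivial
    have b := h1 (x := 0 + 1) trivial
    have c := hp 0
    have d := key 0
    simp only at a b
    rw [a, b, d] at c
    exact hs0 (0,0) (by linear_combination -c/2)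
  · have a := h1 (x := 0) trivial
    have b := h1 (x := 0 + 1) trivial
    have c := hp 0
    have d := key 0
    simp only [Pi.neg_apply] at a b
    rw [a, b, d] at c
    exact hs0 (0,0) (by linear_combination c/2)

end JC

/-- every boundary curve contains a zero of `s` -/
lemma Geo.parity {B : SmoothBoundary K} {T : ℂ → ℂ} {C : ℝ} (h : Geo B T C) (s : ℂ → ℂ)
    (hs : ContinuousOn s (frontier K))
    (hsT : ∀ w ∈ frontier K, s w ^ 2 * T w = ((‖s w‖^2 : ℝ) : ℂ)) (i : Fin B.n) :
    ∃ u, s (B.curve i u) = 0 := by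
  by_contra! hne
  have hJ := B.jc i
  have hsc : Continuous (fun u => s (B.curve i u)) :=
    hs.comp_continuous hJ.cont (fun u => curve_mem B i u)
  apply hJ.no_sqrt (fun u => conj (s (B.curve i u)) / ((‖s (B.curve i u)‖ : ℝ) : ℂ)
    * ((Real.sqrt ‖deriv (B.curve i) u‖ : ℝ) : ℂ))
  · have hd := hJ.contDeriv
    apply Continuous.mul
    · apply Continuous.div
      · exact Complex.continuous_conj.comp hsc
      · exact Complex.continuous_ofReal.comp hsc.norm
      · intro u; have := norm_ne_zero_iff.2 (hne u); exact_mod_cast this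
    · fun_prop
  · intro u
    simp only [hJ.periodic u, hJ.periodicDeriv u]
  · intro u
    have hn := norm_ne_zero_iff.2 (hne u)
    have hn' : ((‖s (B.curve i u)‖ : ℝ) : ℂ) ≠ 0 := by exact_mod_cast hn
    have hd := norm_ne_zero_iff.2 (hJ.regular u)
    have hd' : ((‖deriv (B.curve i) u‖ : ℝ) : ℂ) ≠ 0 := by exact_mod_cast hd
    have h1 := hsT _ (curve_mem B i u)
    rw [h.tan] at h1
    have hq : ((Real.sqrt ‖deriv (B.curve i) u‖ : ℝ) : ℂ) ^ 2 = (‖deriv (B.curve i) u‖ : ℝ) := by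
      rw [← ofReal_pow, Real.sq_sqrt (norm_nonneg _)]
    have hc : s (B.curve i u) * conj (s (B.curve i u)) = ((‖s (B.curve i u)‖ : ℝ) : ℂ)^2 := by
      rw [Complex.mul_conj, Complex.normSq_eq_norm_sq]; push_cast; rfl
    rw [mul_pow, hq, div_pow]
    rw [div_mul_eq_mul_div, div_eq_iff (pow_ne_zero 2 hn')]
    have h0 := hne u
    field_simp at h1
    push_cast at h1
    rw [← mul_right_inj' (pow_ne_zero 2 h0), ← hc]
    rw [← hc] at h1
    linear_combination (-s (B.curve i u) * conj (s (B.curve i u))) * h1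
end

section
open scoped ENNReal NNReal Real ComplexConjugate CompactlySupported
variable {K : Set ℂ}

lemma pos_ext {E X : Type*} [AddCommGroup E] [Module ℝ E] [TopologicalSpace X] [T2Space X]
    [CompactSpace X] [MeasurableSpace X] [BorelSpace X] (A : E →ₗ[ℝ] C(X, ℝ)) (l : E →ₗ[ℝ] ℝ)
    (hpos : ∀ e, (∀ x, 0 ≤ A e x) → 0 ≤ l e) (e1 : E) (he1 : ∀ x, A e1 x = 1) :
    ∃ μ : Measure X, IsFiniteMeasure μ ∧ ∀ e, ∫ x, A e x ∂μ = l e := by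
  have hker : l ∈ (LinearMap.ker A).dualAnnihilator := by
    rw [Submodule.mem_dualAnnihilator]
    intro e he
    rw [LinearMap.mem_ker] at he
    have h1 := hpos e (fun x => by rw [he]; simp)
    have h2 := hpos (-e) (fun x => by rw [map_neg, he]; simp)
    rw [map_neg] at h2
    linarith
  rw [← LinearMap.range_dualMap_eq_dualAnnihilator_ker] at hker
  obtain ⟨φ, hφ⟩ := hker
  have hφ' : ∀ e, φ (A e) = l e := fun e => by rw [← hφ]; rfl
  obtain ⟨g, hg1, hg2⟩ := riesz_extension (PointedCone.positive ℝ C(X, ℝ))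
    ⟨LinearMap.range A, φ.domRestrict _⟩
    (by
      rintro ⟨x, e, rfl⟩ hx
      change 0 ≤ φ (A e)
      rw [hφ']
      exact hpos e (fun y => hx y))
    (by
      intro y
      refine ⟨⟨A (‖y‖ • e1), ⟨_, rfl⟩⟩, ?_⟩
      change (0 : C(X, ℝ)) ≤ A (‖y‖ • e1) + y
      intro x
      have h1 := y.norm_coe_le_norm x
      rw [Real.norm_eq_abs] at h1
      have h2 := (abs_le.1 h1).1
      rw [map_smul]
      change 0 ≤ ‖y‖ * (A e1 x) + y x
      rw [he1]
      linarith)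
  let L : C_c(X, ℝ) →ₗ[ℝ] ℝ :=
    { toFun := fun f => g f.toContinuousMap
      map_add' := fun f f' => by rw [← map_add]; rfl
      map_smul' := fun c f => by rw [RingHom.id_apply, ← map_smul]; rfl }
  let Λ : C_c(X, ℝ) →ₚ[ℝ] ℝ := PositiveLinearMap.mk₀ L (fun f hf => hg2 _ (fun x => hf x))
  refine ⟨RealRMK.rieszMeasure Λ, inferInstance, fun e => ?_⟩
  have := RealRMK.integral_rieszMeasure Λ (CompactlySupportedContinuousMap.continuousMapEquiv (A e))
  change ∫ x, A e x ∂_ = g (A e) at this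
  rw [this]
  have := hg1 ⟨A e, ⟨_, rfl⟩⟩
  rw [← hφ' e]
  exact this

lemma fin_integrable {ν : Measure ℂ} [IsFiniteMeasure ν] (hK : IsCompact K) (hν : ∀ᵐ w ∂ν, w ∈ frontier K)
    {f : ℂ → ℂ} (hf : ContinuousOn f (frontier K)) : Integrable f ν := by
  have : ν = ν.restrict (frontier K) := (Measure.restrict_eq_self_of_ae_mem hν).symm
  rw [this]
  exact hf.integrableOn_compact (frontier_compact hK)

lemma exists_dual {P : Set ℂ} (hK : IsCompact K) (hP : P ⊆ interior K) {ν : Measure ℂ} [IsFiniteMeasure ν]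
    (hν : ∀ᵐ w ∂ν, w ∈ frontier K) {ε : ℝ} (hε : 0 < ε)
    (hno : ∀ R ∈ Rsp P, (∀ w ∈ frontier K, 0 ≤ (1 + R w).re) → ε ≤ ∫ w, (1 + R w).re ∂ν) :
    ∃ μ : Measure ℂ, IsFiniteMeasure μ ∧ (∀ᵐ w ∂μ, w ∈ frontier K) ∧
      μ.real univ = ν.real univ - ε ∧ ∀ R ∈ Rsp P, ∫ w, R w ∂μ = ∫ w, R w ∂ν := by
  have hc : ∀ R ∈ Rsp P, ContinuousOn R (frontier K) := fun R hR => rsp_cont hP hR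
  have hi : ∀ R ∈ Rsp P, Integrable R ν := fun R hR => fin_integrable hK hν (hc R hR)
  have : CompactSpace (frontier K) := isCompact_iff_compactSpace.1 (frontier_compact hK)
  let A : (ℝ × (Rsp P)) →ₗ[ℝ] C(frontier K, ℝ) :=
    { toFun := fun e => ⟨fun x => e.1 + (e.2.1 x.1).re, by
        have := (hc _ e.2.2).domRestrict
        exact continuous_const.add (Complex.continuous_re.comp this)⟩
      map_add' := by
        intro e e'; ext x
        simp; ring
      map_smul' := by
        intro c e; ext x
        simp; ring }
  let l : (ℝ × (Rsp P)) →ₗ[ℝ] ℝ :=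
    { toFun := fun e => (∫ w, e.2.1 w ∂ν).re + e.1 * (ν.real univ - ε)
      map_add' := by
        intro e e'
        have := integral_add (hi _ e.2.2) (hi _ e'.2.2)
        simp [this]; ring
      map_smul' := by
        intro c e
        have : ∫ w, (c • e.2.1) w ∂ν = c • ∫ w, e.2.1 w ∂ν := integral_smul c e.2.1
        change (∫ w, (c • e.2.1) w ∂ν).re + (c * e.1) * (ν.real univ - ε)
          = c * ((∫ w, e.2.1 w ∂ν).re + e.1 * (ν.real univ - ε))
        rw [this, Complex.real_smul, Complex.re_ofReal_mul]; ring }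
  have hre : ∀ (c : ℝ), ∀ R ∈ Rsp P, ∫ w, (c + (R w).re) ∂ν = (∫ w, R w ∂ν).re + c * ν.real univ := by
    intro c R hR
    have hir : Integrable (fun w => (R w).re) ν := (hi R hR).re
    rw [integral_add (integrable_const _) hir, integral_const]
    have : ∫ w, (R w).re ∂ν = (∫ w, R w ∂ν).re := integral_re (hi R hR)
    rw [this, smul_eq_mul]; ring
  obtain ⟨m, hm, hmA⟩ := pos_ext A l (by
    rintro ⟨c, R, hR⟩ hx
    change 0 ≤ (∫ w, R w ∂ν).re + c * (ν.real univ - ε)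
    have hx' : ∀ w ∈ frontier K, 0 ≤ c + (R w).re := fun w hw => hx ⟨w, hw⟩
    have h0 : 0 ≤ ∫ w, (c + (R w).re) ∂ν := integral_nonneg_of_ae (by
      filter_upwards [hν] with w hw using hx' w hw)
    rcases le_or_gt c 0 with h | h
    · rw [hre c R hR] at h0
      nlinarith
    · have h1 := hno ((c⁻¹ : ℂ) • R) (Submodule.smul_mem _ _ hR) (by
        intro w hw
        have := hx' w hw
        have e : (1 + ((c⁻¹ : ℂ) • R) w).re = c⁻¹ * (c + (R w).re) := by
          simp [← ofReal_inv]; field_simp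
        rw [e]; positivity)
      have e : (fun w => (1 + ((c⁻¹ : ℂ) • R) w).re) = fun w => c⁻¹ * (c + (R w).re) := by
        ext w; simp [← ofReal_inv]; field_simp
      rw [e, integral_const_mul, hre c R hR] at h1
      have h2 : c * ε ≤ c * (c⁻¹ * ((∫ w, R w ∂ν).re + c * ν.real univ)) := by gcongr
      rw [mul_inv_cancel_left₀ h.ne'] at h2
      linarith) (1, 0) (by intro x; simp [A])
  refine ⟨m.map Subtype.val, inferInstance, ?_, ?_, ?_⟩
  · have hms : MeasurableSet (frontier K) := isClosed_frontier.measurableSet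
    refine (ae_map_iff (p := fun w => w ∈ frontier K) measurable_subtype_coe.aemeasurable hms).2 ?_
    exact Eventually.of_forall fun x => x.2
  · rw [map_measureReal_apply measurable_subtype_coe MeasurableSet.univ]
    have := hmA (1, 0)
    simp [A, l] at this
    simpa using this
  · intro R hR
    have emb : MeasurableEmbedding (Subtype.val : frontier K → ℂ) :=
      MeasurableEmbedding.subtype_coe isClosed_frontier.measurableSet
    rw [emb.integral_map]
    have hRi : Integrable (fun x : frontier K => R x) m := by
      have : Continuous (fun x : frontier K => R x) := (hc R hR).domRestrict
      exact this.integrable_of_hasCompactSupport (HasCompactSupport.of_compactSpace _)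
    have key : ∀ R ∈ Rsp P, (∫ x : frontier K, (R x).re ∂m) = (∫ w, R w ∂ν).re := by
      intro R hR
      have := hmA (0, ⟨R, hR⟩)
      simp [A, l] at this
      exact this
    apply Complex.ext
    · have h1 : ∫ x : frontier K, (R x).re ∂m = (∫ x : frontier K, R x ∂m).re := integral_re hRi
      rw [← h1, key R hR]
    · have h1 : ∫ x : frontier K, (R x).im ∂m = (∫ x : frontier K, R x ∂m).im := integral_im hRi
      have h2 := key ((-I) • R) (Submodule.smul_mem _ _ hR)
      have h3 : ∫ w, ((-I) • R) w ∂ν = (-I) • ∫ w, R w ∂ν := integral_smul (-I) R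
      rw [h3] at h2
      simp at h2
      rw [← h1, h2]
end

section
open scoped ENNReal NNReal Real ComplexConjugate
variable {K : Set ℂ}

lemma harnack {H : ℂ → ℂ} {z0 z : ℂ} {r : ℝ} (hH : DifferentiableOn ℂ H (ball z0 r))
    (hpos : ∀ z ∈ ball z0 r, 0 < (H z).re) (hz : z ∈ ball z0 r) :
    (H z0).re * (1 - ‖z - z0‖ / r) ≤ (H z).re * (1 + ‖z - z0‖ / r) := by
  have hr : 0 < r := dist_nonneg.trans_lt (mem_ball.1 hz)
  have h0 := hpos z0 (mem_ball_self hr)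
  obtain ⟨a, ha⟩ : ∃ a : ℝ, a = (H z0).re := ⟨_, rfl⟩
  obtain ⟨y0, hy0⟩ : ∃ a : ℝ, a = (H z0).im := ⟨_, rfl⟩
  rw [← ha] at h0 ⊢
  obtain ⟨G, hG⟩ : ∃ G : ℂ → ℂ, G = fun z => H z - y0 * I := ⟨_, rfl⟩
  have hGd : DifferentiableOn ℂ G (ball z0 r) := by rw [hG]; exact hH.sub_const _
  have hGre : ∀ z, (G z).re = (H z).re := by intro z; simp [hG]
  have hG0 : G z0 = a := by
    apply Complex.ext <;> simp [hG, ha, hy0]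
  have hlt : ∀ z ∈ ball z0 r, ‖G z - a‖ < ‖G z + a‖ := by
    intro z hz
    have := hpos z hz
    rw [← hGre] at this
    rw [← sq_lt_sq₀ (norm_nonneg _) (norm_nonneg _), ← Complex.normSq_eq_norm_sq, ← Complex.normSq_eq_norm_sq,
      Complex.normSq_apply, Complex.normSq_apply]
    simp
    nlinarith [mul_pos this h0]
  have hne : ∀ z ∈ ball z0 r, G z + a ≠ 0 := fun z hz => norm_pos_iff.1 ((norm_nonneg _).trans_lt (hlt z hz))
  have hs := Complex.dist_le_div_mul_dist_of_mapsTo_ball (f := fun z => (G z - a) / (G z + a)) (c := z0)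
    (R₁ := r) (R₂ := 1) (z := z) ((hGd.sub_const _).div (hGd.add_const _) hne)
    (by
      intro z hz
      rw [mem_closedBall, hG0]
      simp only [sub_self, zero_div, dist_zero_right, norm_div]
      exact ((div_lt_one (norm_pos_iff.2 (hne z hz))).2 (hlt z hz)).le) hz
  rw [hG0] at hs
  simp only [sub_self, zero_div, dist_zero_right, norm_div] at hs
  obtain ⟨q, hq⟩ : ∃ q, q = ‖z - z0‖ / r := ⟨_, rfl⟩
  have hq1 : q < 1 := by rw [hq, div_lt_one hr, ← dist_eq_norm]; exact hz
  have hq0 : 0 ≤ q := by rw [hq]; positivity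
  have hs' : ‖G z - a‖ ≤ q * ‖G z + a‖ := by
    rw [div_le_iff₀ (norm_pos_iff.2 (hne z hz)), dist_eq_norm] at hs
    rw [hq]; refine hs.trans (le_of_eq ?_); ring
  rw [← hq]
  rw [← sq_le_sq₀ (norm_nonneg _) (by positivity), mul_pow, ← Complex.normSq_eq_norm_sq, ← Complex.normSq_eq_norm_sq,
      Complex.normSq_apply, Complex.normSq_apply] at hs'
  simp at hs'
  rw [← hGre]
  have hx : 0 < (G z).re := by rw [hGre]; exact hpos z hz
  by_contra! hcon
  have h1 : q * ((G z).re + a) < a - (G z).re := by nlinarith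
  have h2 : (q * ((G z).re + a))^2 < (a - (G z).re)^2 := by
    apply pow_lt_pow_left₀ h1 (by positivity) (by norm_num)
  have h3 : q^2 ≤ 1 := by nlinarith
  nlinarith [mul_nonneg (sub_nonneg.2 h3) (mul_self_nonneg (G z).im)]

/-- logarithmic potential -/
def pot (m : Measure ℂ) (z : ℂ) : ℝ := ∫ w, Real.log ‖w - z‖ ∂m

lemma fin_integrableR {ν : Measure ℂ} [IsFiniteMeasure ν] (hK : IsCompact K) (hν : ∀ᵐ w ∂ν, w ∈ frontier K)
    {f : ℂ → ℝ} (hf : ContinuousOn f (frontier K)) : Integrable f ν := by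
  have : ν = ν.restrict (frontier K) := (Measure.restrict_eq_self_of_ae_mem hν).symm
  rw [this]
  exact hf.integrableOn_compact (frontier_compact hK)

lemma log_int_off {m : Measure ℂ} [IsFiniteMeasure m] (hK : IsCompact K) (hm : ∀ᵐ w ∂m, w ∈ frontier K)
    {z : ℂ} (hz : z ∉ frontier K) : Integrable (fun w => Real.log ‖w - z‖) m := by
  apply fin_integrableR hK hm
  apply ContinuousOn.log (by fun_prop)
  intro w hw h
  rw [norm_eq_zero, sub_eq_zero] at h
  exact hz (h ▸ hw)

lemma pot_loc {m : Measure ℂ} [IsFiniteMeasure m] (hK : IsCompact K) (hm : ∀ᵐ w ∂m, w ∈ frontier K)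
    {z0 : ℂ} {r : ℝ} (hr : 0 < r) (hb : ∀ w ∈ frontier K, r ≤ ‖w - z0‖) :
    ∃ F : ℂ → ℂ, ∀ z ∈ ball z0 r, HasDerivAt F (-∫ w, (w - z)⁻¹ ∂m) z ∧
      pot m z = pot m z0 + (F z).re := by
  have hslit : ∀ z ∈ ball z0 r, ∀ w ∈ frontier K, 1 - (z - z0) / (w - z0) ∈ Complex.slitPlane := by
    intro z hz w hw
    rw [mem_ball, dist_eq_norm] at hz
    have h1 := hb w hw
    have h2 : ‖(z - z0) / (w - z0)‖ < 1 := by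
      rw [norm_div, div_lt_one (by linarith)]; linarith
    have := Complex.mem_slitPlane_of_norm_lt_one (z := -((z - z0) / (w - z0))) (by rwa [norm_neg])
    rwa [← sub_eq_add_neg] at this
  have hne0 : ∀ w ∈ frontier K, w - z0 ≠ 0 := fun w hw => norm_pos_iff.1 (hr.trans_le (hb w hw))
  have hne : ∀ z ∈ ball z0 r, ∀ w ∈ frontier K, w - z ≠ 0 := by
    intro z hz w hw h
    rw [mem_ball, dist_eq_norm] at hz
    have := hb w hw
    rw [sub_eq_zero] at h
    rw [h] at this; linarith
  have hci : ∀ z ∈ ball z0 r, Integrable (fun w => Complex.log (1 - (z - z0) / (w - z0))) m := by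
    intro z hz
    apply fin_integrable hK hm
    apply ContinuousOn.clog
    · apply continuousOn_const.sub
      apply continuousOn_const.div (by fun_prop) hne0
    · exact fun w hw => hslit z hz w hw
  have hcd : ∀ z ∈ ball z0 r, Integrable (fun w => (w - z)⁻¹) m := by
    intro z hz
    apply fin_integrable hK hm
    apply ContinuousOn.inv₀ (by fun_prop) (hne z hz)
  refine ⟨fun z => ∫ w, Complex.log (1 - (z - z0) / (w - z0)) ∂m, fun z hz => ⟨?_, ?_⟩⟩
  · have hz' := hz
    rw [mem_ball, dist_eq_norm] at hz'
    obtain ⟨d, hd⟩ : ∃ d, d = (r - ‖z - z0‖) / 2 := ⟨_, rfl⟩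
    have hd0 : 0 < d := by rw [hd]; linarith
    have hsub : ball z d ⊆ ball z0 r := by
      apply ball_subset_ball'
      rw [dist_eq_norm]; linarith
    have := hasDerivAt_integral_of_dominated_loc_of_deriv_le (μ := m) (𝕜 := ℂ)
      (F := fun z w => Complex.log (1 - (z - z0) / (w - z0))) (F' := fun z w => -(w - z)⁻¹)
      (x₀ := z) (s := ball z d) (bound := fun _ => d⁻¹) (ball_mem_nhds z hd0)
      (by filter_upwards [isOpen_ball.mem_nhds hz] with y hy using (hci y hy).aestronglyMeasurable)
      (hci z hz) (hcd z hz).neg.aestronglyMeasurable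
      (by
        filter_upwards [hm] with w hw y hy
        rw [norm_neg, norm_inv]
        apply inv_anti₀ hd0
        have h1 := hb w hw
        rw [mem_ball, dist_eq_norm] at hy
        have h2 : ‖w - z0‖ ≤ ‖w - y‖ + ‖y - z‖ + ‖z - z0‖ := by
          calc ‖w - z0‖ = ‖(w - y) + (y - z) + (z - z0)‖ := by congr 1; ring
            _ ≤ _ := norm_add₃_le
        linarith)
      (integrable_const _)
      (by
        filter_upwards [hm] with w hw y hy
        have h1 : HasDerivAt (fun y => 1 - (y - z0) / (w - z0)) (-(1 / (w - z0))) y := by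
          simpa using (((hasDerivAt_id y).sub_const z0).div_const (w - z0)).const_sub 1
        refine (h1.clog (hslit y (hsub hy) w hw)).congr_deriv ?_
        have h3 := hne0 w hw
        have h4 := hne y (hsub hy) w hw
        have h5 : 1 - (y - z0) / (w - z0) = (w - y) / (w - z0) := by field_simp; ring
        rw [h5]; field_simp)
    rw [integral_neg] at this
    exact this.2
  · have h1 : (∫ w, Complex.log (1 - (z - z0) / (w - z0)) ∂m).re = ∫ w, (Complex.log (1 - (z - z0) / (w - z0))).re ∂m :=
      (integral_re (hci z hz)).symm
    have hz0 : z0 ∉ frontier K := fun h => hne0 _ h (sub_self _)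
    have hire : Integrable (fun w => (Complex.log (1 - (z - z0) / (w - z0))).re) m := (hci z hz).re
    rw [h1, pot, pot, ← integral_add (log_int_off hK hm hz0) hire]
    apply integral_congr_ae
    filter_upwards [hm] with w hw
    have h3 := hne0 w hw
    have h4 := hne z hz w hw
    have h5 : 1 - (z - z0) / (w - z0) = (w - z) / (w - z0) := by field_simp; ring
    rw [Complex.log_re, h5, norm_div, Real.log_div (norm_ne_zero_iff.2 h4) (norm_ne_zero_iff.2 h3)]
    ring

lemma pot_inf {m : Measure ℂ} [IsFiniteMeasure m] (hK : IsCompact K) (hm : ∀ᵐ w ∂m, w ∈ frontier K) :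
    ∀ᶠ z in cobounded ℂ, |pot m z - m.real univ * Real.log ‖z‖| ≤ m.real univ * Real.log 2 := by
  obtain ⟨M, hM⟩ := (frontier_compact hK).isBounded.exists_norm_le
  filter_upwards [tendsto_norm_cobounded_atTop.eventually_gt_atTop (2 * M + 1),
    tendsto_norm_cobounded_atTop.eventually_gt_atTop 0, tendsto_norm_cobounded_atTop.eventually_gt_atTop M] with z hz hz0 hzM
  have hzf : z ∉ frontier K := by
    intro h
    have := hM z h
    linarith
  have h1 : pot m z - m.real univ * Real.log ‖z‖ = ∫ w, (Real.log ‖w - z‖ - Real.log ‖z‖) ∂m := by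
    rw [integral_sub (log_int_off hK hm hzf) (integrable_const _), integral_const]; rfl
  rw [h1, ← Real.norm_eq_abs]
  have := norm_integral_le_of_norm_le_const (μ := m) (C := Real.log 2) (f := fun w => (Real.log ‖w - z‖ - Real.log ‖z‖)) (by
    filter_upwards [hm] with w hw
    have hw1 := hM w hw
    have h2 : ‖w - z‖ ≤ 2 * ‖z‖ := (norm_sub_le _ _).trans (by linarith [norm_nonneg w])
    have h3 : ‖z‖ / 2 ≤ ‖w - z‖ := by
      have := norm_sub_norm_le z w
      rw [norm_sub_rev] at this
      linarith
    have h4 : 0 < ‖w - z‖ := by linarith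
    rw [Real.norm_eq_abs, abs_le]
    constructor
    · have := Real.log_le_log (by positivity) h3
      rw [Real.log_div hz0.ne' (by norm_num)] at this
      linarith
    · have := Real.log_le_log h4 h2
      rw [Real.log_mul (by norm_num) hz0.ne'] at this
      linarith)
  linarith
end

section
open scoped ENNReal NNReal Real ComplexConjugate
variable {K : Set ℂ}

/-- truncated potential -/
def tpot (m : Measure ℂ) (r : ℝ) (z : ℂ) : ℝ := ∫ w, Real.log (max r ‖w - z‖) ∂m

lemma tpot_int {m : Measure ℂ} [IsFiniteMeasure m] (hK : IsCompact K) (hm : ∀ᵐ w ∂m, w ∈ frontier K)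
    {r : ℝ} (hr : 0 < r) (z : ℂ) : Integrable (fun w => Real.log (max r ‖w - z‖)) m := by
  apply fin_integrableR hK hm
  apply ContinuousOn.log (by fun_prop)
  intro w hw
  have : r ≤ max r ‖w - z‖ := le_max_left _ _
  linarith

lemma tpot_cont {m : Measure ℂ} [IsFiniteMeasure m] (hK : IsCompact K) (hm : ∀ᵐ w ∂m, w ∈ frontier K)
    {r : ℝ} (hr : 0 < r) (b : ℂ) : ContinuousAt (tpot m r) b := by
  obtain ⟨M, hM⟩ := (frontier_compact hK).isBounded.exists_norm_le
  apply continuousAt_of_dominated (bound := fun _ => |Real.log r| + |Real.log (max r (M + ‖b‖ + 1))|)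
  · exact Eventually.of_forall fun z => (tpot_int hK hm hr z).aestronglyMeasurable
  · filter_upwards [ball_mem_nhds b zero_lt_one] with z hz
    filter_upwards [hm] with w hw
    rw [mem_ball, dist_eq_norm] at hz
    have h1 : ‖w - z‖ ≤ M + ‖b‖ + 1 := by
      have e : w - z = w - b - (z - b) := by ring
      rw [e]
      have := norm_sub_le (w - b) (z - b)
      have := norm_sub_le w b
      have := hM w hw
      linarith
    have h2 : r ≤ max r ‖w - z‖ := le_max_left _ _
    have h3 : max r ‖w - z‖ ≤ max r (M + ‖b‖ + 1) := max_le_max le_rfl h1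
    have h4 := Real.log_le_log hr h2
    have h5 := Real.log_le_log (by linarith) h3
    rw [Real.norm_eq_abs, abs_le]
    constructor
    · linarith [neg_abs_le (Real.log r), abs_nonneg (Real.log (max r (M + ‖b‖ + 1)))]
    · linarith [le_abs_self (Real.log (max r (M + ‖b‖ + 1))), abs_nonneg (Real.log r)]
  · exact integrable_const _
  · refine Eventually.of_forall fun w => ?_
    apply ContinuousAt.log (by fun_prop)
    have : r ≤ max r ‖w - b‖ := le_max_left _ _
    linarith

lemma pot_le_tpot {m : Measure ℂ} [IsFiniteMeasure m] (hK : IsCompact K) (hm : ∀ᵐ w ∂m, w ∈ frontier K)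
    {r : ℝ} (hr : 0 < r) {z : ℂ} (hz : ∀ᵐ w ∂m, w ≠ z) (hi : Integrable (fun w => Real.log ‖w - z‖) m) :
    pot m z ≤ tpot m r z := by
  apply integral_mono_ae hi (tpot_int hK hm hr z)
  filter_upwards [hz] with w hw
  exact Real.log_le_log (norm_pos_iff.2 (sub_ne_zero.2 hw)) (le_max_right _ _)

lemma log_max_bound {r x : ℝ} (hr : 0 < r) (hr1 : r ≤ 1) (hx : 0 < x) :
    |Real.log (max r x)| ≤ |Real.log x| + |Real.log (max 1 x)| := by
  have h1 := Real.log_le_log hx (le_max_right r x)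
  have h2 := Real.log_le_log (lt_max_of_lt_left hr) (max_le_max hr1 (le_refl x))
  rw [abs_le]
  constructor
  · linarith [neg_abs_le (Real.log x), abs_nonneg (Real.log (max 1 x))]
  · linarith [le_abs_self (Real.log (max 1 x)), abs_nonneg (Real.log x)]

lemma pot_usc {m : Measure ℂ} [IsFiniteMeasure m] (hK : IsCompact K) (hm : ∀ᵐ w ∂m, w ∈ frontier K)
    (hz : ∀ z, ∀ᵐ w ∂m, w ≠ z) (hi : ∀ z, Integrable (fun w => Real.log ‖w - z‖) m) (b : ℂ)
    {η : ℝ} (hη : 0 < η) : ∀ᶠ z in 𝓝 b, pot m z < pot m b + η := by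
  have hlim : Tendsto (fun r => tpot m r b) (𝓝[>] 0) (𝓝 (pot m b)) := by
    apply tendsto_integral_filter_of_dominated_convergence
      (bound := fun w => |Real.log ‖w - b‖| + |Real.log (max 1 ‖w - b‖)|)
    · filter_upwards [self_mem_nhdsWithin] with r hr using (tpot_int hK hm hr b).aestronglyMeasurable
    · filter_upwards [Ioo_mem_nhdsGT (zero_lt_one' ℝ)] with r hr
      filter_upwards [hz b] with w hw
      exact log_max_bound hr.1 hr.2.le (norm_pos_iff.2 (sub_ne_zero.2 hw))
    · exact (hi b).abs.add (tpot_int hK hm one_pos b).abs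
    · filter_upwards [hz b] with w hw
      have hp := norm_pos_iff.2 (sub_ne_zero.2 hw)
      apply Tendsto.congr' _ tendsto_const_nhds
      filter_upwards [Ioo_mem_nhdsGT hp] with r hr
      rw [max_eq_right hr.2.le]
  obtain ⟨r, hr1, hr0⟩ := ((hlim.eventually_lt_const (show pot m b < pot m b + η by linarith)).and
    self_mem_nhdsWithin).exists
  filter_upwards [(tpot_cont hK hm hr0 b).eventually_lt_const hr1] with z hzz
  exact (pot_le_tpot hK hm hr0 (hz z) (hi z)).trans_lt hzz

lemma log_split {r x : ℝ} (hr : 0 < r) (hx : 0 < x) : Real.log x = Real.log (max r x) - Real.posLog (r / x) := by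
  rw [Real.posLog, Real.log_div hr.ne' hx.ne']
  rcases le_total r x with h | h
  · have := Real.log_le_log hr h
    rw [max_eq_right h, max_eq_left (by linarith)]; ring
  · have := Real.log_le_log hx h
    rw [max_eq_left h, max_eq_right (by linarith)]; ring

lemma posLog_int {m : Measure ℂ} {D : ℝ} {r : ℝ} {z : ℂ}
    (hD : ∫⁻ w, ENNReal.ofReal (Real.posLog (r / ‖w - z‖)) ∂m ≤ ENNReal.ofReal D) :
    Integrable (fun w => Real.posLog (r / ‖w - z‖)) m := by
  have hme : Measurable (fun w : ℂ => Real.posLog (r / ‖w - z‖)) := by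
    apply posLog_meas.comp
    fun_prop
  refine ⟨hme.aestronglyMeasurable, ?_⟩
  rw [hasFiniteIntegral_iff_ofReal (Eventually.of_forall fun w => Real.posLog_nonneg)]
  exact hD.trans_lt ENNReal.ofReal_lt_top

lemma log_int_of {m : Measure ℂ} [IsFiniteMeasure m] (hK : IsCompact K) (hm : ∀ᵐ w ∂m, w ∈ frontier K)
    {D : ℝ} {z : ℂ} (hz : ∀ᵐ w ∂m, w ≠ z)
    (hD : ∫⁻ w, ENNReal.ofReal (Real.posLog (1 / ‖w - z‖)) ∂m ≤ ENNReal.ofReal D) :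
    Integrable (fun w => Real.log ‖w - z‖) m := by
  refine ((tpot_int hK hm one_pos z).sub (posLog_int hD)).congr ?_
  filter_upwards [hz] with w hw
  exact (log_split one_pos (norm_pos_iff.2 (sub_ne_zero.2 hw))).symm

lemma pot_lsc {m : Measure ℂ} [IsFiniteMeasure m] (hK : IsCompact K) (hm : ∀ᵐ w ∂m, w ∈ frontier K)
    (hz : ∀ z, ∀ᵐ w ∂m, w ≠ z) {D : ℝ} (hD0 : 0 < D)
    (hD : ∀ z : ℂ, ∀ r > 0, ∫⁻ w, ENNReal.ofReal (Real.posLog (r / ‖w - z‖)) ∂m ≤ ENNReal.ofReal (D * r)) (b : ℂ)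
    {η : ℝ} (hη : 0 < η) : ∀ᶠ z in 𝓝 b, pot m b - η < pot m z := by
  have hi : ∀ z, Integrable (fun w => Real.log ‖w - z‖) m := fun z => log_int_of hK hm (hz z) (hD z 1 one_pos)
  obtain ⟨r, hr⟩ : ∃ r, r = η / (2 * D) := ⟨_, rfl⟩
  have hr0 : 0 < r := by rw [hr]; positivity
  have hDr : D * r = η / 2 := by rw [hr]; field_simp
  have h1 : pot m b - η / 2 < tpot m r b := by linarith [pot_le_tpot hK hm hr0 (hz b) (hi b)]
  filter_upwards [(tpot_cont hK hm hr0 b).eventually_const_lt h1] with z hzz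
  have h2 : pot m z = tpot m r z - ∫ w, Real.posLog (r / ‖w - z‖) ∂m := by
    rw [pot, tpot, ← integral_sub (tpot_int hK hm hr0 z) (posLog_int (hD z r hr0))]
    apply integral_congr_ae
    filter_upwards [hz z] with w hw
    exact log_split hr0 (norm_pos_iff.2 (sub_ne_zero.2 hw))
  have h3 : ∫ w, Real.posLog (r / ‖w - z‖) ∂m ≤ η / 2 := by
    rw [← hDr, integral_eq_lintegral_of_nonneg_ae (Eventually.of_forall fun w => Real.posLog_nonneg)
      (posLog_int (hD z r hr0)).aestronglyMeasurable]
    apply ENNReal.toReal_le_of_le_ofReal (by positivity) (hD z r hr0)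
  linarith

variable {B : SmoothBoundary K} {T : ℂ → ℂ} {C : ℝ}

lemma Geo.nr_half (h : Geo B T C) {w b : ℂ} (hw : w ∈ frontier K) (hb : b ∈ frontier K) {t : ℝ}
    (ht : |t| * (4 * C) ≤ 1) : ‖w - b‖ / 2 ≤ ‖w - nr T b t‖ ∧ ‖w - nr T b t‖ ≤ ‖w - b‖ + |t| := by
  constructor
  · have h1 := h.dist_nr hw hb ht
    rw [← sq_le_sq₀ (by positivity) (norm_nonneg _)]
    nlinarith [sq_nonneg t, sq_nonneg ‖w - b‖]
  · have e : w - nr T b t = (w - b) - t * I * T b := by simp only [nr]; ring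
    rw [e]
    refine (norm_sub_le _ _).trans ?_
    simp [h.norm_T hb]

lemma Geo.pot_nr (h : Geo B T C) {m : Measure ℂ} [IsFiniteMeasure m] (hK : IsCompact K) (hm : ∀ᵐ w ∂m, w ∈ frontier K)
    {b : ℂ} (hb : b ∈ frontier K) (hz : ∀ᵐ w ∂m, w ≠ b) (hi : Integrable (fun w => Real.log ‖w - b‖) m)
    {t : ℕ → ℝ} (ht : Tendsto t atTop (𝓝 0)) :
    Tendsto (fun n => pot m (nr T b (t n))) atTop (𝓝 (pot m b)) := by
  have hsm : ∀ᶠ n in atTop, |t n| * (4 * C) < 1 := by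
    have : Tendsto (fun n => |t n| * (4 * C)) atTop (𝓝 (|0| * (4 * C))) := ht.abs.mul_const _
    rw [abs_zero, zero_mul] at this
    exact this.eventually_lt_const one_pos
  have hC := h.Cpos
  have hnr : Tendsto (fun n => nr T b (t n)) atTop (𝓝 b) := by
    have : Continuous (fun t : ℝ => nr T b t) := by unfold nr; fun_prop
    have h2 := (this.tendsto 0).comp ht
    simpa [nr, Function.comp_def] using h2
  apply tendsto_integral_filter_of_dominated_convergence
      (bound := fun w => |Real.log ‖w - b‖| + Real.log 2 + Real.log (‖w - b‖ + 1))
  · refine Eventually.of_forall fun n => ?_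
    have : Measurable (fun w : ℂ => Real.log ‖w - nr T b (t n)‖) := Real.measurable_log.comp (by fun_prop)
    exact this.aestronglyMeasurable
  · filter_upwards [hsm] with n hn
    filter_upwards [hm, hz] with w hw hwb
    have hp := norm_pos_iff.2 (sub_ne_zero.2 hwb)
    obtain ⟨h1, h2⟩ := h.nr_half hw hb hn.le
    have h3 : |t n| ≤ 1 := by nlinarith [abs_nonneg (t n)]
    have h4 := Real.log_le_log (by positivity) h1
    rw [Real.log_div hp.ne' (by norm_num)] at h4
    have h5 := Real.log_le_log (by linarith) (h2.trans (show _ ≤ ‖w - b‖ + 1 by linarith))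
    have h6 : 0 ≤ Real.log (‖w - b‖ + 1) := Real.log_nonneg (by linarith)
    have h7 : 0 ≤ Real.log 2 := Real.log_nonneg (by norm_num)
    rw [Real.norm_eq_abs, abs_le]
    constructor
    · linarith [neg_abs_le (Real.log ‖w - b‖)]
    · linarith [abs_nonneg (Real.log ‖w - b‖)]
  · apply (hi.abs.add (integrable_const _)).add
    apply fin_integrableR hK hm
    apply ContinuousOn.log (by fun_prop)
    intro w _
    positivity
  · filter_upwards [hz] with w hw
    have hp := norm_pos_iff.2 (sub_ne_zero.2 hw)
    have h1 : Tendsto (fun n => ‖w - nr T b (t n)‖) atTop (𝓝 ‖w - b‖) := (tendsto_const_nhds.sub hnr).norm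
    exact h1.log hp.ne'

lemma Geo.pot_bdry (h : Geo B T C) {ν μ : Measure ℂ} [IsFiniteMeasure ν] [IsFiniteMeasure μ] (hK : IsCompact K)
    (hν : ∀ᵐ w ∂ν, w ∈ frontier K) (hμ : ∀ᵐ w ∂μ, w ∈ frontier K)
    {b : ℂ} (hb : b ∈ frontier K) (hz : ∀ᵐ w ∂ν, w ≠ b) (hi : Integrable (fun w => Real.log ‖w - b‖) ν)
    {t0 c0 : ℝ} (ht0 : 0 < t0) (ht0' : t0 * (4 * C) ≤ 1)
    (hc : ∀ t, 0 < t → t ≤ t0 → pot ν (nr T b t) - pot μ (nr T b t) = c0)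
    (hoff : ∀ t, 0 < t → t ≤ t0 → nr T b t ∉ frontier K) :
    (∀ᵐ w ∂μ, w ≠ b) ∧ Integrable (fun w => Real.log ‖w - b‖) μ ∧ pot ν b - pot μ b = c0 := by
  obtain ⟨t, htd⟩ : ∃ t : ℕ → ℝ, t = fun n : ℕ => t0 * (1 / ((n : ℝ) + 1)) := ⟨_, rfl⟩
  have htp : ∀ n, 0 < t n := fun n => by rw [htd]; positivity
  have htle : ∀ n, t n ≤ t0 := fun n => by
    rw [htd]
    have : 1 / ((n : ℝ) + 1) ≤ 1 := by
      rw [div_le_one (by positivity)]; linarith [(Nat.cast_nonneg n : (0:ℝ) ≤ n)]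
    beta_reduce
    nlinarith
  have htt : Tendsto t atTop (𝓝 0) := by
    rw [htd]; simpa using (tendsto_one_div_add_atTop_nhds_zero_nat (𝕜 := ℝ)).const_mul t0
  have hC := h.Cpos
  have hta : ∀ n, |t n| * (4 * C) ≤ 1 := fun n => by
    rw [abs_of_pos (htp n)]; nlinarith [htle n]
  have hnr : Tendsto (fun n => nr T b (t n)) atTop (𝓝 b) := by
    have : Continuous (fun t : ℝ => nr T b t) := by unfold nr; fun_prop
    have h2 := (this.tendsto 0).comp htt
    simpa [nr, Function.comp_def] using h2
  have hνt := h.pot_nr hK hν hb hz hi htt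
  have hμt : Tendsto (fun n => pot μ (nr T b (t n))) atTop (𝓝 (pot ν b - c0)) := by
    refine (hνt.sub_const c0).congr fun n => ?_
    rw [← hc (t n) (htp n) (htle n)]; ring
  obtain ⟨M, hM⟩ := (frontier_compact hK).isBounded.exists_norm_le
  have hM0 : 0 ≤ M := (norm_nonneg b).trans (hM b hb)
  obtain ⟨L, hL⟩ : ∃ L, L = Real.log (2 * M + t0) := ⟨_, rfl⟩
  have hlogle : ∀ n, ∀ w ∈ frontier K, Real.log ‖w - nr T b (t n)‖ ≤ L := by
    intro n w hw
    rw [hL]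
    have h1 := (h.nr_half hw hb (hta n)).2
    have h2 : ‖w - b‖ ≤ 2 * M := (norm_sub_le _ _).trans (by linarith [hM w hw, hM b hb])
    rw [abs_of_pos (htp n)] at h1
    apply Real.log_le_log
    · apply norm_pos_iff.2; intro hh
      rw [sub_eq_zero] at hh
      exact hoff (t n) (htp n) (htle n) (hh ▸ hw)
    · linarith [htle n]
  have hlin : ∀ n, ∫⁻ w, ENNReal.ofReal (L - Real.log ‖w - nr T b (t n)‖) ∂μ
      = ENNReal.ofReal (μ.real univ * L - pot μ (nr T b (t n))) := by
    intro n
    have hii := log_int_off hK hμ (hoff (t n) (htp n) (htle n))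
    rw [← ofReal_integral_eq_lintegral_ofReal (f := fun w => L - Real.log ‖w - nr T b (t n)‖) (int_sub (integrable_const _) hii)
      (by filter_upwards [hμ] with w hw; simpa using hlogle n w hw)]
    rw [integral_sub (integrable_const _) hii, integral_const]; rfl
  have hfat := lintegral_liminf_le (μ := μ) (u := atTop) (f := fun n w => ENNReal.ofReal (L - Real.log ‖w - nr T b (t n)‖))
    (fun n => ENNReal.measurable_ofReal.comp (measurable_const.sub (Real.measurable_log.comp (by fun_prop))))
  have hlim2 : Tendsto (fun n => ∫⁻ w, ENNReal.ofReal (L - Real.log ‖w - nr T b (t n)‖) ∂μ) atTop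
      (𝓝 (ENNReal.ofReal (μ.real univ * L - (pot ν b - c0)))) := by
    simp_rw [hlin]
    exact ENNReal.tendsto_ofReal (tendsto_const_nhds.sub hμt)
  rw [hlim2.liminf_eq] at hfat
  have hlt : ∫⁻ w, liminf (fun n => ENNReal.ofReal (L - Real.log ‖w - nr T b (t n)‖)) atTop ∂μ ≠ ⊤ :=
    (hfat.trans_lt ENNReal.ofReal_lt_top).ne
  have hae := ae_lt_top (Measurable.liminf fun n =>
    (ENNReal.measurable_ofReal.comp (measurable_const.sub (Real.measurable_log.comp (by fun_prop))) :
      Measurable (fun w => ENNReal.ofReal (L - Real.log ‖w - nr T b (t n)‖)))) hlt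
  have hnb : ∀ᵐ w ∂μ, w ≠ b := by
    filter_upwards [hae] with w hw hwb
    rw [hwb] at hw
    apply hw.ne
    have e : ∀ n, ‖b - nr T b (t n)‖ = t n := by
      intro n
      have : b - nr T b (t n) = -(t n * I * T b) := by simp only [nr]; ring
      rw [this]
      simp [h.norm_T hb, abs_of_pos (htp n)]
    change liminf (fun n => ENNReal.ofReal (L - Real.log ‖b - nr T b (t n)‖)) atTop = ⊤
    simp_rw [e]
    apply Tendsto.liminf_eq
    apply ENNReal.tendsto_ofReal_atTop.comp
    have h1 : Tendsto t atTop (𝓝[>] 0) := tendsto_nhdsWithin_iff.2 ⟨htt, Eventually.of_forall htp⟩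
    have h2 := Real.tendsto_log_nhdsGT_zero.comp h1
    exact tendsto_atTop_add_const_left _ L (tendsto_neg_atBot_atTop.comp h2)
  have hInt : Integrable (fun w => Real.log ‖w - b‖) μ := by
    have h1 : Integrable (fun w => L - Real.log ‖w - b‖) μ := by
      refine ⟨(measurable_const.sub (Real.measurable_log.comp (by fun_prop))).aestronglyMeasurable, ?_⟩
      rw [hasFiniteIntegral_iff_ofReal]
      · refine lt_of_le_of_lt (le_of_eq ?_) (lt_top_iff_ne_top.2 hlt)
        apply lintegral_congr_ae
        filter_upwards [hnb] with w hw
        have hp := norm_pos_iff.2 (sub_ne_zero.2 hw)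
        have h1 : Tendsto (fun n => ‖w - nr T b (t n)‖) atTop (𝓝 ‖w - b‖) := (tendsto_const_nhds.sub hnr).norm
        exact (ENNReal.tendsto_ofReal (tendsto_const_nhds.sub (h1.log hp.ne'))).liminf_eq.symm
      · filter_upwards [hnb, hμ] with w hw hwf
        have hp := norm_pos_iff.2 (sub_ne_zero.2 hw)
        have h1 : Tendsto (fun n => ‖w - nr T b (t n)‖) atTop (𝓝 ‖w - b‖) := (tendsto_const_nhds.sub hnr).norm
        have := le_of_tendsto (h1.log hp.ne') (Eventually.of_forall fun n => hlogle n w hwf)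
        simpa using this
    have := (integrable_const L).sub h1
    refine this.congr (Eventually.of_forall fun w => ?_)
    simp
  refine ⟨hnb, hInt, ?_⟩
  have := tendsto_nhds_unique (h.pot_nr hK hμ hb hnb hInt htt) hμt
  linarith
end

section
open scoped ENNReal NNReal Real ComplexConjugate
variable {K : Set ℂ}

/-- `V` is near `z0` the real part of a holomorphic function. -/
def LocRe (V : ℂ → ℝ) (z0 : ℂ) : Prop :=
  ∃ r > 0, ∃ F : ℂ → ℂ, DifferentiableOn ℂ F (ball z0 r) ∧ ∀ z ∈ ball z0 r, V z = V z0 + (F z).re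

lemma LocRe.min {V : ℂ → ℝ} {z0 : ℂ} (h : LocRe V z0) (hmin : ∀ᶠ z in 𝓝 z0, V z0 ≤ V z) :
    ∀ᶠ z in 𝓝 z0, V z = V z0 := by
  obtain ⟨r, hr, F, hF, hV⟩ := h
  have hF0 : (F z0).re = 0 := by linarith [hV z0 (mem_ball_self hr)]
  have hball : ∀ᶠ z in 𝓝 z0, z ∈ ball z0 r := ball_mem_nhds z0 hr
  have hd : ∀ᶠ z in 𝓝 z0, DifferentiableAt ℂ (fun z => Complex.exp (-F z)) z := by
    filter_upwards [hball] with z hz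
    exact ((hF.differentiableAt (isOpen_ball.mem_nhds hz)).neg).cexp
  have hm : IsLocalMax (norm ∘ (fun z => Complex.exp (-F z))) z0 := by
    filter_upwards [hball, hmin] with z hz hz'
    simp only [Function.comp, Complex.norm_exp, neg_re, hF0, Real.exp_le_exp]
    linarith [hV z hz]
  filter_upwards [hball, Complex.eventually_eq_of_isLocalMax_norm hd hm] with z hz hz'
  have := congrArg norm hz'
  simp only [Complex.norm_exp, neg_re, hF0, Real.exp_eq_exp] at this
  linarith [hV z hz]

lemma lsc_closed {V : ℂ → ℝ} (hl : ∀ b, ∀ η > 0, ∀ᶠ z in 𝓝 b, V b - η < V z) (c : ℝ) :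
    IsOpen {z | c < V z} := by
  rw [isOpen_iff_mem_nhds]
  intro z hz
  filter_upwards [hl z (V z - c) (by simpa using hz)] with y hy
  show c < V y
  linarith

lemma min_princ {V : ℂ → ℝ} {Γ : Set ℂ} (hne : Γ.Nonempty)
    (hl : ∀ b, ∀ η > 0, ∀ᶠ z in 𝓝 b, V b - η < V z) (hinf : Tendsto V (cobounded ℂ) atTop)
    (hloc : ∀ z ∉ Γ, LocRe V z) {c : ℝ} (hc : ∀ z ∈ Γ, c ≤ V z) (z : ℂ) : c ≤ V z := by
  by_contra! hz
  obtain ⟨ρ, hρ⟩ : ∃ ρ, ∀ y, ρ < ‖y‖ → V z + 1 ≤ V y := by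
    have := hinf.eventually_ge_atTop (V z + 1)
    rw [← comap_norm_atTop, eventually_comap] at this
    obtain ⟨ρ, hρ⟩ := (this.and (eventually_gt_atTop 0)).exists_forall_of_atTop
    exact ⟨ρ, fun y hy => (hρ ‖y‖ hy.le).1 y rfl⟩
  have hzρ : z ∈ closedBall (0:ℂ) ρ := by
    rw [mem_closedBall_zero_iff]; by_contra! h; linarith [hρ z h]
  have hlsc : LowerSemicontinuousOn V (closedBall (0:ℂ) ρ) := by
    apply LowerSemicontinuous.lowerSemicontinuousOn
    rw [lowerSemicontinuous_iff_isOpen_preimage]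
    intro y; exact lsc_closed hl y
  obtain ⟨z1, hz1, hmin⟩ := hlsc.exists_isMinOn ⟨z, hzρ⟩ (isCompact_closedBall 0 ρ)
  have hz1z : V z1 ≤ V z := hmin hzρ
  have hall : ∀ y, V z1 ≤ V y := by
    intro y
    by_cases hy : y ∈ closedBall (0:ℂ) ρ
    · exact hmin hy
    · rw [mem_closedBall_zero_iff] at hy; push Not at hy; linarith [hρ y hy]
  have hop : IsOpen {y | V y = V z1} := by
    rw [isOpen_iff_mem_nhds]
    intro y hy
    have hy' : V y = V z1 := hy
    have hyΓ : y ∉ Γ := fun h => by linarith [hc y h]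
    filter_upwards [(hloc y hyΓ).min (Eventually.of_forall fun x => by rw [hy']; exact hall x)] with x hx
    exact hx.trans hy'
  have hcl : IsClosed {y | V y = V z1} := by
    have : {y | V y = V z1} = {y | V z1 < V y}ᶜ := by
      ext y; simp only [mem_ofPred_eq, mem_compl_iff, not_lt]
      exact ⟨fun h => h.le, fun h => le_antisymm h (hall y)⟩
    rw [this]; exact (lsc_closed hl _).isClosed_compl
  have huniv : {y | V y = V z1} = univ := IsClopen.eq_univ ⟨hcl, hop⟩ ⟨z1, rfl⟩
  obtain ⟨g, hg⟩ := hne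
  have : g ∈ {y | V y = V z1} := huniv ▸ mem_univ g
  have h2 : V g = V z1 := this
  linarith [hc g hg]

lemma min_strict {V : ℂ → ℝ} {U : Set ℂ} (hU : IsOpen U) (hUc : IsPreconnected U) (hUi : U ∈ cobounded ℂ)
    (hl : ∀ b, ∀ η > 0, ∀ᶠ z in 𝓝 b, V b - η < V z) (hinf : Tendsto V (cobounded ℂ) atTop)
    (hloc : ∀ z ∈ U, LocRe V z) {c : ℝ} (hc : ∀ z, c ≤ V z) {z : ℂ} (hz : z ∈ U) : c < V z := by
  by_contra! hzc
  have hop : IsOpen (U ∩ {y | V y = c}) := by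
    rw [isOpen_iff_mem_nhds]
    intro y hy
    have hy' : V y = c := hy.2
    filter_upwards [(hloc y hy.1).min (Eventually.of_forall fun x => by rw [hy']; exact hc x),
      hU.mem_nhds hy.1] with x hx hxU
    exact ⟨hxU, hx.trans hy'⟩
  obtain ⟨y, hy, hyU⟩ := ((hinf.eventually_gt_atTop c).and hUi).exists
  obtain ⟨x, hx, hx1, hx2⟩ := hUc _ _ hop (lsc_closed hl c)
    (fun x hx => by
      rcases (hc x).eq_or_lt with h | h
      · exact Or.inl ⟨hx, h.symm⟩
      · exact Or.inr h)
    ⟨z, hz, hz, le_antisymm hzc (hc z)⟩ ⟨y, hyU, hy⟩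
  have h1 : V x = c := hx1.2
  have h2 : c < V x := hx2
  linarith

variable {B : SmoothBoundary K} {T : ℂ → ℂ} {C : ℝ}

/-- difference of potentials, local representation -/
lemma dpot_loc {ν μ : Measure ℂ} [IsFiniteMeasure ν] [IsFiniteMeasure μ] (hK : IsCompact K)
    (hν : ∀ᵐ w ∂ν, w ∈ frontier K) (hμ : ∀ᵐ w ∂μ, w ∈ frontier K)
    {z0 : ℂ} {r : ℝ} (hr : 0 < r) (hb : ∀ w ∈ frontier K, r ≤ ‖w - z0‖) :
    ∃ F : ℂ → ℂ, ∀ z ∈ ball z0 r, HasDerivAt F (∫ w, (w - z)⁻¹ ∂μ - ∫ w, (w - z)⁻¹ ∂ν) z ∧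
      pot ν z - pot μ z = (pot ν z0 - pot μ z0) + (F z).re := by
  obtain ⟨F, hF⟩ := pot_loc hK hν hr hb
  obtain ⟨G, hG⟩ := pot_loc hK hμ hr hb
  refine ⟨fun z => F z - G z, fun z hz => ⟨?_, ?_⟩⟩
  · have e := (hF z hz).1.sub (hG z hz).1
    rw [neg_sub_neg] at e
    exact e
  · rw [(hF z hz).2, (hG z hz).2, sub_re]; ring

lemma dpot_locRe {ν μ : Measure ℂ} [IsFiniteMeasure ν] [IsFiniteMeasure μ] (hK : IsCompact K)
    (hν : ∀ᵐ w ∂ν, w ∈ frontier K) (hμ : ∀ᵐ w ∂μ, w ∈ frontier K)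
    {z0 : ℂ} (hz0 : z0 ∉ frontier K) : LocRe (fun z => pot ν z - pot μ z) z0 := by
  obtain ⟨r, hr, hb⟩ := front_dist hz0
  obtain ⟨F, hF⟩ := dpot_loc hK hν hμ hr hb
  exact ⟨r, hr, F, fun z hz => (hF z hz).1.differentiableAt.differentiableWithinAt, fun z hz => (hF z hz).2⟩

lemma ball_front {z0 : ℂ} {r : ℝ} {U : Set ℂ} (hU : Disjoint U (frontier K)) (hb : ball z0 r ⊆ U) :
    ∀ w ∈ frontier K, r ≤ ‖w - z0‖ := by
  intro w hw
  by_contra! h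
  exact hU.ne_of_mem (hb (mem_ball_iff_norm.2 h)) hw rfl

lemma int_disj_front : Disjoint (interior K) (frontier K) := disjoint_interior_frontier

lemma dpot_const {ν μ : Measure ℂ} [IsFiniteMeasure ν] [IsFiniteMeasure μ] (hK : IsCompact K)
    (hν : ∀ᵐ w ∂ν, w ∈ frontier K) (hμ : ∀ᵐ w ∂μ, w ∈ frontier K)
    (hcau : ∀ z ∈ interior K, ∫ w, (w - z)⁻¹ ∂ν = ∫ w, (w - z)⁻¹ ∂μ)
    {z0 : ℂ} {r : ℝ} (hr : 0 < r) (hb : ball z0 r ⊆ interior K) {z : ℂ} (hz : z ∈ ball z0 r) :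
    pot ν z - pot μ z = pot ν z0 - pot μ z0 := by
  obtain ⟨F, hF⟩ := dpot_loc hK hν hμ hr (ball_front int_disj_front hb)
  have h0 : ∀ y ∈ ball z0 r, HasDerivAt F 0 y := by
    intro y hy
    have := (hF y hy).1
    rwa [hcau y (hb hy), sub_self] at this
  have hc : F z = F z0 := isOpen_ball.is_const_of_deriv_eq_zero (convex_ball z0 r).isPreconnected
    (fun y hy => (h0 y hy).differentiableAt.differentiableWithinAt) (fun y hy => (h0 y hy).deriv) hz (mem_ball_self hr)
  have h1 := (hF z hz).2
  have h2 := (hF z0 (mem_ball_self hr)).2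
  rw [hc] at h1; linarith
end

section
open scoped ENNReal NNReal Real ComplexConjugate
variable {K : Set ℂ} {B : SmoothBoundary K} {T : ℂ → ℂ} {C : ℝ}

lemma Geo.dpot_bd (h : Geo B T C) {ν μ : Measure ℂ} [IsFiniteMeasure ν] [IsFiniteMeasure μ] (hK : IsCompact K)
    (hconn : IsConnected Kᶜ) (hν : ∀ᵐ w ∂ν, w ∈ frontier K) (hμ : ∀ᵐ w ∂μ, w ∈ frontier K)
    (hcau : ∀ z ∈ interior K, ∫ w, (w - z)⁻¹ ∂ν = ∫ w, (w - z)⁻¹ ∂μ)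
    {b : ℂ} (hb : b ∈ frontier K) (hz : ∀ᵐ w ∂ν, w ≠ b) (hi : Integrable (fun w => Real.log ‖w - b‖) ν)
    {t0 : ℝ} (ht0 : 0 < t0) (ht0' : t0 * (4 * C) ≤ 1) :
    (∀ᵐ w ∂μ, w ≠ b) ∧ Integrable (fun w => Real.log ‖w - b‖) μ ∧
      ∀ t, 0 < t → t ≤ t0 → pot ν (nr T b t) - pot μ (nr T b t) = pot ν b - pot μ b := by
  have hside := (h.side hK hconn hb ht0 ht0').1
  have hc : ∀ t, 0 < t → t ≤ t0 → pot ν (nr T b t) - pot μ (nr T b t) =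
      pot ν (nr T b t0) - pot μ (nr T b t0) := fun t ht htt =>
    dpot_const hK hν hμ hcau ht0 hside (h.nr_mem_ball hb ht htt).1
  obtain ⟨h1, h2, h3⟩ := h.pot_bdry hK hν hμ hb hz hi ht0 ht0' hc (fun t ht htt hf =>
    int_disj_front.ne_of_mem (hside (h.nr_mem_ball hb ht htt).1) hf rfl)
  exact ⟨h1, h2, fun t ht htt => by rw [hc t ht htt, h3]⟩

lemma Geo.dpot_curve (h : Geo B T C) {ν μ : Measure ℂ} [IsFiniteMeasure ν] [IsFiniteMeasure μ] (hK : IsCompact K)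
    (hconn : IsConnected Kᶜ) (hν : ∀ᵐ w ∂ν, w ∈ frontier K) (hμ : ∀ᵐ w ∂μ, w ∈ frontier K)
    (hcau : ∀ z ∈ interior K, ∫ w, (w - z)⁻¹ ∂ν = ∫ w, (w - z)⁻¹ ∂μ)
    (hz : ∀ z, ∀ᵐ w ∂ν, w ≠ z) (hi : ∀ z, Integrable (fun w => Real.log ‖w - z‖) ν) (i : Fin B.n) (u v : ℝ) :
    pot ν (B.curve i u) - pot μ (B.curve i u) = pot ν (B.curve i v) - pot μ (B.curve i v) := by
  have hC := h.Cpos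
  obtain ⟨t0, ht0, ht0'⟩ : ∃ t0 : ℝ, 0 < t0 ∧ t0 * (4 * C) ≤ 1 := ⟨1 / (4 * C), by positivity, by field_simp; rfl⟩
  have hbd := fun u => (h.dpot_bd hK hconn hν hμ hcau (curve_mem B i u) (hz _) (hi _) ht0 ht0').2.2 t0 ht0 le_rfl
  have hcont : Continuous (fun u => nr T (B.curve i u) t0) := by
    unfold nr
    have h1 : Continuous (B.curve i) := (B.smooth i).continuous
    have h2 := h.contTg
    fun_prop
  have hloc : IsLocallyConstant (fun u => pot ν (B.curve i u) - pot μ (B.curve i u)) := by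
    rw [IsLocallyConstant.iff_eventually_eq]
    intro x
    filter_upwards [hcont.continuousAt.preimage_mem_nhds (ball_mem_nhds (nr T (B.curve i x) t0) ht0)] with y hy
    rw [← hbd y, ← hbd x]
    exact dpot_const hK hν hμ hcau ht0 (h.side hK hconn (curve_mem B i x) ht0 ht0').1 hy
  exact hloc.apply_eq_of_preconnectedSpace u v

/-- second difference kernel -/
def ker2 (T : ℂ → ℂ) (b : ℂ) (t : ℝ) (w : ℂ) : ℝ :=
  Real.log ‖w - nr T b t‖ + Real.log ‖w - nr T b (-t)‖ - 2 * Real.log ‖w - b‖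

lemma Geo.ker2_eq (h : Geo B T C) {b w : ℂ} (hb : b ∈ frontier K) (hw : w ∈ frontier K) (hwb : w ≠ b) {t : ℝ}
    (ht : 0 < t) (ht' : t * (4 * C) ≤ 1) :
    0 < ‖((w - b) * conj (T b)) ^ 2 + (t:ℂ) ^ 2‖ ∧
    ker2 T b t w = Real.log ‖((w - b) * conj (T b)) ^ 2 + (t:ℂ) ^ 2‖ - Real.log (‖w - b‖ ^ 2) := by
  have h1 : w - nr T b t ≠ 0 := by
    intro h0; exact h.nr_off hb ht.ne' (by rwa [abs_of_pos ht]) (by rwa [← sub_eq_zero.1 h0])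
  have h2 : w - nr T b (-t) ≠ 0 := by
    intro h0
    exact h.nr_off hb (t := -t) (by linarith) (by rwa [abs_neg, abs_of_pos ht]) (by rwa [← sub_eq_zero.1 h0])
  have hTT := h.T_conj hb
  have e : ((w - b) * conj (T b)) ^ 2 + (t:ℂ) ^ 2 = (w - nr T b t) * (w - nr T b (-t)) * conj (T b) ^ 2 := by
    unfold nr; push_cast
    linear_combination (-(t:ℂ) ^ 2 * (T b * conj (T b) + 1)) * hTT + (t:ℂ)^2 * (T b * conj (T b))^2 * I_sq
  have en : ‖((w - b) * conj (T b)) ^ 2 + (t:ℂ) ^ 2‖ = ‖w - nr T b t‖ * ‖w - nr T b (-t)‖ := by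
    rw [e, norm_mul, norm_mul, norm_pow, RCLike.norm_conj, h.norm_T hb]; ring
  have p1 := norm_pos_iff.2 h1
  have p2 := norm_pos_iff.2 h2
  refine ⟨by rw [en]; positivity, ?_⟩
  rw [en, Real.log_mul p1.ne' p2.ne', Real.log_pow]; unfold ker2; push_cast; ring

lemma Geo.ker2_le (h : Geo B T C) {b w : ℂ} (hb : b ∈ frontier K) (hw : w ∈ frontier K) (hwb : w ≠ b) {t : ℝ}
    (ht : 0 < t) (ht' : t * (4 * C) ≤ 1) :
    ker2 T b t w ≤ Real.log (1 + t ^ 2 / ‖w - b‖ ^ 2) := by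
  obtain ⟨h1, h2⟩ := h.ker2_eq hb hw hwb ht ht'
  have p : 0 < ‖w - b‖ := norm_pos_iff.2 (sub_ne_zero.2 hwb)
  rw [h2, sub_le_iff_le_add, ← Real.log_mul (by positivity) (by positivity)]
  apply Real.log_le_log h1
  refine (norm_add_le _ _).trans ?_
  rw [norm_pow, norm_mul, RCLike.norm_conj, h.norm_T hb, norm_pow, Complex.norm_real, Real.norm_of_nonneg ht.le]
  field_simp; linarith

lemma Geo.ker2_ge (h : Geo B T C) {b w : ℂ} (hb : b ∈ frontier K) (hw : w ∈ frontier K) (hwb : w ≠ b) {t δ : ℝ}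
    (ht : 0 < t) (ht' : t * (4 * C) ≤ 1) (hδ : 0 < δ) (hδ' : δ * (2 * C) ≤ 1) (htδ : 2 * t ^ 2 ≤ δ ^ 2) :
    -(2 * (t ^ 2 / δ ^ 2)) ≤ ker2 T b t w := by
  obtain ⟨h1, h2⟩ := h.ker2_eq hb hw hwb ht ht'
  have p : 0 < ‖w - b‖ := norm_pos_iff.2 (sub_ne_zero.2 hwb)
  have hC := h.Cpos
  have hq := h.quad w hw b hb
  obtain ⟨q, hqd⟩ : ∃ q, q = (w - b) * conj (T b) := ⟨_, rfl⟩
  rw [← hqd] at h1 h2 hq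
  have hqn : ‖q‖ = ‖w - b‖ := by rw [hqd, norm_mul, RCLike.norm_conj, h.norm_T hb, mul_one]
  rw [h2]
  by_cases hx : ‖w - b‖ ≤ δ
  · have hpos : 0 ≤ Real.log ‖q ^ 2 + (t:ℂ) ^ 2‖ - Real.log (‖w - b‖ ^ 2) := by
      rw [sub_nonneg]
      apply Real.log_le_log (by positivity)
      rw [← abs_of_nonneg (norm_nonneg (q ^ 2 + (t:ℂ) ^ 2)), ← abs_of_nonneg (sq_nonneg ‖w - b‖)]
      apply sq_le_sq.1
      have hn : ‖w - b‖ ^ 2 = q.re ^ 2 + q.im ^ 2 := by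
        rw [← hqn, ← Complex.normSq_eq_norm_sq, Complex.normSq_apply]; ring
      have him : |q.im| ≤ ‖w - b‖ / 2 := by
        refine hq.trans ?_
        have : ‖w - b‖ * (2 * C) ≤ 1 := le_trans (by gcongr) hδ'
        nlinarith
      have him2 : q.im ^ 2 ≤ ‖w - b‖ ^ 2 / 4 := by
        rw [← sq_abs]; nlinarith [abs_nonneg q.im]
      have hre : q.im ^ 2 ≤ q.re ^ 2 := by nlinarith [sq_nonneg q.re, sq_nonneg q.im]
      have e : ‖q ^ 2 + (t:ℂ) ^ 2‖ ^ 2 = (q.re ^ 2 + q.im ^ 2) ^ 2 + 2 * t ^ 2 * (q.re ^ 2 - q.im ^ 2) + (t^2)^2 := by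
        rw [← Complex.normSq_eq_norm_sq, Complex.normSq_apply]
        simp [sq]; ring
      rw [e, hn]
      have : 0 ≤ t ^ 2 * (q.re ^ 2 - q.im ^ 2) := mul_nonneg (sq_nonneg t) (by linarith)
      nlinarith [sq_nonneg (t ^ 2)]
    have : 0 ≤ t ^ 2 / δ ^ 2 := by positivity
    linarith
  · push Not at hx
    have hy : t ^ 2 / ‖w - b‖ ^ 2 ≤ t ^ 2 / δ ^ 2 := by gcongr
    obtain ⟨y, hyd⟩ : ∃ y, y = t ^ 2 / ‖w - b‖ ^ 2 := ⟨_, rfl⟩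
    have hy2 : t ^ 2 / δ ^ 2 ≤ 1 / 2 := by rw [div_le_div_iff₀ (by positivity) two_pos]; linarith
    have hy0 : 0 ≤ y := by rw [hyd]; positivity
    rw [← hyd] at hy
    have h3 : ‖w - b‖ ^ 2 * (1 - y) ≤ ‖q ^ 2 + (t:ℂ) ^ 2‖ := by
      have := norm_sub_norm_le (q ^ 2) (-(t:ℂ) ^ 2)
      rw [sub_neg_eq_add, norm_neg, norm_pow, hqn, norm_pow, Complex.norm_real, Real.norm_of_nonneg ht.le] at this
      refine le_trans (le_of_eq ?_) this
      rw [hyd]; field_simp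
    have h1y : 0 < 1 - y := by linarith
    have h4 := Real.log_le_log (by positivity) h3
    rw [Real.log_mul (by positivity) h1y.ne'] at h4
    have h5 := Real.one_sub_inv_le_log_of_pos h1y
    have h6 : -(2 * y) ≤ 1 - (1 - y)⁻¹ := by
      have : (1 - y)⁻¹ ≤ 1 + 2 * y := by
        rw [inv_le_iff_one_le_mul₀ h1y]; nlinarith
      linarith
    linarith
end

section
open scoped ENNReal NNReal Real ComplexConjugate
variable {K : Set ℂ} {B : SmoothBoundary K} {T : ℂ → ℂ} {C : ℝ}

lemma compl_disj_front (hK : IsCompact K) : Disjoint Kᶜ (frontier K) :=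
  disjoint_compl_left.mono_right hK.isClosed.frontier_subset

lemma dpot_inf {ν μ : Measure ℂ} [IsFiniteMeasure ν] [IsFiniteMeasure μ] (hK : IsCompact K)
    (hν : ∀ᵐ w ∂ν, w ∈ frontier K) (hμ : ∀ᵐ w ∂μ, w ∈ frontier K) (hmass : μ.real univ < ν.real univ) :
    Tendsto (fun z => pot ν z - pot μ z) (cobounded ℂ) atTop := by
  have h1 : Tendsto (fun z : ℂ => (ν.real univ - μ.real univ) * Real.log ‖z‖ -
      (ν.real univ * Real.log 2 + μ.real univ * Real.log 2)) (cobounded ℂ) atTop := by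
    apply tendsto_atTop_add_const_right
    exact (Real.tendsto_log_atTop.comp tendsto_norm_cobounded_atTop).const_mul_atTop (by linarith)
  refine tendsto_atTop_mono' _ ?_ h1
  filter_upwards [pot_inf hK hν, pot_inf hK hμ] with z h2 h3
  rw [abs_le] at h2 h3
  linarith [h2.1, h3.2]

lemma Geo.harnack_lin (h : Geo B T C) {ν μ : Measure ℂ} [IsFiniteMeasure ν] [IsFiniteMeasure μ] (hK : IsCompact K)
    (hconn : IsConnected Kᶜ) (hν : ∀ᵐ w ∂ν, w ∈ frontier K) (hμ : ∀ᵐ w ∂μ, w ∈ frontier K)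
    {b : ℂ} (hb : b ∈ frontier K) {t0 c : ℝ} (ht0 : 0 < t0) (ht0' : t0 * (4 * C) ≤ 1)
    (hpos : ∀ z ∈ Kᶜ, c < pot ν z - pot μ z) :
    ∃ c1 > 0, ∀ t, 0 < t → t ≤ t0 → c1 * t ≤ pot ν (nr T b (-t)) - pot μ (nr T b (-t)) - c := by
  have hside := (h.side hK hconn hb ht0 ht0').2
  obtain ⟨z0, hz0⟩ : ∃ z0, z0 = nr T b (-t0) := ⟨_, rfl⟩
  rw [← hz0] at hside
  obtain ⟨F, hF⟩ := dpot_loc hK hν hμ ht0 (ball_front (compl_disj_front hK) hside)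
  have hm0 := mem_ball_self (x := z0) ht0
  have hv0 := hpos z0 (hside hm0)
  refine ⟨(pot ν z0 - pot μ z0 - c) / (2 * t0), div_pos (by linarith) (by linarith), fun t ht htt => ?_⟩
  obtain ⟨z, hz⟩ : ∃ z, z = nr T b (-t) := ⟨_, rfl⟩
  have hzm : z ∈ ball z0 t0 := by rw [hz, hz0]; exact (h.nr_mem_ball hb ht htt).2
  have hre : ∀ y ∈ ball z0 t0, (F y + ((pot ν z0 - pot μ z0 - c : ℝ) : ℂ)).re = pot ν y - pot μ y - c := by
    intro y hy
    rw [add_re, ofReal_re, (hF y hy).2]; ring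
  have hH := harnack (H := fun y => F y + ((pot ν z0 - pot μ z0 - c : ℝ) : ℂ)) (z0 := z0) (r := t0)
    (fun y hy => ((hF y hy).1.differentiableAt.add_const _).differentiableWithinAt)
    (fun y hy => by
      show 0 < (F y + ((pot ν z0 - pot μ z0 - c : ℝ) : ℂ)).re
      rw [hre y hy]; linarith [hpos y (hside hy)]) hzm
  simp only [hre z hzm, hre z0 hm0] at hH
  have hn : ‖z - z0‖ = t0 - t := by
    rw [hz, hz0, nr, nr, show b + ((-t : ℝ) : ℂ) * I * T b - (b + ((-t0 : ℝ) : ℂ) * I * T b) = ((t0 - t : ℝ) : ℂ) * I * T b by push_cast; ring,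
      norm_mul, norm_mul, norm_I, h.norm_T hb, mul_one, mul_one, Complex.norm_real, Real.norm_of_nonneg (by linarith)]
  rw [hn] at hH
  rw [← hz]
  have hvz := hpos z (hside hzm)
  have e1 : 1 - (t0 - t) / t0 = t / t0 := by field_simp; ring
  have e2 : 1 + (t0 - t) / t0 ≤ 2 := by
    have : (t0 - t) / t0 ≤ 1 := by rw [div_le_one ht0]; linarith
    linarith
  rw [e1] at hH
  have h3 : (pot ν z - pot μ z - c) * (1 + (t0 - t) / t0) ≤ (pot ν z - pot μ z - c) * 2 :=
    mul_le_mul_of_nonneg_left e2 (by linarith)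
  have h4 : (pot ν z0 - pot μ z0 - c) / (2 * t0) * t = (pot ν z0 - pot μ z0 - c) * (t / t0) / 2 := by field_simp
  rw [h4]; linarith

lemma Geo.ker2_int (h : Geo B T C) {ν : Measure ℂ} [IsFiniteMeasure ν] (hK : IsCompact K)
    (hν : ∀ᵐ w ∂ν, w ∈ frontier K) {b : ℂ} (hb : b ∈ frontier K)
    (hi : Integrable (fun w => Real.log ‖w - b‖) ν) {t : ℝ} (ht : 0 < t) (ht' : t * (4 * C) ≤ 1) :
    Integrable (ker2 T b t) ν ∧
    ∫ w, ker2 T b t w ∂ν = pot ν (nr T b t) + pot ν (nr T b (-t)) - 2 * pot ν b := by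
  have i1 := log_int_off hK hν (h.nr_off hb ht.ne' (by rwa [abs_of_pos ht]))
  have i2 := log_int_off hK hν (h.nr_off hb (t := -t) (by linarith) (by rwa [abs_neg, abs_of_pos ht]))
  refine ⟨(i1.add i2).sub (hi.const_mul 2), ?_⟩
  have e1 := integral_sub (f := fun w => Real.log ‖w - nr T b t‖ + Real.log ‖w - nr T b (-t)‖)
    (g := fun w => 2 * Real.log ‖w - b‖) (i1.add i2) (hi.const_mul 2)
  have e2 := integral_add (f := fun w => Real.log ‖w - nr T b t‖) (g := fun w => Real.log ‖w - nr T b (-t)‖) i1 i2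
  rw [e2, integral_const_mul] at e1
  exact e1

lemma Geo.no_dual (h : Geo B T C) {ν μ : Measure ℂ} [IsFiniteMeasure ν] [IsFiniteMeasure μ] (hK : IsCompact K)
    (hconn : IsConnected Kᶜ) (hν : ∀ᵐ w ∂ν, w ∈ frontier K) (hμ : ∀ᵐ w ∂μ, w ∈ frontier K)
    (hmass : μ.real univ < ν.real univ)
    (hcau : ∀ z ∈ interior K, ∫ w, (w - z)⁻¹ ∂ν = ∫ w, (w - z)⁻¹ ∂μ)
    (hz : ∀ z, ∀ᵐ w ∂ν, w ≠ z) {D : ℝ} (hD0 : 0 < D)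
    (hD : ∀ z : ℂ, ∀ r > 0, ∫⁻ w, ENNReal.ofReal (Real.posLog (r / ‖w - z‖)) ∂ν ≤ ENNReal.ofReal (D * r))
    (hflat : ∀ i, ∃ u, ∀ η > 0, ∃ δ > 0, ∀ t > 0,
      ∫⁻ w in ball (B.curve i u) δ, ENNReal.ofReal (Real.log (1 + t ^ 2 / ‖w - B.curve i u‖ ^ 2)) ∂ν ≤
        ENNReal.ofReal (η * t)) : False := by
  have hC := h.Cpos
  obtain ⟨t0, ht0, ht0'⟩ : ∃ t0 : ℝ, 0 < t0 ∧ t0 * (4 * C) ≤ 1 := ⟨1 / (4 * C), by positivity, by field_simp; rfl⟩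
  have hi : ∀ z, Integrable (fun w => Real.log ‖w - z‖) ν := fun z =>
    log_int_of hK hν (hz z) (hD z 1 one_pos)
  have hbd := fun (b : ℂ) (hb : b ∈ frontier K) => h.dpot_bd hK hconn hν hμ hcau hb (hz b) (hi b) ht0 ht0'
  have hzμ : ∀ z, ∀ᵐ w ∂μ, w ≠ z := by
    intro z
    by_cases hzf : z ∈ frontier K
    · exact (hbd z hzf).1
    · filter_upwards [hμ] with w hw hwz
      exact hzf (hwz ▸ hw)
  have hiμ : ∀ z, Integrable (fun w => Real.log ‖w - z‖) μ := by
    intro z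
    by_cases hzf : z ∈ frontier K
    · exact (hbd z hzf).2.1
    · exact log_int_off hK hμ hzf
  choose u hu using hflat
  have : Nonempty (Fin B.n) := ⟨⟨0, B.npos⟩⟩
  obtain ⟨i0, hi0⟩ := Finite.exists_min (fun i => pot ν (B.curve i (u i)) - pot μ (B.curve i (u i)))
  obtain ⟨b, hbd0⟩ : ∃ b, b = B.curve i0 (u i0) := ⟨_, rfl⟩
  have hb : b ∈ frontier K := hbd0 ▸ curve_mem B i0 (u i0)
  obtain ⟨c, hc⟩ : ∃ c, c = pot ν b - pot μ b := ⟨_, rfl⟩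
  have hflat := hu i0
  rw [← hbd0] at hflat
  simp only [← hbd0, ← hc] at hi0
  have hΓ : ∀ z ∈ frontier K, c ≤ pot ν z - pot μ z := by
    intro z hzf
    obtain ⟨i, v, rfl⟩ := mem_front B hzf
    rw [h.dpot_curve hK hconn hν hμ hcau hz hi i v (u i)]
    exact hi0 i
  have hl : ∀ b, ∀ η > 0, ∀ᶠ z in 𝓝 b, (pot ν b - pot μ b) - η < pot ν z - pot μ z := by
    intro b η hη
    filter_upwards [pot_lsc hK hν hz hD0 hD b (half_pos hη), pot_usc hK hμ hzμ hiμ b (half_pos hη)] with z h1 h2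
    linarith
  have hinf := dpot_inf hK hν hμ hmass
  have hmin := min_princ ⟨b, hb⟩ hl hinf (fun z hz => dpot_locRe hK hν hμ hz) hΓ
  have hstr : ∀ z ∈ Kᶜ, c < pot ν z - pot μ z := fun z hzK =>
    min_strict (V := fun z => pot ν z - pot μ z) hK.isClosed.isOpen_compl hconn.isPreconnected (compl_nhds_inf hK) hl hinf
      (fun y hy => dpot_locRe hK hν hμ (fun hf => (compl_disj_front hK).ne_of_mem hy hf rfl)) hmin hzK
  obtain ⟨c1, hc1, hlin⟩ := h.harnack_lin hK hconn hν hμ hb ht0 ht0' hstr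
  obtain ⟨δ', hδ', hfl'⟩ := hflat (c1 / 2) (half_pos hc1)
  obtain ⟨δ, hδ, hδC, hδδ⟩ : ∃ δ > 0, δ * (2 * C) ≤ 1 ∧ δ ≤ δ' := by
    refine ⟨min δ' (1 / (2 * C)), by positivity, ?_, min_le_left _ _⟩
    calc _ ≤ 1 / (2 * C) * (2 * C) := by gcongr; exact min_le_right _ _
      _ = 1 := by field_simp
  have hfl : ∀ t > 0, ∫⁻ w in ball b δ, ENNReal.ofReal (Real.log (1 + t ^ 2 / ‖w - b‖ ^ 2)) ∂ν ≤
        ENNReal.ofReal (c1 / 2 * t) := fun t ht =>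
    (lintegral_mono_set (ball_subset_ball hδδ)).trans (hfl' t ht)
  obtain ⟨M, hM⟩ : ∃ M, M = (ν.real univ + 2 * μ.real univ) / δ ^ 2 := ⟨_, rfl⟩
  have hM0 : 0 ≤ M := by rw [hM]; positivity
  -- main inequality
  have key : ∀ t, 0 < t → t ≤ t0 → 2 * t ^ 2 ≤ δ ^ 2 → c1 * t ≤ c1 / 2 * t + M * t ^ 2 := by
    intro t ht htt htδ
    have ht4 : t * (4 * C) ≤ 1 := le_trans (by gcongr) ht0'
    obtain ⟨kν, eν⟩ := h.ker2_int hK hν hb (hi b) ht ht4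
    obtain ⟨kμ, eμ⟩ := h.ker2_int hK hμ hb (hiμ b) ht ht4
    have h1 := (hbd b hb).2.2 t ht htt
    have h2 := hlin t ht htt
    have lμ : -(2 * (t ^ 2 / δ ^ 2)) * μ.real univ ≤ ∫ w, ker2 T b t w ∂μ := by
      have := integral_mono_ae (μ := μ) (integrable_const (-(2 * (t ^ 2 / δ ^ 2)))) kμ (by
        filter_upwards [hμ, hzμ b] with w hw hwb
        exact h.ker2_ge hb hw hwb ht ht4 hδ hδC htδ)
      rw [integral_const, smul_eq_mul, mul_comm] at this
      exact this
    have Lm : Measurable (fun w : ℂ => Real.log (1 + t ^ 2 / ‖w - b‖ ^ 2)) := by fun_prop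
    have L0 : ∀ w : ℂ, 0 ≤ Real.log (1 + t ^ 2 / ‖w - b‖ ^ 2) := fun w => by
      apply Real.log_nonneg
      have : 0 ≤ t ^ 2 / ‖w - b‖ ^ 2 := by positivity
      linarith
    have Li : IntegrableOn (fun w : ℂ => Real.log (1 + t ^ 2 / ‖w - b‖ ^ 2)) (ball b δ) ν := by
      refine ⟨Lm.aestronglyMeasurable, ?_⟩
      rw [hasFiniteIntegral_iff_ofReal (Eventually.of_forall L0)]
      exact (hfl t ht).trans_lt ENNReal.ofReal_lt_top
    have Lint : ∫ w in ball b δ, Real.log (1 + t ^ 2 / ‖w - b‖ ^ 2) ∂ν ≤ c1 / 2 * t := by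
      rw [integral_eq_lintegral_of_nonneg_ae (Eventually.of_forall L0) Lm.aestronglyMeasurable]
      exact ENNReal.toReal_le_of_le_ofReal (by positivity) (hfl t ht)
    have uν : ∫ w, ker2 T b t w ∂ν ≤ c1 / 2 * t + t ^ 2 / δ ^ 2 * ν.real univ := by
      have hInt := (Li.integrable_indicator measurableSet_ball).add (integrable_const (μ := ν) (t ^ 2 / δ ^ 2))
      refine (integral_mono_ae kν hInt ?_).trans ?_
      · filter_upwards [hν, hz b] with w hw hwb
        have hk := h.ker2_le hb hw hwb ht ht4
        by_cases hwδ : w ∈ ball b δ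
        · simp only [Pi.add_apply, indicator_of_mem hwδ]
          have : 0 ≤ t ^ 2 / δ ^ 2 := by positivity
          linarith
        · simp only [Pi.add_apply, indicator_of_notMem hwδ, zero_add]
          refine hk.trans ?_
          rw [mem_ball_iff_norm, not_lt] at hwδ
          have h5 : t ^ 2 / ‖w - b‖ ^ 2 ≤ t ^ 2 / δ ^ 2 := by gcongr
          have h6 : 0 ≤ t ^ 2 / ‖w - b‖ ^ 2 := by positivity
          have h7 := Real.log_le_sub_one_of_pos (x := 1 + t ^ 2 / ‖w - b‖ ^ 2) (by linarith)
          linarith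
      · have := integral_add (Li.integrable_indicator measurableSet_ball) (integrable_const (μ := ν) (t ^ 2 / δ ^ 2))
        simp only [Pi.add_apply] at this ⊢
        rw [this, integral_indicator measurableSet_ball, integral_const, smul_eq_mul, mul_comm (ν.real univ)]
        linarith
    have hMt : M * t ^ 2 = t ^ 2 / δ ^ 2 * ν.real univ + 2 * (t ^ 2 / δ ^ 2) * μ.real univ := by
      rw [hM]; field_simp
    rw [hMt]
    rw [eν] at uν
    rw [eμ] at lμ
    rw [hc] at h2
    linarith
  obtain ⟨t, ht, htt, htδ, htM⟩ : ∃ t, 0 < t ∧ t ≤ t0 ∧ t ≤ δ / 2 ∧ t * (4 * (M + 1)) ≤ c1 := by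
    refine ⟨min t0 (min (δ / 2) (c1 / (4 * (M + 1)))), by positivity, min_le_left _ _,
      (min_le_right _ _).trans (min_le_left _ _), ?_⟩
    calc _ ≤ c1 / (4 * (M + 1)) * (4 * (M + 1)) := by
          gcongr; exact (min_le_right _ _).trans (min_le_right _ _)
      _ = c1 := by field_simp
  have := key t ht htt (by nlinarith)
  have h8 : M * t ^ 2 ≤ c1 / 4 * t := by
    have : t * M * 4 ≤ c1 := by nlinarith
    nlinarith
  have : 0 < c1 * t := by positivity
  linarith
end

section
open scoped ENNReal NNReal Real ComplexConjugate
variable {K : Set ℂ} {B : SmoothBoundary K} {T : ℂ → ℂ} {C : ℝ}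

lemma wd_le {σ : Measure ℂ} {q : ℂ → ℝ} (hq : Measurable q) {A : Set ℂ} (hA : MeasurableSet A) {M : ℝ}
    (hM : ∀ w ∈ A, q w ≤ M) {f : ℂ → ℝ≥0∞} (hf : Measurable f) :
    ∫⁻ w in A, f w ∂(σ.withDensity fun w => ENNReal.ofReal (q w)) ≤ ENNReal.ofReal M * ∫⁻ w, f w ∂σ := by
  rw [restrict_withDensity hA, lintegral_withDensity_eq_lintegral_mul _ hq.ennreal_ofReal hf,
    ← lintegral_const_mul _ hf]
  refine le_trans ?_ (setLIntegral_le_lintegral A _)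
  refine setLIntegral_mono (hf.const_mul _) fun w hw => ?_
  simp only [Pi.mul_apply]
  gcongr
  exact hM w hw

lemma log_one_add_sq {t x : ℝ} (ht : 0 < t) (hx : 0 < x) :
    Real.log (1 + t ^ 2 / x ^ 2) ≤ t * (2 * t / (x ^ 2 + t ^ 2)) + 2 * Real.posLog (t / x) := by
  have h0 : 0 < t ^ 2 / x ^ 2 := by positivity
  have hpl := Real.posLog_nonneg (x := t / x)
  by_cases htx : t ≤ x
  · have h1 := Real.log_le_sub_one_of_pos (x := 1 + t ^ 2 / x ^ 2) (by positivity)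
    have h2 : t ^ 2 / x ^ 2 ≤ t * (2 * t / (x ^ 2 + t ^ 2)) := by
      rw [← mul_div_assoc, div_le_div_iff₀ (by positivity) (by positivity)]
      have : t ^ 2 ≤ x ^ 2 := by gcongr
      nlinarith [sq_nonneg t, sq_nonneg x]
    linarith
  · push Not at htx
    have e : 1 + t ^ 2 / x ^ 2 = (t / x) ^ 2 * (1 + x ^ 2 / t ^ 2) := by field_simp; ring
    have h1x : 1 ≤ |t / x| := by rw [abs_of_pos (by positivity), one_le_div hx]; exact htx.le
    rw [e, Real.log_mul (by positivity) (by positivity), Real.log_pow, Real.posLog_eq_log h1x]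
    have h1 := Real.log_le_sub_one_of_pos (x := 1 + x ^ 2 / t ^ 2) (by positivity)
    have h3 : x ^ 2 ≤ t ^ 2 := by gcongr
    have h2 : x ^ 2 / t ^ 2 ≤ t * (2 * t / (x ^ 2 + t ^ 2)) := by
      rw [← mul_div_assoc, div_le_div_iff₀ (by positivity) (by positivity)]
      nlinarith [sq_nonneg t, sq_nonneg x]
    push_cast
    linarith

lemma sig_log2_bound (B : SmoothBoundary K) (hK : IsCompact K) : ∃ E : ℝ, 0 < E ∧ ∀ b ∈ frontier K, ∀ t > 0,
    ∫⁻ w, ENNReal.ofReal (Real.log (1 + t ^ 2 / ‖w - b‖ ^ 2)) ∂(sig B) ≤ ENNReal.ofReal (E * t) := by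
  obtain ⟨C1, hC1, h1⟩ := sig_poisson_bound B
  obtain ⟨C2, hC2, h2⟩ := sig_log_bound B hK
  refine ⟨C1 + 2 * C2, by positivity, fun b hb t ht => ?_⟩
  have hle : ∫⁻ w, ENNReal.ofReal (Real.log (1 + t ^ 2 / ‖w - b‖ ^ 2)) ∂(sig B) ≤
      ∫⁻ w, (ENNReal.ofReal t * ENNReal.ofReal (2 * t / (‖w - b‖ ^ 2 + t ^ 2)) +
        ENNReal.ofReal 2 * ENNReal.ofReal (Real.posLog (t / ‖w - b‖))) ∂(sig B) := by
    apply lintegral_mono_ae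
    filter_upwards [sig_noatom B b] with w hw
    have hp : 0 < ‖w - b‖ := norm_pos_iff.2 (sub_ne_zero.2 hw)
    rw [← ENNReal.ofReal_mul ht.le, ← ENNReal.ofReal_mul two_pos.le,
      ← ENNReal.ofReal_add (by positivity) (mul_nonneg two_pos.le Real.posLog_nonneg)]
    exact ENNReal.ofReal_le_ofReal (log_one_add_sq ht hp)
  refine hle.trans ?_
  have m1 : Measurable (fun w : ℂ => ENNReal.ofReal (2 * t / (‖w - b‖ ^ 2 + t ^ 2))) := by fun_prop
  have m2 : Measurable (fun w : ℂ => ENNReal.ofReal (Real.posLog (t / ‖w - b‖))) := by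
    apply Measurable.ennreal_ofReal
    exact posLog_meas.comp (by fun_prop)
  rw [lintegral_add_left (m1.const_mul _), lintegral_const_mul _ m1, lintegral_const_mul _ m2]
  calc _ ≤ ENNReal.ofReal t * ENNReal.ofReal C1 + ENNReal.ofReal 2 * ENNReal.ofReal (C2 * t) := by
        gcongr
        · exact h1 b hb t ht
        · exact h2 b t ht
    _ = _ := by
        rw [← ENNReal.ofReal_mul ht.le, ← ENNReal.ofReal_mul two_pos.le, ← ENNReal.ofReal_add (by positivity) (by positivity)]
        congr 1; ring

/-- the approximation by functions with nonnegative real part -/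
lemma Geo.exists_pos (h : Geo B T C) (hK : IsCompact K) (hconn : IsConnected Kᶜ) {S : Set ℂ}
    (hS : ∀ z ∈ interior K, ∃ s ∈ S, s ∈ connectedComponentIn (interior K) z) {s : ℂ → ℂ}
    (hs : ContinuousOn s (frontier K)) (hsT : ∀ w ∈ frontier K, s w ^ 2 * T w = ((‖s w‖ ^ 2 : ℝ) : ℂ))
    {ε : ℝ} (hε : 0 < ε) :
    ∃ R ∈ Rsp (S ∩ interior K), (∀ w ∈ frontier K, 0 ≤ (1 + R w).re) ∧
      (∫ w, (1 + R w) * ((‖s w‖ ^ 2 : ℝ) : ℂ) ∂(sig B)).re < ε := by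
  have hP : S ∩ interior K ⊆ interior K := inter_subset_right
  have hΓ := frontier_compact hK
  have hΓm : MeasurableSet (frontier K) := hΓ.measurableSet
  have hsn : ContinuousOn (fun w => ‖s w‖ ^ 2) (frontier K) := hs.norm.pow 2
  obtain ⟨q, hqd⟩ : ∃ q : ℂ → ℝ, q = (frontier K).indicator (fun w => ‖s w‖ ^ 2) := ⟨_, rfl⟩
  have hqΓ : ∀ w ∈ frontier K, q w = ‖s w‖ ^ 2 := fun w hw => by rw [hqd, indicator_of_mem hw]
  have hqn : ∀ w ∉ frontier K, q w = 0 := fun w hw => by rw [hqd, indicator_of_notMem hw]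
  have hq0 : ∀ w, 0 ≤ q w := fun w => by rw [hqd]; exact indicator_nonneg (fun _ _ => by positivity) w
  have hqm : Measurable q := by
    rw [hqd]
    classical
    have := hsn.measurable_piecewise (g := 0) continuousOn_const hΓm
    rwa [piecewise_eq_indicator] at this
  obtain ⟨M0, hM0⟩ := hΓ.exists_bound_of_continuousOn hsn
  obtain ⟨M, hM, hqM⟩ : ∃ M > 0, ∀ w, q w ≤ M := by
    refine ⟨max M0 1, by positivity, fun w => ?_⟩
    by_cases hw : w ∈ frontier K
    · rw [hqΓ w hw]
      exact (le_abs_self _).trans ((hM0 w hw).trans (le_max_left _ _))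
    · rw [hqn w hw]; positivity
  obtain ⟨ν, hνd⟩ : ∃ ν : Measure ℂ, ν = (sig B).withDensity (fun w => ENNReal.ofReal (q w)) := ⟨_, rfl⟩
  have hac : ν ≪ sig B := hνd ▸ withDensity_absolutelyContinuous _ _
  have hνΓ : ∀ᵐ w ∂ν, w ∈ frontier K := hac.ae_le (sig_ae_mem B)
  have hνz : ∀ z, ∀ᵐ w ∂ν, w ≠ z := fun z => hac.ae_le (sig_noatom B z)
  have hle : ∀ {f : ℂ → ℝ≥0∞}, Measurable f → ∫⁻ w, f w ∂ν ≤ ENNReal.ofReal M * ∫⁻ w, f w ∂(sig B) := by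
    intro f hf
    have := wd_le (σ := sig B) hqm MeasurableSet.univ (fun w _ => hqM w) hf
    rwa [Measure.restrict_univ, ← hνd] at this
  have hfin : IsFiniteMeasure ν := ⟨by
    have := hle (f := fun _ => 1) measurable_const
    rw [lintegral_one, lintegral_one] at this
    exact this.trans_lt (ENNReal.mul_lt_top ENNReal.ofReal_lt_top (measure_lt_top _ _))⟩
  have hν_int : ∀ f : ℂ → ℂ, ∫ w, f w ∂ν = ∫ w, f w * ((‖s w‖ ^ 2 : ℝ) : ℂ) ∂(sig B) := by
    intro f
    rw [hνd, integral_withDensity_eq_integral_toReal_smul hqm.ennreal_ofReal (Eventually.of_forall fun _ => ENNReal.ofReal_lt_top)]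
    apply integral_congr_ae
    filter_upwards [sig_ae_mem B] with w hw
    rw [ENNReal.toReal_ofReal (hq0 w), hqΓ w hw, Complex.real_smul, mul_comm]
  by_contra! hno
  obtain ⟨μ, hμf, hμΓ, hμm, hμR⟩ := exists_dual (P := S ∩ interior K) hK hP hνΓ hε (by
    intro R hR hpos
    have h1 := hno R hR hpos
    rw [← hν_int (fun w => 1 + R w)] at h1
    have hi : Integrable (fun w => 1 + R w) ν := fin_integrable hK hνΓ (continuousOn_const.add (rsp_cont hP hR))
    have h2 : ∫ w, (1 + R w).re ∂ν = (∫ w, (1 + R w) ∂ν).re := integral_re hi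
    rw [h2]; exact h1)
  have hcau : ∀ z ∈ interior K, ∫ w, (w - z)⁻¹ ∂ν = ∫ w, (w - z)⁻¹ ∂μ := by
    intro z hz
    have := cauchy_eq hS hνΓ hμΓ (y := fun _ => 1) (x := fun _ => 1) (integrable_const _) (integrable_const _) (by
      intro p hp k
      simp only [one_mul]
      exact (hμR _ (Submodule.subset_span ⟨p, hp, k, rfl⟩)).symm) hz
    simpa only [one_mul] using this
  obtain ⟨C2, hC2, hlog⟩ := sig_log_bound B hK
  obtain ⟨E, hE, hEb⟩ := sig_log2_bound B hK
  refine h.no_dual hK hconn hνΓ hμΓ (by linarith) hcau hνz (D := M * C2) (by positivity) ?_ ?_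
  · intro z r hr
    refine (hle ?_).trans ?_
    · apply Measurable.ennreal_ofReal
      exact posLog_meas.comp (by fun_prop)
    · rw [mul_assoc, ENNReal.ofReal_mul hM.le]
      gcongr
      exact hlog z r hr
  · intro i
    obtain ⟨u, hu⟩ := h.parity s hs hsT i
    refine ⟨u, fun η hη => ?_⟩
    obtain ⟨b, hb⟩ : ∃ b, b = B.curve i u := ⟨_, rfl⟩
    rw [← hb] at hu ⊢
    have hbΓ : b ∈ frontier K := hb ▸ curve_mem B i u
    have hcw := hsn b hbΓ
    have hev : ∀ᶠ w in 𝓝[frontier K] b, ‖s w‖ ^ 2 < η / E := by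
      apply hcw.eventually_lt_const
      show ‖s b‖ ^ 2 < η / E
      rw [hu, norm_zero, zero_pow two_ne_zero]; positivity
    rw [eventually_nhdsWithin_iff, Metric.eventually_nhds_iff_ball] at hev
    obtain ⟨δ, hδ, hδb⟩ := hev
    refine ⟨δ, hδ, fun t ht => ?_⟩
    have hm : Measurable (fun w : ℂ => ENNReal.ofReal (Real.log (1 + t ^ 2 / ‖w - b‖ ^ 2))) := by fun_prop
    have := wd_le (σ := sig B) hqm (measurableSet_ball (x := b) (ε := δ)) (M := η / E) (fun w hw => by
      by_cases hwΓ : w ∈ frontier K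
      · rw [hqΓ w hwΓ]; exact (hδb w hw hwΓ).le
      · rw [hqn w hwΓ]; positivity) hm
    rw [← hνd] at this
    refine this.trans ?_
    calc _ ≤ ENNReal.ofReal (η / E) * ENNReal.ofReal (E * t) := by gcongr; exact hEb b hbΓ t ht
      _ = _ := by rw [← ENNReal.ofReal_mul (by positivity)]; congr 1; field_simp
end

section
open scoped ENNReal NNReal Real ComplexConjugate
variable {K : Set ℂ} {B : SmoothBoundary K} {T : ℂ → ℂ} {C : ℝ}

lemma l2_pert {μ : Measure ℂ} {f g : ℂ → ℂ} (hf : MemLp f 2 μ) (hg : MemLp g 2 μ) {ε : ℝ} (hε : 0 < ε) :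
    ∃ ε₁ > 0, ∀ e : ℂ → ℂ, MemLp e 2 μ → ∫ w, ‖e w‖ ^ 2 ∂μ < ε₁ →
      ∫ w, ‖f w + e w‖ ^ 2 ∂μ ≤ ∫ w, ‖f w‖ ^ 2 ∂μ + ε ∧ ‖∫ w, e w * g w ∂μ‖ ≤ ε := by
  obtain ⟨A, hA⟩ : ∃ A, A = ∫ w, ‖f w‖ ^ 2 ∂μ := ⟨_, rfl⟩
  obtain ⟨D, hD⟩ : ∃ D, D = √(∫ w, ‖g w‖ ^ 2 ∂μ) := ⟨_, rfl⟩
  have hA0 : 0 ≤ A := hA ▸ integral_nonneg fun w => by positivity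
  have hD0 : 0 ≤ D := hD ▸ Real.sqrt_nonneg _
  obtain ⟨τ, hτ, hτA⟩ : ∃ τ > 0, τ * (2 * (A + 1)) = ε := ⟨ε / (2 * (A + 1)), by positivity, by field_simp⟩
  refine ⟨min (ε / (2 * (1 + τ⁻¹))) ((ε / (D + 1)) ^ 2), by positivity, fun e he hlt => ⟨?_, ?_⟩⟩
  · have h1 : ∀ w, ‖f w + e w‖ ^ 2 ≤ (1 + τ) * ‖f w‖ ^ 2 + (1 + τ⁻¹) * ‖e w‖ ^ 2 := by
      intro w
      have h2 : ‖f w + e w‖ ^ 2 ≤ (‖f w‖ + ‖e w‖) ^ 2 := by gcongr; exact norm_add_le _ _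
      have h3 : 0 ≤ τ⁻¹ * (τ * ‖f w‖ - ‖e w‖) ^ 2 := by positivity
      have h4 : τ⁻¹ * (τ * ‖f w‖ - ‖e w‖) ^ 2 = τ * ‖f w‖ ^ 2 - 2 * ‖f w‖ * ‖e w‖ + τ⁻¹ * ‖e w‖ ^ 2 := by
        field_simp; ring
      nlinarith
    have i1 := (l2_sq hf).const_mul (1 + τ)
    have i2 := (l2_sq he).const_mul (1 + τ⁻¹)
    have h5 := integral_mono (l2_sq (hf.add he)) (i1.add i2) h1
    have h6 := integral_add i1 i2
    simp only [Pi.add_apply] at h5 h6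
    rw [h6, integral_const_mul, integral_const_mul, ← hA] at h5
    have h7 : (1 + τ⁻¹) * ∫ w, ‖e w‖ ^ 2 ∂μ ≤ ε / 2 := by
      calc _ ≤ (1 + τ⁻¹) * (ε / (2 * (1 + τ⁻¹))) := by gcongr; exact hlt.le.trans (min_le_left _ _)
        _ = ε / 2 := by field_simp
    rw [← hA]
    nlinarith
  · refine (l2_cs he hg).trans ?_
    rw [← hD]
    have h2 : √(∫ w, ‖e w‖ ^ 2 ∂μ) ≤ ε / (D + 1) := by
      rw [Real.sqrt_le_left (by positivity)]
      exact hlt.le.trans (min_le_right _ _)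
    calc _ ≤ ε / (D + 1) * D := by gcongr
      _ ≤ ε / (D + 1) * (D + 1) := by gcongr; linarith
      _ = ε := by field_simp

lemma inf_fil (hK : IsCompact K) : cobounded ℂ ⊓ 𝓟 Kᶜ = cobounded ℂ :=
  inf_eq_left.2 (le_principal_iff.2 (compl_nhds_inf hK))

lemma good_zero (P : Set ℂ) : Good P 0 0 := ⟨⟨∅, finite_empty, empty_subset _, differentiableOn_const 0⟩, by simp⟩

lemma Geo.cap_bdd (h : Geo B T C) (hK : IsCompact K) (hconn : IsConnected Kᶜ) :
    BddAbove { r : ℝ | ∃ (f : ℂ → ℂ) (l w : ℂ), DifferentiableOn ℂ f Kᶜ ∧ (∀ z ∈ Kᶜ, ‖f z‖ ≤ 1) ∧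
    HasDerivAtInftyOn f Kᶜ l w ∧ r = ‖w‖ } := by
  refine ⟨(2 * π)⁻¹ * ∫ z, ‖1 + (0 : ℂ → ℂ) z‖ ^ 2 ∂(sig B), ?_⟩
  rintro r ⟨f, l, w, hf, hf1, hfi, rfl⟩
  have := h.upper hK hconn (P := ∅) (empty_subset _) (good_zero ∅) hf hf1 hfi
  rw [mul_zero, add_zero] at this
  rw [le_inv_mul_iff₀ (by positivity)]
  exact this

lemma Geo.cap_le (h : Geo B T C) (hK : IsCompact K) (hconn : IsConnected Kᶜ) {P : Set ℂ} (hP : P ⊆ interior K)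
    {R : ℂ → ℂ} {a : ℂ} (hR : Good P R a) :
    2 * π * analyticCapacity K ≤ ∫ z, ‖1 + R z‖ ^ 2 ∂(sig B) + 4 * π * ‖a‖ := by
  have hp : 0 < 2 * π := by positivity
  rw [← le_inv_mul_iff₀ hp]
  apply csSup_le
  · exact ⟨0, fun _ => 0, 0, 0, differentiableOn_const 0, by simp, ⟨tendsto_const_nhds, by simpa using tendsto_const_nhds⟩, by simp⟩
  · rintro r ⟨f, l, w, hf, hf1, hfi, rfl⟩
    rw [le_inv_mul_iff₀ hp]
    have h1 := h.upper hK hconn hP hR hf hf1 hfi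
    have hl : ‖l‖ ≤ 1 := by
      have := hfi.1
      rw [inf_fil hK] at this
      refine le_of_tendsto this.norm ?_
      filter_upwards [compl_nhds_inf hK] with z hz using hf1 z hz
    have h2 : ‖w‖ ≤ ‖w + 2 * l * a‖ + 2 * ‖a‖ := by
      have h3 := norm_sub_le (w + 2 * l * a) (2 * l * a)
      rw [add_sub_cancel_right, norm_mul, norm_mul, Complex.norm_ofNat] at h3
      have : ‖l‖ * ‖a‖ ≤ 1 * ‖a‖ := by gcongr
      linarith
    calc 2 * π * ‖w‖ ≤ 2 * π * (‖w + 2 * l * a‖ + 2 * ‖a‖) := by gcongr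
      _ ≤ _ := by linarith

lemma good_pos (hK : IsCompact K) {P : Set ℂ} (hP : P ⊆ interior K) {R : ℂ → ℂ} {a : ℂ} (hR : Good P R a)
    (hpos : ∀ w ∈ frontier K, 0 ≤ (1 + R w).re) {z : ℂ} (hz : z ∈ Kᶜ) : 0 ≤ (1 + R z).re := by
  have h0 := hR.tendsto_zero
  have hev : ∀ᶠ y in cobounded ℂ, ‖R y‖ < 1 := by
    have := h0.norm
    rw [norm_zero] at this
    exact this.eventually_lt_const one_pos
  obtain ⟨ρ, hρ, hρz⟩ : ∃ ρ, (∀ y, ρ ≤ ‖y‖ → ‖R y‖ < 1) ∧ ‖z‖ < ρ := by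
    rw [← comap_norm_atTop, eventually_comap] at hev
    obtain ⟨ρ, hρ⟩ := (hev.and (eventually_gt_atTop 0)).exists_forall_of_atTop
    refine ⟨max ρ (‖z‖ + 1), fun y hy => (hρ ‖y‖ ((le_max_left _ _).trans hy)).1 y rfl, ?_⟩
    exact lt_of_lt_of_le (by linarith) (le_max_right _ _)
  have hdisj : Disjoint (interior K)ᶜ P := disjoint_compl_left.mono_right hP
  have hcl : closure (Kᶜ ∩ ball 0 ρ) ⊆ (interior K)ᶜ := by
    rw [← closure_compl]; exact closure_mono inter_subset_left
  have hd : DiffContOnCl ℂ (fun y => Complex.exp (-(1 + R y))) (Kᶜ ∩ ball 0 ρ) := by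
    have h1 : DifferentiableOn ℂ (fun y => Complex.exp (-(1 + R y))) (interior K)ᶜ :=
      (((hR.diffOn hdisj).const_add 1).neg).cexp
    exact ⟨h1.mono (subset_closure.trans hcl), h1.continuousOn.mono hcl⟩
  have hb := Complex.norm_le_of_forall_mem_frontier_norm_le (U := Kᶜ ∩ ball 0 ρ) (C := 1)
    (isBounded_ball.subset inter_subset_right) hd (by
      intro y hy
      rw [Complex.norm_exp, Real.exp_le_one_iff, neg_re, neg_nonpos]
      rcases frontier_inter_subset _ _ hy with h1 | h1
      · have := h1.1
        rw [frontier_compl] at this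
        exact hpos y this
      · have h2 := frontier_ball_subset_sphere h1.2
        rw [mem_sphere_zero_iff_norm] at h2
        have h3 := hρ y h2.ge
        have h4 := (abs_le.1 (Complex.abs_re_le_norm (R y))).1
        rw [add_re, one_re]; linarith)
    (subset_closure ⟨hz, by rwa [mem_ball_zero_iff]⟩)
  rw [Complex.norm_exp, Real.exp_le_one_iff, neg_re, neg_nonpos] at hb
  exact hb

lemma Geo.cap_ge_good (h : Geo B T C) (hK : IsCompact K) (hconn : IsConnected Kᶜ) {P : Set ℂ} (hP : P ⊆ interior K)
    {R : ℂ → ℂ} {a : ℂ} (hR : Good P R a) (hpos : ∀ w ∈ frontier K, 0 ≤ (1 + R w).re) :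
    a.re / 2 ≤ analyticCapacity K := by
  have hp : ∀ z ∈ Kᶜ, 0 ≤ (1 + R z).re := fun z hz => good_pos hK hP hR hpos hz
  have hre : ∀ z ∈ Kᶜ, 1 ≤ (2 + R z).re := fun z hz => by
    have := hp z hz
    rw [add_re, one_re] at this
    rw [add_re]; norm_num; linarith
  have hne : ∀ z ∈ Kᶜ, 2 + R z ≠ 0 := fun z hz h0 => by
    have := hre z hz
    rw [h0, zero_re] at this; linarith
  have h0 := hR.tendsto_zero
  have hlim2 : Tendsto (fun z => 2 + R z) (cobounded ℂ) (𝓝 2) := by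
    simpa using h0.const_add 2
  have hdisj : Disjoint Kᶜ P := disjoint_compl_left.mono_right (hP.trans interior_subset)
  have hdR := hR.diffOn hdisj
  have hmem : ‖a / 2‖ ∈ { r : ℝ | ∃ (f : ℂ → ℂ) (l w : ℂ), DifferentiableOn ℂ f Kᶜ ∧ (∀ z ∈ Kᶜ, ‖f z‖ ≤ 1) ∧
    HasDerivAtInftyOn f Kᶜ l w ∧ r = ‖w‖ } := by
    refine ⟨fun z => R z / (2 + R z), 0, a / 2, hdR.div (hdR.const_add 2) hne, fun z hz => ?_, ?_, rfl⟩
    · rw [norm_div, div_le_one (norm_pos_iff.2 (hne z hz))]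
      rw [← abs_of_nonneg (norm_nonneg (R z)), ← abs_of_nonneg (norm_nonneg (2 + R z))]
      apply sq_le_sq.1
      rw [← Complex.normSq_eq_norm_sq, ← Complex.normSq_eq_norm_sq, Complex.normSq_apply, Complex.normSq_apply]
      have := hp z hz
      simp only [add_re, one_re, add_im, Complex.re_ofNat, Complex.im_ofNat] at this ⊢
      nlinarith
    · rw [HasDerivAtInftyOn, inf_fil hK]
      constructor
      · have h1 := h0.div hlim2 two_ne_zero
        rw [zero_div] at h1
        exact h1
      · refine (hR.2.div hlim2 two_ne_zero).congr fun z => ?_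
        rw [sub_zero, Pi.div_apply, mul_div_assoc]
  refine le_trans ?_ (le_csSup (h.cap_bdd hK hconn) hmem)
  rw [norm_div, Complex.norm_ofNat]
  have := Complex.re_le_norm a
  linarith
end

/-- If `K ⊆ ℂ` is compact with `Ω = ℂ∞ ∖ K` a finitely connected domain
with `C^∞` boundary and `S` contains at least one point of each component of `interior K`,
then for every `ε > 0` there are rational functions `R₁, R₂` vanishing at `∞` with poles in `S`
such that `(1/2π)∫_{∂Ω}|1 + R₂|²|dz| − ε ≤ γ(K) ≤ 2 Re R₁′(∞) − (1/2π)∫_{∂Ω}|R₁|²|dz| + ε`. -/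
theorem capacity_rational_bounds (K : Set ℂ) (hK : IsCompact K)
    (hconn : IsConnected Kᶜ) (B : SmoothBoundary K) (S : Set ℂ)
    (hS : ∀ z ∈ interior K, ∃ s ∈ S, s ∈ connectedComponentIn (interior K) z) :
    ∀ ε > (0:ℝ), ∃ (R₁ R₂ : ℂ → ℂ) (w : ℂ),
      IsRationalVanishingAtInftyWithPoles S R₁ ∧
      IsRationalVanishingAtInftyWithPoles S R₂ ∧
      Tendsto (fun z => z * R₁ z) (cobounded ℂ ⊓ 𝓟 Kᶜ) (𝓝 w) ∧
      1 / (2 * Real.pi) * arcIntegralOf B.curve (fun z => ‖1 + R₂ z‖ ^ 2) - ε ≤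
        analyticCapacity K ∧
      analyticCapacity K ≤
        2 * w.re - 1 / (2 * Real.pi) * arcIntegralOf B.curve (fun z => ‖R₁ z‖ ^ 2) + ε := by
  intro ε hε
  have hπ : (0:ℝ) < 2 * Real.pi := by positivity
  have hπ3 := Real.pi_gt_three
  obtain ⟨T, C, h⟩ := exists_geo B
  obtain ⟨P, hPd⟩ : ∃ P, P = S ∩ interior K := ⟨_, rfl⟩
  have hP : P ⊆ interior K := hPd ▸ inter_subset_right
  have hPS : P ⊆ S := hPd ▸ inter_subset_left
  obtain ⟨G, s, α, hG, hp, hk, hGα, hkα, hpT, hs, hsT, hsR⟩ := h.exists_ext hK hconn hS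
  -- lower bound for the capacity
  have hge : α ≤ analyticCapacity K := by
    apply le_of_forall_pos_le_add
    intro η hη
    obtain ⟨R, hR, hpos, hlt⟩ := h.exists_pos hK hconn hS hs hsT hη
    obtain ⟨a, ha⟩ := good_of_mem hR
    have h1 := hsR R hR a ha 1
    have h2 := h.cap_ge_good hK hconn inter_subset_right ha hpos
    rw [h1, show (2 * (Real.pi : ℂ) * (2 * α * 1 - a)) = ((2 * Real.pi : ℝ) : ℂ) * (((2 * α : ℝ) : ℂ) - a) by push_cast; ring,
      re_ofReal_mul, sub_re, ofReal_re] at hlt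
    by_contra! hcon
    have h3 : 2 * η < 2 * α - a.re := by linarith
    nlinarith
  rw [← hPd] at hp hk
  have hTl : MemLp T 2 (sig B) := l2_cont B hK h.contTg.continuousOn
  have hGl : MemLp G 2 (sig B) := l2_cont B hK hG
  -- approximants of `1 - G`
  have hR2 : ∀ η > 0, ∃ R ∈ Rsp P, ∃ a, Good P R a ∧
      ∫ w, ‖1 + R w‖ ^ 2 ∂(sig B) ≤ 2 * Real.pi * α + η ∧ 2 * Real.pi * ‖a‖ ≤ η := by
    intro η hη
    obtain ⟨ε₁, hε₁, hpert⟩ := l2_pert hGl hTl hη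
    obtain ⟨R, hR, hRε⟩ := hp.2 ε₁ hε₁
    have hRl : MemLp R 2 (sig B) := l2_cont B hK (rsp_cont hP hR)
    obtain ⟨h1, h2⟩ := hpert (fun w => (1 - G w) - R w) (hp.1.sub hRl) hRε
    have hR' : (-1 : ℂ) • R ∈ Rsp P := Submodule.smul_mem _ _ hR
    obtain ⟨a, ha⟩ := good_of_mem hR'
    refine ⟨_, hR', a, ha, ?_, ?_⟩
    · rw [hGα] at h1
      refine le_trans (le_of_eq ?_) h1
      congr 1; ext w
      simp only [Pi.smul_apply, smul_eq_mul]
      congr 2; ring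
    · have h3 := h.good_int hK hP ha
      have e : ∫ w, ((1 - G w) - R w) * T w ∂(sig B) = ∫ w, ((-1 : ℂ) • R) w * T w ∂(sig B) := by
        have e1 := integral_add (f := fun w => (1 - G w) * T w) (g := fun w => ((-1 : ℂ) • R) w * T w) (l2_mul hp.1 hTl)
          (l2_mul (hRl.const_smul (-1 : ℂ)) hTl)
        rw [hpT, zero_add] at e1
        rw [← e1]
        congr 1; ext w
        simp only [Pi.smul_apply, smul_eq_mul]; ring
      rw [e, h3, norm_mul, norm_mul, norm_mul, norm_I, Complex.norm_ofNat, Complex.norm_real,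
        Real.norm_of_nonneg Real.pi_pos.le, mul_one] at h2
      exact h2
  have hle : analyticCapacity K ≤ α := by
    apply le_of_forall_pos_le_add
    intro η hη
    obtain ⟨R, hR, a, ha, h1, h2⟩ := hR2 η hη
    have h3 := h.cap_le hK hconn hP ha
    by_contra! hcon
    nlinarith
  obtain ⟨R₂, hR₂, a₂, ha₂, h21, h22⟩ := hR2 ε hε
  -- approximants of `conj (G T)`
  obtain ⟨k, hkd⟩ : ∃ k : ℂ → ℂ, k = fun w => (starRingEnd ℂ) (G w * T w) := ⟨_, rfl⟩
  rw [← hkd] at hk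
  have hkn : ∫ w, ‖k w‖ ^ 2 ∂(sig B) = 2 * Real.pi * α := by
    rw [← hGα]
    apply integral_congr_ae
    filter_upwards [sig_ae_mem B] with w hw
    rw [hkd]
    simp only [RCLike.norm_conj, norm_mul, h.norm_T hw, mul_one]
  have hkT : ∫ w, k w * T w ∂(sig B) = 2 * Real.pi * α := by rw [hkd]; exact hkα
  obtain ⟨ε₁, hε₁, hpert⟩ := l2_pert hk.1 hTl hε
  obtain ⟨Q, hQ, hQε⟩ := hk.2 ε₁ hε₁
  have hQl : MemLp Q 2 (sig B) := l2_cont B hK (rsp_cont hP hQ)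
  obtain ⟨h11, h12⟩ := hpert (fun w => Q w - k w) (hQl.sub hk.1) (by
    refine lt_of_eq_of_lt ?_ hQε
    congr 1; ext w; rw [norm_sub_rev])
  obtain ⟨a, ha⟩ := good_of_mem hQ
  have hgood := ha.smul I
  have hQn : ∫ w, ‖(I • Q) w‖ ^ 2 ∂(sig B) ≤ 2 * Real.pi * α + ε := by
    rw [hkn] at h11
    refine le_trans (le_of_eq ?_) h11
    congr 1; ext w
    rw [Pi.smul_apply, norm_smul, norm_I, one_mul]
    congr 2; ring
  have hw : |2 * Real.pi * (I * a).re - 2 * Real.pi * α| ≤ ε := by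
    have h3 := h.good_int hK hP ha
    have e1 := integral_sub (f := fun w => Q w * T w) (g := fun w => k w * T w) (l2_mul hQl hTl) (l2_mul hk.1 hTl)
    have e : ∫ w, (Q w - k w) * T w ∂(sig B) = ((2 * Real.pi : ℝ) : ℂ) * (I * a) - ((2 * Real.pi * α : ℝ) : ℂ) := by
      rw [h3, hkT] at e1
      rw [show ((2 * Real.pi : ℝ) : ℂ) * (I * a) - ((2 * Real.pi * α : ℝ) : ℂ) = 2 * Real.pi * I * a - 2 * Real.pi * α by push_cast; ring, ← e1]
      congr 1; ext w; ring
    rw [e] at h12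
    have h4 := (Complex.abs_re_le_norm _).trans h12
    rwa [sub_re, re_ofReal_mul, ofReal_re] at h4
  refine ⟨I • Q, R₂, I * a, ?_, ?_, ?_, ?_, ?_⟩
  · exact Rsp.isRational hPS (Submodule.smul_mem _ _ hQ)
  · exact Rsp.isRational hPS hR₂
  · exact hgood.2.mono_left inf_le_left
  · have hc : ContinuousOn (fun z => ‖1 + R₂ z‖ ^ 2) (frontier K) :=
      (continuousOn_const.add (rsp_cont hP hR₂)).norm.pow 2
    rw [arc_sig B hK hc]
    have h5 : 1 / (2 * Real.pi) * ∫ w, ‖1 + R₂ w‖ ^ 2 ∂(sig B) ≤ α + ε := by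
      rw [one_div, inv_mul_le_iff₀ hπ]
      nlinarith
    linarith
  · have hc : ContinuousOn (fun z => ‖(I • Q) z‖ ^ 2) (frontier K) :=
      (rsp_cont hP (Submodule.smul_mem _ I hQ)).norm.pow 2
    rw [arc_sig B hK hc]
    rw [abs_le] at hw
    have h5 : 1 / (2 * Real.pi) * ∫ w, ‖(I • Q) w‖ ^ 2 ∂(sig B) ≤ α + ε / 6 := by
      rw [one_div, inv_mul_le_iff₀ hπ]
      nlinarith
    have h6 : α - ε / 6 ≤ (I * a).re := by
      by_contra! hcon
      nlinarith [hw.1]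
    linarith
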